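/- For every integer n with n ≡ 6 (mod 8) and n ≥ 342 there exists a cyclically 6-connected strictly critical snark of order n. -/

import Mathlib

/-- The colour set `K = (ℤ₂ × ℤ₂) ∖ {(0,0)}`. -/
abbrev Kol : Type := {x : ZMod 2 × ZMod 2 // x ≠ 0}

/-- A proper edge colouring: distinct edges sharing a vertex get distinct colours. -/
def IsProperEdgeColoring {V C : Type*} (G : SimpleGraph V) (f : Sym2 V → C) : Prop :=
  ∀ e₁ ∈ G.edgeSet, ∀ e₂ ∈ G.edgeSet, e₁ ≠ e₂ → (∃ v : V, v ∈ e₁ ∧ v ∈ e₂) → f e₁ ≠ f e₂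

/-- A graph is 3-edge-colourable if it has a proper edge colouring with three colours. -/
def ThreeEdgeColorable {V : Type*} (G : SimpleGraph V) : Prop :=
  ∃ f : Sym2 V → Kol, IsProperEdgeColoring G f

/-- A graph is cubic if every vertex has degree 3. -/
def IsCubic {V : Type*} (G : SimpleGraph V) : Prop :=
  ∀ v : V, (G.neighborSet v).ncard = 3

/-- A snark: a connected cubic simple graph which is not 3-edge-colourable. -/
def IsSnark {V : Type*} (G : SimpleGraph V) : Prop :=
  G.Connected ∧ IsCubic G ∧ ¬ ThreeEdgeColorable G

/-- A snark is critical if removing any two distinct adjacent vertices yields a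
3-edge-colourable graph. -/
def Critical {V : Type*} (G : SimpleGraph V) : Prop :=
  ∀ u v : V, G.Adj u v → ThreeEdgeColorable (G.induce ({u, v}ᶜ : Set V))

/-- A snark is bicritical if removing any two distinct vertices yields a
3-edge-colourable graph. -/
def Bicritical {V : Type*} (G : SimpleGraph V) : Prop :=
  ∀ u v : V, u ≠ v → ThreeEdgeColorable (G.induce ({u, v}ᶜ : Set V))

/-- Strictly critical: critical but not bicritical. -/
def StrictlyCritical {V : Type*} (G : SimpleGraph V) : Prop :=
  Critical G ∧ ¬ Bicritical G

/-- A cubic graph is cyclically `k`-connected if no set of fewer than `k` edges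
separates two cycles, i.e. there is no set `F` of fewer than `k` edges whose deletion
leaves a graph in which two connected components contain a cycle. -/
def CyclicallyConnected {V : Type*} (G : SimpleGraph V) (k : ℕ) : Prop :=
  ¬ ∃ F : Set (Sym2 V), F ⊆ G.edgeSet ∧ F.ncard < k ∧
    ∃ a b : V, (∃ w : (G.deleteEdges F).Walk a a, w.IsCycle) ∧
               (∃ w : (G.deleteEdges F).Walk b b, w.IsCycle) ∧
               ¬ (G.deleteEdges F).Reachable a b

/-- The cyclic connectivity of a cubic graph: the largest `k` (at most the number of
edges) such that the graph is cyclically `k`-connected. -/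
noncomputable def cyclicConnectivity {V : Type*} (G : SimpleGraph V) : ℕ :=
  sSup {k | k ≤ G.edgeSet.ncard ∧ CyclicallyConnected G k}

/-- Being three-edge-colourable passes to graphs embedding into a colourable graph. -/
theorem ThreeEdgeColorable.of_embedding {V W : Type*} {G : SimpleGraph V} {H : SimpleGraph W}
    (φ : G ↪g H) (h : ThreeEdgeColorable H) : ThreeEdgeColorable G := by
  obtain ⟨f, hf⟩ := h
  have hinj : Function.Injective (Sym2.map φ) := Sym2.map.injective φ.injective
  refine ⟨fun e => f (e.map φ), fun e₁ h₁ e₂ h₂ hne ⟨v, hv₁, hv₂⟩ => ?_⟩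
  have key : ∀ e ∈ G.edgeSet, e.map φ ∈ H.edgeSet := by
    intro e
    induction e with
    | h x y => simp
  exact hf _ (key _ h₁) _ (key _ h₂) (hinj.ne hne)
    ⟨φ v, Sym2.mem_map.2 ⟨v, hv₁, rfl⟩, Sym2.mem_map.2 ⟨v, hv₂, rfl⟩⟩

theorem ThreeEdgeColorable.iso {V W : Type*} {G : SimpleGraph V} {H : SimpleGraph W}
    (φ : G ≃g H) : ThreeEdgeColorable G ↔ ThreeEdgeColorable H :=
  ⟨fun h => h.of_embedding φ.symm.toEmbedding, fun h => h.of_embedding φ.toEmbedding⟩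

theorem threeEdgeColorable_induce_iso {V W : Type*} {G : SimpleGraph V} {H : SimpleGraph W}
    (φ : G ≃g H) (u v : V) (h : ThreeEdgeColorable (G.induce ({u, v}ᶜ : Set V))) :
    ThreeEdgeColorable (H.induce ({φ u, φ v}ᶜ : Set W)) := by
  have hmem : ∀ x : ({φ u, φ v}ᶜ : Set W), φ.symm x ∈ ({u, v}ᶜ : Set V) := by
    rintro ⟨x, hx⟩
    simp only [Set.mem_compl_iff, Set.mem_insert_iff, Set.mem_singleton_iff, not_or] at hx ⊢
    exact ⟨fun h => hx.1 (by simp [← h]), fun h => hx.2 (by simp [← h])⟩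
  refine h.of_embedding ⟨⟨fun x => ⟨φ.symm x, hmem x⟩, ?_⟩, ?_⟩
  · intro x y hxy
    simpa [Subtype.ext_iff] using hxy
  · intro x y
    exact φ.symm.map_adj_iff

theorem CyclicallyConnected.iso {V W : Type*} {G : SimpleGraph V} {H : SimpleGraph W}
    (φ : G ≃g H) {k : ℕ} (h : CyclicallyConnected G k) : CyclicallyConnected H k := by
  rintro ⟨F, hF, hk, a, b, ⟨w₁, hw₁⟩, ⟨w₂, hw₂⟩, hab⟩
  have hinj : Function.Injective (Sym2.map φ) := Sym2.map.injective φ.injective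
  let ψ : G.deleteEdges (Sym2.map φ ⁻¹' F) ≃g H.deleteEdges F :=
    ⟨φ.toEquiv, by intro x y; simp [φ.map_adj_iff]⟩
  refine h ⟨Sym2.map φ ⁻¹' F, ?_, ?_, φ.symm a, φ.symm b,
    ⟨w₁.map ψ.symm.toHom, hw₁.map ψ.symm.injective⟩,
    ⟨w₂.map ψ.symm.toHom, hw₂.map ψ.symm.injective⟩, ?_⟩
  · intro e he
    have := hF he
    induction e with
    | h x y => simpa [φ.map_adj_iff] using this
  · rwa [Set.ncard_preimage_of_injective_subset_range hinj]
    intro e _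
    induction e with
    | h x y => exact ⟨s(φ.symm x, φ.symm y), by simp⟩
  · intro hr
    exact hab (by simpa [ψ] using hr.map ψ.toHom)

theorem IsCubic.iso {V W : Type*} {G : SimpleGraph V} {H : SimpleGraph W}
    (φ : G ≃g H) (h : IsCubic G) : IsCubic H := by
  intro w
  have := h (φ.symm w)
  rw [← this, ← Nat.card_coe_set_eq, ← Nat.card_coe_set_eq]
  exact Nat.card_congr (φ.symm.mapNeighborSet w)

theorem IsSnark.iso {V W : Type*} {G : SimpleGraph V} {H : SimpleGraph W}
    (φ : G ≃g H) (h : IsSnark G) : IsSnark H :=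
  ⟨φ.connected_iff.1 h.1, h.2.1.iso φ, fun hc => h.2.2 ((ThreeEdgeColorable.iso φ).2 hc)⟩

theorem StrictlyCritical.iso {V W : Type*} {G : SimpleGraph V} {H : SimpleGraph W}
    (φ : G ≃g H) (h : StrictlyCritical G) : StrictlyCritical H := by
  refine ⟨fun u v huv => ?_, fun hb => h.2 fun u v huv => ?_⟩
  · have := threeEdgeColorable_induce_iso φ _ _ (h.1 _ _ (φ.symm.map_adj_iff.2 huv))
    rwa [φ.apply_symm_apply, φ.apply_symm_apply] at this
  · have := threeEdgeColorable_induce_iso φ.symm _ _ (hb _ _ (φ.injective.ne huv))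
    rwa [φ.symm_apply_apply, φ.symm_apply_apply] at this

/-- The edges of a graph joining the two sides of a bipartition of its vertices. -/
def edgeCut {V : Type*} (G : SimpleGraph V) (S : V → Bool) : Set (Sym2 V) :=
  {e | ∃ x y, e = s(x, y) ∧ G.Adj x y ∧ S x ≠ S y}

/-- A bipartition in which every vertex has at most one neighbour on the other side. -/
def IsStable {V : Type*} (G : SimpleGraph V) (S : V → Bool) : Prop :=
  ∀ v x y, G.Adj v x → G.Adj v y → S v ≠ S x → S v ≠ S y → x = y

/-- On a cycle of `G.deleteEdges F` every vertex has two neighbours on the same cycle. -/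
theorem exists_two_neighbors_of_isCycle {V : Type*} {G : SimpleGraph V} {a : V} {w : G.Walk a a}
    (hw : w.IsCycle) {v : V} (hv : v ∈ w.support) :
    ∃ x ∈ w.support, ∃ y ∈ w.support, x ≠ y ∧ G.Adj v x ∧ G.Adj v y := by
  have h2 := hw.ncard_neighborSet_toSubgraph_eq_two hv
  obtain ⟨x, y, hxy, hs⟩ := Set.ncard_eq_two.1 h2
  have hx : w.toSubgraph.Adj v x := by
    rw [← SimpleGraph.Subgraph.mem_neighborSet, hs]; simp
  have hy : w.toSubgraph.Adj v y := by
    rw [← SimpleGraph.Subgraph.mem_neighborSet, hs]; simp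
  exact ⟨x, w.mem_verts_toSubgraph.1 hx.snd_mem, y, w.mem_verts_toSubgraph.1 hy.snd_mem, hxy,
    hx.adj_sub, hy.adj_sub⟩

/-- Moving one vertex with at least two neighbours on the other side decreases the cut. -/
theorem ncard_edgeCut_flip_lt {V : Type*} [Finite V] [DecidableEq V] {G : SimpleGraph V}
    (hG : IsCubic G) (S : V → Bool) {v x y : V} (hxy : x ≠ y) (hx : G.Adj v x) (hy : G.Adj v y)
    (hSx : S v ≠ S x) (hSy : S v ≠ S y) :
    (edgeCut G (Function.update S v (!S v))).ncard < (edgeCut G S).ncard := by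
  classical
  obtain ⟨z, hz⟩ : ∃ z, ∀ u, G.Adj v u → u = x ∨ u = y ∨ u = z := by
    have h3 := hG v
    have hsub : ({x, y} : Set V) ⊆ G.neighborSet v := by
      rintro u (rfl | rfl) <;> assumption
    have h1 : (G.neighborSet v \ {x, y}).ncard = 1 := by
      rw [Set.ncard_sdiff hsub, h3, Set.ncard_pair hxy]
    obtain ⟨z, hz⟩ := Set.ncard_eq_one.1 h1
    refine ⟨z, fun u hu => ?_⟩
    by_contra! hne
    have : u ∈ G.neighborSet v \ {x, y} := ⟨hu, by simp [hne.1, hne.2.1]⟩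
    rw [hz] at this
    exact hne.2.2 this
  have hsub : edgeCut G (Function.update S v (!S v)) ⊆
      insert s(v, z) (edgeCut G S \ {s(v, x), s(v, y)}) := by
    rintro e ⟨p, q, rfl, hpq, hS⟩
    have hflip : ∀ u, G.Adj v u → (!S v) ≠ S u → s(v, u) = s(v, z) := by
      intro u hu hne
      rcases hz u hu with rfl | rfl | rfl
      · cases h1 : S v <;> cases h2 : S u <;> simp_all
      · cases h1 : S v <;> cases h2 : S u <;> simp_all
      · rfl
    by_cases hp : p = v
    · subst hp
      left
      have hq : q ≠ p := hpq.ne'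
      refine hflip q hpq ?_
      simpa [Function.update_of_ne hq] using hS
    · by_cases hq : q = v
      · subst hq
        left
        rw [Sym2.eq_swap]
        refine hflip p hpq.symm ?_
        simpa [Function.update_of_ne hp] using hS.symm
      · right
        refine ⟨⟨p, q, rfl, hpq, by simpa [hp, hq] using hS⟩, ?_⟩
        simp only [Set.mem_insert_iff, Set.mem_singleton_iff, Sym2.eq_iff]
        tauto
  have hmem : ({s(v, x), s(v, y)} : Set (Sym2 V)) ⊆ edgeCut G S := by
    rintro e (rfl | rfl)
    · exact ⟨v, x, rfl, hx, hSx⟩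
    · exact ⟨v, y, rfl, hy, hSy⟩
  have hpair : ({s(v, x), s(v, y)} : Set (Sym2 V)).ncard = 2 := by
    refine Set.ncard_pair fun h => hxy ?_
    rcases Sym2.eq_iff.1 h with h | h
    exacts [h.2, h.2.trans h.1]
  have h1 := Set.ncard_le_ncard hsub (Set.toFinite _)
  have h2 := Set.ncard_insert_le s(v, z) (edgeCut G S \ {s(v, x), s(v, y)})
  have h3 := Set.ncard_sdiff_add_ncard_of_subset hmem (Set.toFinite _)
  omega

/-- To show cyclic connectivity of a cubic graph, it suffices to consider stable cuts. -/
theorem cyclicallyConnected_of_stable {V : Type*} [Finite V] {G : SimpleGraph V}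
    (hG : IsCubic G) {k : ℕ}
    (h : ∀ S : V → Bool, IsStable G S → (∃ a b, S a ≠ S b) → k ≤ (edgeCut G S).ncard) :
    CyclicallyConnected G k := by
  classical
  rintro ⟨F, hF, hk, a, b, ⟨w₁, hw₁⟩, ⟨w₂, hw₂⟩, hab⟩
  have key : ∀ (n : ℕ) (S : V → Bool), (edgeCut G S).ncard = n → n < k →
      (∀ x ∈ w₁.support, S x = true) → (∀ x ∈ w₂.support, S x = false) → False := by
    intro n
    induction n using Nat.strong_induction_on with
    | _ n ih =>
      intro S hn hnk h₁ h₂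
      by_cases hst : IsStable G S
      · have := h S hst ⟨a, b, by simp [h₁ a w₁.start_mem_support, h₂ b w₂.start_mem_support]⟩
        omega
      · simp only [IsStable, not_forall] at hst
        obtain ⟨v, x, y, hx, hy, hSx, hSy, hxy⟩ := hst
        have hlt := ncard_edgeCut_flip_lt hG S hxy hx hy hSx hSy
        have hoff : ∀ {c : V} (w : (G.deleteEdges F).Walk c c) (β : Bool), w.IsCycle →
            (∀ u ∈ w.support, S u = β) → v ∉ w.support := by
          intro c w β hw hβ hv
          obtain ⟨x', hx', y', hy', hne, hax, hay⟩ := exists_two_neighbors_of_isCycle hw hv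
          have hcard : ({x, y, x', y'} : Finset V).card ≤ 3 := by
            rw [← hG v, ← Set.ncard_coe_finset]
            refine Set.ncard_le_ncard ?_ (Set.toFinite _)
            intro u hu
            simp only [Finset.coe_insert, Finset.coe_singleton, Set.mem_insert_iff,
              Set.mem_singleton_iff] at hu
            rcases hu with rfl | rfl | rfl | rfl
            exacts [hx, hy, (SimpleGraph.deleteEdges_adj.1 hax).1,
              (SimpleGraph.deleteEdges_adj.1 hay).1]
          have hd : ∀ z, S v ≠ S z → ∀ z' ∈ w.support, z ≠ z' := by
            rintro z hz z' hz' rfl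
            exact hz ((hβ v hv).trans (hβ z hz').symm)
          have h4 : ({x, y, x', y'} : Finset V).card = 4 := by
            rw [Finset.card_insert_of_notMem, Finset.card_insert_of_notMem,
              Finset.card_pair hne]
            · simp [hd y hSy x' hx', hd y hSy y' hy']
            · simp [hxy, hd x hSx x' hx', hd x hSx y' hy']
          omega
        refine ih _ (hn ▸ hlt) _ rfl (by omega) ?_ ?_
        · intro u hu
          rw [Function.update_of_ne]
          · exact h₁ u hu
          · rintro rfl
            exact hoff w₁ true hw₁ h₁ hu
        · intro u hu
          rw [Function.update_of_ne]
          · exact h₂ u hu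
          · rintro rfl
            exact hoff w₂ false hw₂ h₂ hu
  refine key _ (fun x => decide ((G.deleteEdges F).Reachable a x)) rfl ?_ ?_ ?_
  · refine (Set.ncard_le_ncard ?_ (Set.toFinite _)).trans_lt hk
    rintro e ⟨x, y, rfl, hxy, hne⟩
    by_contra he
    have hadj : (G.deleteEdges F).Adj x y := SimpleGraph.deleteEdges_adj.2 ⟨hxy, he⟩
    refine hne ?_
    rw [decide_eq_decide]
    exact ⟨fun hr => hr.trans hadj.reachable, fun hr => hr.trans hadj.symm.reachable⟩
  · intro x hx
    simpa using ⟨w₁.takeUntil x hx⟩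
  · intro x hx
    simp only [decide_eq_false_iff_not]
    intro hr
    exact hab (hr.trans ⟨(w₂.takeUntil x hx).reverse⟩)

theorem connected_of_stable {V : Type*} [Nonempty V] {G : SimpleGraph V}
    (h : ∀ S : V → Bool, IsStable G S → (∃ a b, S a ≠ S b) → 0 < (edgeCut G S).ncard) :
    G.Connected := by
  classical
  refine ⟨fun a b => ?_⟩
  by_contra hab
  have hS : ∀ x y, G.Adj x y → decide (G.Reachable a x) = decide (G.Reachable a y) := by
    intro x y hxy
    rw [decide_eq_decide]
    exact ⟨fun hr => hr.trans hxy.reachable, fun hr => hr.trans hxy.symm.reachable⟩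
  have h0 := h (fun x => decide (G.Reachable a x))
    (fun v x _ hx _ hne _ => absurd (hS v x hx) hne) ⟨a, b, by simp [hab]⟩
  have : edgeCut G (fun x => decide (G.Reachable a x)) = ∅ := by
    rw [Set.eq_empty_iff_forall_notMem]
    rintro e ⟨x, y, -, hxy, hne⟩
    exact hne (hS x y hxy)
  rw [this, Set.ncard_empty] at h0
  exact h0.false

/-- A cubic simple graph presented by its darts: every vertex has three ports, and `rot` sends a
port to the port at the other end of its edge. -/
structure Rotation (V : Type*) where
  rot : V × Fin 3 → V × Fin 3
  rot_rot : ∀ d, rot (rot d) = d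
  nbr_injective : ∀ v, Function.Injective fun i => (rot (v, i)).1
  nbr_ne : ∀ v i, (rot (v, i)).1 ≠ v

namespace Rotation

variable {V : Type*} (R : Rotation V)

/-- The neighbour of `v` along port `i`. -/
def nbr (v : V) (i : Fin 3) : V := (R.rot (v, i)).1

theorem nbr_rot (d : V × Fin 3) : R.nbr (R.rot d).1 (R.rot d).2 = d.1 := by
  simp [nbr, R.rot_rot]

/-- The underlying simple graph. -/
def graph : SimpleGraph V where
  Adj u v := ∃ i, R.nbr u i = v
  symm := ⟨by
    rintro u v ⟨i, rfl⟩
    exact ⟨(R.rot (u, i)).2, R.nbr_rot (u, i)⟩⟩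
  loopless := ⟨fun v ⟨i, hi⟩ => R.nbr_ne v i hi⟩

theorem graph_adj {u v : V} : R.graph.Adj u v ↔ ∃ i, R.nbr u i = v := Iff.rfl

theorem adj_nbr (v : V) (i : Fin 3) : R.graph.Adj v (R.nbr v i) := ⟨i, rfl⟩

theorem isCubic : IsCubic R.graph := by
  intro v
  have : R.graph.neighborSet v = Set.range (R.nbr v) := by
    ext u
    simp [graph_adj]
  rw [this, ← Set.image_univ, Set.ncard_image_of_injective (f := R.nbr v) _ (R.nbr_injective v),
    Set.ncard_univ]
  simp

/-- The edge of a dart. -/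
def edge (d : V × Fin 3) : Sym2 V := s(d.1, R.nbr d.1 d.2)

theorem edge_rot (d : V × Fin 3) : R.edge (R.rot d) = R.edge d := by
  simp only [edge, R.nbr_rot]
  exact Sym2.eq_swap

theorem edge_eq_iff {d d' : V × Fin 3} : R.edge d = R.edge d' ↔ d' = d ∨ d' = R.rot d := by
  constructor
  · intro h
    rcases Sym2.eq_iff.1 h with ⟨h₁, h₂⟩ | ⟨h₁, h₂⟩
    · left
      rw [h₁] at h₂
      exact Prod.ext h₁.symm (R.nbr_injective _ h₂.symm)
    · right
      have h3 : d'.1 = (R.rot d).1 := h₂.symm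
      refine Prod.ext h3 (R.nbr_injective d'.1 ?_)
      change R.nbr d'.1 d'.2 = R.nbr d'.1 (R.rot d).2
      rw [← h₁, h3, R.nbr_rot]
  · rintro (rfl | rfl)
    · rfl
    · exact (R.edge_rot d).symm

/-- A function on darts which agrees on both ends of each edge comes from a function on edges. -/
theorem exists_edge_function {C : Type*} [Nonempty C] (c : V × Fin 3 → C)
    (hc : ∀ d, c (R.rot d) = c d) : ∃ g : Sym2 V → C, ∀ d, g (R.edge d) = c d := by
  classical
  refine ⟨fun e => if h : ∃ d, R.edge d = e then c h.choose else Classical.arbitrary C,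
    fun d => ?_⟩
  have h : ∃ d', R.edge d' = R.edge d := ⟨d, rfl⟩
  simp only [dif_pos h]
  rcases R.edge_eq_iff.1 h.choose_spec.symm with h' | h'
  · rw [h']
  · rw [h', hc]

theorem threeEdgeColorable_induce (A : Set V) (c : V × Fin 3 → Kol)
    (hc : ∀ d, c (R.rot d) = c d) (hinj : ∀ v ∈ A, Function.Injective fun i => c (v, i)) :
    ThreeEdgeColorable (R.graph.induce A) := by
  obtain ⟨g, hg⟩ : ∃ g : Sym2 V → Kol, ∀ d, g (R.edge d) = c d :=
    haveI : Nonempty Kol := ⟨⟨(1, 0), by decide⟩⟩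
    R.exists_edge_function c hc
  refine ⟨fun e => g (e.map Subtype.val), ?_⟩
  rintro e₁ h₁ e₂ h₂ hne ⟨v, ⟨x, rfl⟩, ⟨y, rfl⟩⟩
  obtain ⟨i, hi⟩ : R.graph.Adj v x := h₁
  obtain ⟨j, hj⟩ : R.graph.Adj v y := h₂
  have hij : i ≠ j := by
    rintro rfl
    exact hne (by rw [Subtype.ext (hi.symm.trans hj)])
  simp only [Sym2.map_mk, ← hi, ← hj]
  have := (hinj v v.2).ne hij
  rwa [← hg, ← hg] at this

/-- A colouring of the graph induced on `A`, as a function on all darts. -/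
theorem exists_dart_coloring {A : Set V} (h : ThreeEdgeColorable (R.graph.induce A)) :
    ∃ c : V × Fin 3 → Kol, (∀ d, c (R.rot d) = c d) ∧
      ∀ v i j, v ∈ A → R.nbr v i ∈ A → R.nbr v j ∈ A → i ≠ j → c (v, i) ≠ c (v, j) := by
  classical
  obtain ⟨f, hf⟩ := h
  have k₀ : Kol := ⟨(1, 0), by decide⟩
  refine ⟨fun d => if h : d.1 ∈ A ∧ R.nbr d.1 d.2 ∈ A then f s(⟨d.1, h.1⟩, ⟨_, h.2⟩) else k₀,
    fun d => ?_, fun v i j hv hi hj hij => ?_⟩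
  · by_cases h : d.1 ∈ A ∧ R.nbr d.1 d.2 ∈ A
    · have h' : (R.rot d).1 ∈ A ∧ R.nbr (R.rot d).1 (R.rot d).2 ∈ A := by
        rw [R.nbr_rot]
        exact h.symm
      simp only [dif_pos h, dif_pos h']
      congr 1
      rw [Sym2.eq_swap, Sym2.eq_iff]
      left
      exact ⟨Subtype.ext (R.nbr_rot d), rfl⟩
    · have h' : ¬((R.rot d).1 ∈ A ∧ R.nbr (R.rot d).1 (R.rot d).2 ∈ A) := by
        rw [R.nbr_rot]
        exact fun h' => h h'.symm
      simp only [dif_neg h, dif_neg h']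
  · simp only [dif_pos (And.intro hv hi), dif_pos (And.intro hv hj)]
    refine hf _ (R.adj_nbr v i) _ (R.adj_nbr v j) ?_ ⟨⟨v, hv⟩, by simp, by simp⟩
    intro h
    rw [Sym2.congr_right, Subtype.mk.injEq] at h
    exact hij (R.nbr_injective v h)

/-- Whether the edge of a dart crosses from one side of `S` to the other. -/
def cross (S : V → Bool) (d : V × Fin 3) : ℕ := (S d.1 ^^ S (R.nbr d.1 d.2)).toNat

theorem sum_cross_le [Fintype V] (S : V → Bool) :
    ∑ d, R.cross S d ≤ 2 * (edgeCut R.graph S).ncard := by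
  classical
  have h₁ : ∑ d, R.cross S d =
      (Finset.univ.filter fun d : V × Fin 3 => S d.1 ≠ S (R.nbr d.1 d.2)).card := by
    rw [Finset.card_filter]
    refine Finset.sum_congr rfl fun d _ => ?_
    cases h1 : S d.1 <;> cases h2 : S (R.nbr d.1 d.2) <;> simp [cross, h1, h2]
  rw [h₁]
  set D := Finset.univ.filter fun d : V × Fin 3 => S d.1 ≠ S (R.nbr d.1 d.2)
  have h₂ := Finset.card_le_mul_card_image (f := R.edge) D 2 (by
    intro e he
    obtain ⟨d, -, rfl⟩ := Finset.mem_image.1 he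
    refine (Finset.card_le_card (t := {d, R.rot d}) fun d' hd' => ?_).trans Finset.card_le_two
    have := (Finset.mem_filter.1 hd').2
    simpa using R.edge_eq_iff.1 this.symm)
  refine h₂.trans (Nat.mul_le_mul_left 2 ?_)
  rw [← Set.ncard_coe_finset]
  refine Set.ncard_le_ncard ?_ (Set.toFinite _)
  intro e he
  obtain ⟨d, hd, rfl⟩ := Finset.mem_image.1 he
  exact ⟨d.1, R.nbr d.1 d.2, rfl, R.adj_nbr _ _, (Finset.mem_filter.1 hd).2⟩

end Rotation

/-- Vertices of a superposition of the Petersen graph: eight long pieces, each a segment of a flower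
snark with a chain of `ℓ p + 1` claws and with `2 × 3` vertices having a free port, two triples of
hub vertices, and eight further vertices. -/
inductive Vert (ℓ : Fin 8 → ℕ) : Type
  | port (p : Fin 8) (s : Bool) (t : Fin 3)
  | hub (s : Bool) (t : Fin 3)
  | out (x : Fin 8)
  | leaf (p : Fin 8) (j : Fin (ℓ p + 1)) (t : Fin 3)
  | ctr (p : Fin 8) (j : Fin (ℓ p + 1))

/-- The ports outside the pieces. -/
abbrev OuterDart : Type := (Fin 8 × Bool × Fin 3) ⊕ (Bool × Fin 3 × Fin 3) ⊕ (Fin 8 × Fin 3)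

/-- The piece whose ports are joined to the `i`-th port of the hub vertices. -/
def hubPiece : Bool → Fin 3 → Fin 8
  | false => ![0, 3, 6]
  | true => ![2, 5, 7]

/-- The vertex in the junction following a piece. -/
def junction : Fin 8 → Fin 8 := ![0, 1, 0, 2, 3, 0, 4, 0]

/-- The ports joined to the free ports of the pieces. -/
def portMate : Fin 8 → Bool → Fin 3 → OuterDart
  | 0, false, t => .inr (.inl (false, t, 0))
  | 3, false, t => .inr (.inl (false, t, 1))
  | 6, false, t => .inr (.inl (false, t, 2))
  | 2, true, t => .inr (.inl (true, t, 0))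
  | 5, true, t => .inr (.inl (true, t, 1))
  | 7, true, t => .inr (.inl (true, t, 2))
  | p, true, 0 => .inr (.inr (junction p, 0))
  | p, false, 0 => .inr (.inr (junction (p - 1), 1))
  | p, true, t => .inl (p + 1, false, t)
  | p, false, t => .inl (p - 1, true, t)

/-- The ports joined to those of the eight further vertices. -/
def outMate : Fin 8 → Fin 3 → OuterDart :=
  ![![.inl (0, true, 0), .inl (1, false, 0), .inr (.inr (5, 0))],
    ![.inl (1, true, 0), .inl (2, false, 0), .inr (.inr (6, 0))],
    ![.inl (3, true, 0), .inl (4, false, 0), .inr (.inr (6, 1))],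
    ![.inl (4, true, 0), .inl (5, false, 0), .inr (.inr (5, 1))],
    ![.inl (6, true, 0), .inl (7, false, 0), .inr (.inr (7, 0))],
    ![.inr (.inr (0, 2)), .inr (.inr (3, 2)), .inr (.inr (7, 1))],
    ![.inr (.inr (1, 2)), .inr (.inr (2, 2)), .inr (.inr (7, 2))],
    ![.inr (.inr (4, 2)), .inr (.inr (5, 2)), .inr (.inr (6, 2))]]

/-- The pairing of the ports outside the pieces. -/
def mate : OuterDart → OuterDart
  | .inl (p, s, t) => portMate p s t
  | .inr (.inl (s, t, i)) => .inl (hubPiece s i, s, t)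
  | .inr (.inr (x, i)) => outMate x i

theorem mate_mate : ∀ d, mate (mate d) = d := by decide +kernel

/-- Exchange of the last two tracks. -/
def twist : Fin 3 → Fin 3 := ![0, 2, 1]

theorem twist_twist : ∀ t, twist (twist t) = t := by decide

theorem sum_twist (f : Fin 3 → ℕ) : ∑ t, f (twist t) = ∑ t, f t := by
  simp only [Fin.sum_univ_three]
  exact add_right_comm _ _ _

namespace Vert

variable {ℓ : Fin 8 → ℕ}

def ofOuter : OuterDart → Vert ℓ × Fin 3
  | .inl (p, s, t) => (port p s t, 2)
  | .inr (.inl (s, t, i)) => (hub s t, i)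
  | .inr (.inr (x, i)) => (out x, i)

def rotFun : Vert ℓ × Fin 3 → Vert ℓ × Fin 3
  | (port p s t, 0) => (port p (!s) t, 0)
  | (port p true t, 1) => (leaf p 0 t, 0)
  | (port p false t, 1) => (leaf p (Fin.last (ℓ p)) (twist t), 1)
  | (port p s t, 2) => ofOuter (mate (.inl (p, s, t)))
  | (hub s t, i) => ofOuter (mate (.inr (.inl (s, t, i))))
  | (out x, i) => ofOuter (mate (.inr (.inr (x, i))))
  | (leaf p j t, 0) => if h : j.1 = 0 then (port p true t, 1) else (leaf p ⟨j.1 - 1, by omega⟩ t, 1)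
  | (leaf p j t, 1) =>
    if h : j.1 < ℓ p then (leaf p ⟨j.1 + 1, by omega⟩ t, 0) else (port p false (twist t), 1)
  | (leaf p j t, 2) => (ctr p j, t)
  | (ctr p j, t) => (leaf p j t, 2)

theorem rotFun_ofOuter (d : OuterDart) :
    rotFun (ofOuter d : Vert ℓ × Fin 3) = ofOuter (mate d) := by
  rcases d with ⟨p, s, t⟩ | ⟨s, t, i⟩ | ⟨x, i⟩
  · cases s <;> rfl
  · rfl
  · rfl

theorem rotFun_rotFun (d : Vert ℓ × Fin 3) : rotFun (rotFun d) = d := by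
  have houter : ∀ e : OuterDart, rotFun (rotFun (ofOuter e : Vert ℓ × Fin 3)) = ofOuter e := by
    intro e
    rw [rotFun_ofOuter, rotFun_ofOuter, mate_mate]
  obtain ⟨v, i⟩ := d
  cases v with
  | port p s t =>
    fin_cases i
    · cases s <;> rfl
    · cases s
      · simp [rotFun, twist_twist]
      · simp [rotFun]
    · exact houter (.inl (p, s, t))
  | hub s t => exact houter (.inr (.inl (s, t, i)))
  | out x => exact houter (.inr (.inr (x, i)))
  | leaf p j t =>
    obtain ⟨j, hj⟩ := j
    fin_cases i
    · by_cases h : j = 0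
      · subst h
        simp [rotFun]
      · have h1 : j - 1 < ℓ p := by omega
        have h2 : j - 1 + 1 = j := by omega
        simp [rotFun, h, h1, h2]
    · by_cases h : j < ℓ p
      · simp [rotFun, h]
      · have h2 : j = ℓ p := by omega
        subst h2
        simp [rotFun, twist_twist, Fin.last]
    · rfl
  | ctr p j =>
    rfl

/-- The outer end of an outer dart, as a port of a piece or an outer vertex. -/
def outerVertex : OuterDart → (Fin 8 × Bool × Fin 3) ⊕ (Bool × Fin 3) ⊕ Fin 8
  | .inl q => .inl q
  | .inr (.inl (s, t, _)) => .inr (.inl (s, t))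
  | .inr (.inr (x, _)) => .inr (.inr x)

def ofVertex : (Fin 8 × Bool × Fin 3) ⊕ (Bool × Fin 3) ⊕ Fin 8 → Vert ℓ
  | .inl (p, s, t) => port p s t
  | .inr (.inl (s, t)) => hub s t
  | .inr (.inr x) => out x

theorem ofVertex_injective : Function.Injective (ofVertex (ℓ := ℓ)) := by
  rintro (⟨p, s, t⟩ | ⟨s, t⟩ | x) (⟨p', s', t'⟩ | ⟨s', t'⟩ | x') h <;> simp_all [ofVertex]

theorem ofOuter_fst (d : OuterDart) : (ofOuter d : Vert ℓ × Fin 3).1 = ofVertex (outerVertex d) := by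
  rcases d with ⟨p, s, t⟩ | ⟨s, t, i⟩ | ⟨x, i⟩ <;> rfl

theorem outerVertex_mate_ne : ∀ d, outerVertex (mate d) ≠ outerVertex d := by decide +kernel

theorem outerVertex_mate_port_ne :
    ∀ p s t, outerVertex (mate (.inl (p, s, t))) ≠ .inl (p, !s, t) := by decide +kernel

theorem outerVertex_mate_hub : ∀ s t i j, outerVertex (mate (.inr (.inl (s, t, i)))) =
    outerVertex (mate (.inr (.inl (s, t, j)))) → i = j := by decide +kernel

theorem outerVertex_mate_out : ∀ x i j, outerVertex (mate (.inr (.inr (x, i)))) =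
    outerVertex (mate (.inr (.inr (x, j)))) → i = j := by decide +kernel

theorem rotFun_fst_injective (v : Vert ℓ) : Function.Injective fun i => (rotFun (v, i)).1 := by
  suffices h : ∀ i j, i < j → (rotFun (v, i)).1 ≠ (rotFun (v, j)).1 by
    intro i j hij
    rcases lt_trichotomy i j with hlt | heq | hgt
    exacts [absurd hij (h i j hlt), heq, absurd hij.symm (h j i hgt)]
  intro i j hij
  cases v with
  | port p s t =>
    have hv : ∀ w, (rotFun ((port p s t : Vert ℓ), 2)).1 = w →
        ∃ y, w = ofVertex y ∧ y = outerVertex (mate (.inl (p, s, t))) := by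
      rintro w rfl
      refine ⟨_, ?_, rfl⟩
      rw [← ofOuter_fst]
      cases s <;> rfl
    have h₁ : ∀ y p' j' t', (ofVertex y : Vert ℓ) ≠ leaf p' j' t' := by
      rintro (_ | _ | _) p' j' t' h <;> cases h
    obtain ⟨y, hy, rfl⟩ := hv _ rfl
    fin_cases i <;> fin_cases j <;> first | exact absurd hij (by decide) | skip
    · cases s <;> simp [rotFun]
    · intro h
      refine outerVertex_mate_port_ne p s t (ofVertex_injective (ℓ := ℓ) ?_)
      rw [← hy]
      exact h.symm.trans (by cases s <;> rfl)
    · intro h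
      change _ = (rotFun (port p s t, 2)).1 at h
      rw [hy] at h
      cases s <;> exact h₁ _ _ _ _ h.symm
  | hub s t =>
    intro h
    refine hij.ne (outerVertex_mate_hub s t i j (ofVertex_injective (ℓ := ℓ) ?_))
    rw [← ofOuter_fst, ← ofOuter_fst]
    exact h
  | out x =>
    intro h
    refine hij.ne (outerVertex_mate_out x i j (ofVertex_injective (ℓ := ℓ) ?_))
    rw [← ofOuter_fst, ← ofOuter_fst]
    exact h
  | leaf p k t =>
    fin_cases i <;> fin_cases j <;> first | exact absurd hij (by decide) | skip
    · simp only [rotFun]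
      split_ifs <;> simp
    · simp only [rotFun]
      split_ifs <;> simp
    · simp only [rotFun]
      split_ifs <;> simp
  | ctr p k =>
    intro h
    simp only [rotFun, leaf.injEq] at h
    exact hij.ne h.2.2

theorem rotFun_fst_ne (v : Vert ℓ) (i : Fin 3) : (rotFun (v, i)).1 ≠ v := by
  have houter : ∀ e : OuterDart, (rotFun (ofOuter e)).1 ≠ (ofOuter e : Vert ℓ × Fin 3).1 := by
    intro e
    rw [rotFun_ofOuter, ofOuter_fst, ofOuter_fst]
    exact ofVertex_injective.ne (outerVertex_mate_ne e)
  cases v with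
  | port p s t =>
    fin_cases i
    · cases s <;> simp [rotFun]
    · cases s <;> simp [rotFun]
    · exact houter (.inl (p, s, t))
  | hub s t => exact houter (.inr (.inl (s, t, i)))
  | out x => exact houter (.inr (.inr (x, i)))
  | leaf p j t =>
    obtain ⟨j, hj⟩ := j
    fin_cases i
    · simp only [rotFun]
      split_ifs <;> simp
      omega
    · simp only [rotFun]
      split_ifs <;> simp
    · simp [rotFun]
  | ctr p j => simp [rotFun]

/-- The superposition as a rotation. -/
def rotation (ℓ : Fin 8 → ℕ) : Rotation (Vert ℓ) :=
  ⟨rotFun, rotFun_rotFun, rotFun_fst_injective, rotFun_fst_ne⟩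

def equivSum (ℓ : Fin 8 → ℕ) : Vert ℓ ≃ ((Fin 8 × Bool × Fin 3) ⊕ (Bool × Fin 3) ⊕ Fin 8) ⊕
    (Σ p, Fin (ℓ p + 1) × Fin 3) ⊕ (Σ p, Fin (ℓ p + 1)) where
  toFun
    | port p s t => .inl (.inl (p, s, t))
    | hub s t => .inl (.inr (.inl (s, t)))
    | out x => .inl (.inr (.inr x))
    | leaf p j t => .inr (.inl ⟨p, j, t⟩)
    | ctr p j => .inr (.inr ⟨p, j⟩)
  invFun
    | .inl y => ofVertex y
    | .inr (.inl ⟨p, j, t⟩) => leaf p j t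
    | .inr (.inr ⟨p, j⟩) => ctr p j
  left_inv := by rintro (_ | _ | _ | _ | _) <;> rfl
  right_inv := by rintro ((_ | _ | _) | _ | _) <;> rfl

instance : Fintype (Vert ℓ) := Fintype.ofEquiv _ (equivSum ℓ).symm

theorem card_eq : Fintype.card (Vert ℓ) = 62 + ∑ p, (ℓ p + 1) * 4 := by
  rw [Fintype.card_congr (equivSum ℓ)]
  simp only [Fintype.card_sum, Fintype.card_prod, Fintype.card_sigma, Fintype.card_fin,
    Fintype.card_bool]
  rw [← Finset.sum_add_distrib, add_comm]
  have : ∀ a : ℕ, a * 3 + a = a * 4 := by intro a; ring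
  simp only [this]
  ring

theorem sum_eq (f : Vert ℓ × Fin 3 → ℕ) : ∑ d, f d = ∑ e : OuterDart, f (ofOuter e) +
    ∑ p, (∑ t, (f (port p true t, 0) + f (port p false t, 0)) +
      ∑ t, (f (port p true t, 1) + f (port p false t, 1)) +
      ∑ j, ∑ t, (f (leaf p j t, 0) + f (leaf p j t, 1)) +
      ∑ j, ∑ t, (f (leaf p j t, 2) + f (ctr p j, t))) := by
  rw [Fintype.sum_prod_type, ← (equivSum ℓ).symm.sum_comp]
  simp only [Fintype.sum_sum_type, Fintype.sum_prod_type, Fintype.sum_sigma, Fintype.sum_bool,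
    Finset.sum_add_distrib, Fin.sum_univ_three, equivSum, ofVertex, ofOuter, Equiv.coe_fn_symm_mk]
  ring

end Vert

/-- Lower bounds for the number of crossing edges on a chain of claws: the `i`-th octal digit of
`chainTable n` bounds the number of crossing edges before the `n`-th claw (for `n = 4`: any later
claw) over all stable bipartitions which reach the state with index `i`. -/
def chainTable : ℕ → ℕ
  | 0 => 4979662281745678339593859314261063746303121579739624488566988130531888912283237336346288038171244349072565278075697586380563311081034326104282473433303170629456095691176948999009185586562044251885924084977464410624054011891449232709694215173755590536309607524895517050922764930061208839630409693924964723999794208731046101271119755640138737314497850772955557350727403813923303660688367490212277290758491943553933568885490784286459694627474187342999324535235346048141400690228216920020279394050160669002051034975724837322547724357784651443224594915058524934928233995590868550243107311392832580831730727080647310010052530740484232940106252757325690468189409956096953997313646613434299678906077786721886189853073417681935598460027458250515158970443518213534991275581115525937231050044027853196635750199559011838108837692124830635591751752042414389699361735334365063919149423247701346637075312722080406550111282936387205521436080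
  | 1 => 4979662281745616419989642704774733888141712827207696796344562718814628755080445078475976223460674544553781206028523772648757024477326201260355606430635213031272684982370934383733621042373859559910943347790071824918132295071173117229419675211306030700130207185965932511767130974854412535991781530482283077328440868302074385931355303764643011675713959060559452154534673121361877068769186352861263437216458360576462034170567352767370946765028395042677374975288066476094539031282716542738707334541079704960282646521517852752698549929959322325045025080384705894107001976020626265979601252836168433000409897584182043825653844584507134124754683547449595079734730086681668740477422453906480056483134069939593374370257480748134791577133578612788041613313002059455608222338706180911170358852705178956331925312161463085097860669175691953695913102161854092926112384129124713181367373825891309616272257381899887945020081204731643996892592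
  | 2 => 4979661242906781264947094711668341139094891748820746706366110628923670129400688281915203728171148547455388459432214129785149639026255074957826469312411589079143120118218973419352560006605174376042105411850036316474604165875041641565690583923770257192196977268765325570118403275571642423754726296237624409315917009414780368412335139119697669138095203121528673513638413100670932069841227802021474824687075692487878988993964354022756927509599456912395441625952746933574450523900154594796409200297302360787430722598830652863832495962990481349566632298073597551627948405726213259828998459104989623902684910233363787733997913408832368689272077617301829644955188258051666737058455201251513519022369817253547244985341743793476931591399336838545438320423871003974055817602878874425427304151784385995606014200671629227098331199413768276317112028231322593857463434906372827046117631554155613866972040215248461042972491300465828252161096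
  | 3 => 4874475375219680754711237894300265669687658570818110569848592872337378419956376302552374759459149148239423334473072098550688936887507200749683808591426457760616032435306454699383275126129639357092760844413833071142835943420981918990719542098381440927099628259070542626311525966397209055022648867128375567688593303592089606430079245833505219731729472140964481626985235030883080008740454197599304637791218341672725931063162152936405025568512979191342126840174549549848645552193303156224007934215569847210104238735780255937206031625734635176768447148369048512209750939937731553012898646246769876448445371761474008524142996849316314210996821731788467448748569082765134958447366596771416650774928958424208906685070743002656376453950474374157330654009701216461891879393928373229019446961600378702483369140753436299191639898108518486479776361554518910896171107324642433538509674328917023699471910065321925074177434328326979382219848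
  | _ => 4874475375219680754711237894300265669687658570818110569848594708686785595717632895674473362211125726549853477191577348871445485815054250511844145138346566448358815903361590334029640735080673683196532266664604173538262688165761871377891363125687530863782757954033050186359006090499775815422380000436578542648391311789512211112405095601960666840401341568936796258410617820928894906132110873478157111886266438357850780474928929506625285621320515080880822550751521646922821227798203079476642897277092136842850668589784338669980483187353996501392407917427988008914680463388338061186212436042454249543278025618085038804643583618349282145888465458237268287007640704768358340115937631913395804744590236701811834514502329975585545696579052347078190664563187469999081782486336181438529120323716609467844440487466483042832202891973216194194115636915267943019639112665912127638107715256449863237579462115291462769606334575794191669466184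

def forallBool (p : Bool → Bool) : Bool := p false && p true

theorem forallBool_iff {p : Bool → Bool} : forallBool p = true ↔ ∀ x, p x = true := by
  simp [forallBool]

/-- The index of a state: initial values, current values, whether the current vertices already have
a crossing edge, and whether the chain so far is non-constant. -/
def stateIndex (r₀ r₁ r₂ b₀ b₁ b₂ u₀ u₁ u₂ f : Bool) : ℕ :=
  r₀.toNat + 2 * (r₁.toNat + 2 * (r₂.toNat + 2 * (b₀.toNat + 2 * (b₁.toNat + 2 * (b₂.toNat +
    2 * (u₀.toNat + 2 * (u₁.toNat + 2 * (u₂.toNat + 2 * f.toNat))))))))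

def chainBound (n i : ℕ) : ℕ := min 6 ((chainTable n >>> (3 * i)) % 8)

def atMostOne (x y z : Bool) : Bool := !(x && y) && !(x && z) && !(y && z)

/-- The bounds of table `n'` follow from those of table `n`, by appending one claw. -/
def stepCheck (n n' : ℕ) : Bool :=
  forallBool fun r₀ => forallBool fun r₁ => forallBool fun r₂ =>
  forallBool fun b₀ => forallBool fun b₁ => forallBool fun b₂ =>
  forallBool fun u₀ => forallBool fun u₁ => forallBool fun u₂ => forallBool fun f =>
    Nat.ble 6 (chainBound n (stateIndex r₀ r₁ r₂ b₀ b₁ b₂ u₀ u₁ u₂ f)) ||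
    forallBool fun c => forallBool fun y₀ => forallBool fun y₁ => forallBool fun y₂ =>
      !(atMostOne (c ^^ y₀) (c ^^ y₁) (c ^^ y₂) && atMostOne u₀ (b₀ ^^ y₀) false &&
        atMostOne u₁ (b₁ ^^ y₁) false && atMostOne u₂ (b₂ ^^ y₂) false &&
        atMostOne (c ^^ y₀) (b₀ ^^ y₀) false && atMostOne (c ^^ y₁) (b₁ ^^ y₁) false &&
        atMostOne (c ^^ y₂) (b₂ ^^ y₂) false) ||
      Nat.ble (chainBound n' (stateIndex r₀ r₁ r₂ y₀ y₁ y₂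
          (b₀ ^^ y₀ || c ^^ y₀) (b₁ ^^ y₁ || c ^^ y₁) (b₂ ^^ y₂ || c ^^ y₂)
          (f || (c ^^ y₀) || (c ^^ y₁) || (c ^^ y₂) ||
            (Nat.ble 1 n && ((c ^^ b₀) || (c ^^ b₁) || (c ^^ b₂))))))
        (chainBound n (stateIndex r₀ r₁ r₂ b₀ b₁ b₂ u₀ u₁ u₂ f) +
          ((b₀ ^^ y₀).toNat + (b₁ ^^ y₁).toNat + (b₂ ^^ y₂).toNat +
            ((c ^^ y₀).toNat + (c ^^ y₁).toNat + (c ^^ y₂).toNat)))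

theorem stepCheck_succ : ∀ n < 4, stepCheck n (n + 1) = true := by decide +kernel

theorem stepCheck_four : stepCheck 4 4 = true := by decide +kernel

/-- The bound for non-constant chains, for one value `β` and the final values `l`. -/
def finalCheck : Bool :=
  forallBool fun r₀ => forallBool fun r₁ => forallBool fun r₂ =>
  forallBool fun b₀ => forallBool fun b₁ => forallBool fun b₂ =>
  forallBool fun u₀ => forallBool fun u₁ => forallBool fun u₂ =>
    Nat.ble 6 (chainBound 4 (stateIndex r₀ r₁ r₂ b₀ b₁ b₂ u₀ u₁ u₂ true)) ||
    forallBool fun l₀ => forallBool fun l₁ => forallBool fun l₂ => forallBool fun β =>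
      !(atMostOne u₀ (b₀ ^^ l₀) false && atMostOne u₁ (b₁ ^^ l₁) false &&
        atMostOne u₂ (b₂ ^^ l₂) false) ||
      Nat.ble (2 * ((!(r₀ ^^ β) && !(l₀ ^^ β)).toNat + (!(r₁ ^^ β) && !(l₂ ^^ β)).toNat +
          (!(r₂ ^^ β) && !(l₁ ^^ β)).toNat))
        (chainBound 4 (stateIndex r₀ r₁ r₂ b₀ b₁ b₂ u₀ u₁ u₂ true) +
          ((b₀ ^^ l₀).toNat + (b₁ ^^ l₁).toNat + (b₂ ^^ l₂).toNat))

theorem finalCheck_eq : finalCheck = true := by decide +kernel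

/-- A stable bipartition of a chain of `N` claws: `b j` are the values on the three tracks before the
`j`-th claw, `b (j + 1)` and `c j` those of its leaves and its centre. -/
structure StableChain (b : ℕ → Fin 3 → Bool) (c : ℕ → Bool) (N : ℕ) : Prop where
  leaf : ∀ j < N, ∀ t,
    atMostOne (b j t ^^ b (j + 1) t) (c j ^^ b (j + 1) t) (b (j + 1) t ^^ b (j + 2) t) = true
  centre : ∀ j < N, atMostOne (c j ^^ b (j + 1) 0) (c j ^^ b (j + 1) 1) (c j ^^ b (j + 1) 2) = true

theorem atMostOne_or {x y z : Bool} : atMostOne x y z → atMostOne (x || y) z false := by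
  revert x y z
  decide

theorem atMostOne_swap {x y z : Bool} : atMostOne x y z → atMostOne y x false := by
  revert x y z
  decide

namespace StableChain

variable (b : ℕ → Fin 3 → Bool) (c : ℕ → Bool)

def trackCost (j : ℕ) : ℕ := ∑ t, (b j t ^^ b (j + 1) t).toNat

def clawCost (j : ℕ) : ℕ := ∑ t, (c j ^^ b (j + 1) t).toNat

def used : ℕ → Fin 3 → Bool
  | 0, _ => false
  | j + 1, t => b j t ^^ b (j + 1) t || c j ^^ b (j + 1) t

def varies : ℕ → Bool
  | 0 => false
  | j + 1 => varies j || (c j ^^ b (j + 1) 0) || (c j ^^ b (j + 1) 1) || (c j ^^ b (j + 1) 2) ||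
    (Nat.ble 1 j && ((c j ^^ b j 0) || (c j ^^ b j 1) || (c j ^^ b j 2)))

def index (n : ℕ) : ℕ :=
  stateIndex (b 0 0) (b 0 1) (b 0 2) (b n 0) (b n 1) (b n 2)
    (used b c n 0) (used b c n 1) (used b c n 2) (varies b c n)

variable {b c}

theorem atMostOne_used {N : ℕ} (h : StableChain b c N) {n : ℕ} (hn : n ≤ N) (t : Fin 3) :
    atMostOne (used b c n t) (b n t ^^ b (n + 1) t) false = true := by
  cases n with
  | zero => simp [used, atMostOne]
  | succ n =>
    exact atMostOne_or (h.leaf n hn t)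

theorem chainBound_le {N : ℕ} (h : StableChain b c N) {n : ℕ} (hn : n ≤ N) :
    chainBound (min n 4) (index b c n) ≤ ∑ j ∈ Finset.range n, (trackCost b j + clawCost b c j) := by
  induction n with
  | zero =>
    refine le_trans (b := 0) ?_ (Nat.zero_le _)
    simp only [index, used, varies]
    generalize b 0 0 = x
    generalize b 0 1 = y
    generalize b 0 2 = z
    revert x y z
    decide +kernel
  | succ n ih =>
    specialize ih (by omega)
    rw [Finset.sum_range_succ]
    have hstep : stepCheck (min n 4) (min (n + 1) 4) = true := by
      by_cases h4 : n < 4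
      · rw [min_eq_left h4.le, min_eq_left (by omega)]
        exact stepCheck_succ n h4
      · rw [min_eq_right (by omega), min_eq_right (by omega)]
        exact stepCheck_four
    have hn1 : Nat.ble 1 n = Nat.ble 1 (min n 4) := by
      rw [Bool.eq_iff_iff, Nat.ble_eq, Nat.ble_eq]
      omega
    simp only [stepCheck, forallBool_iff] at hstep
    have := hstep (b 0 0) (b 0 1) (b 0 2) (b n 0) (b n 1) (b n 2)
      (used b c n 0) (used b c n 1) (used b c n 2) (varies b c n)
    rw [Bool.or_eq_true, Nat.ble_eq] at this
    rcases this with h6 | hstep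
    · refine (min_le_left _ _).trans ((h6.trans ih).trans (Nat.le_add_right _ _))
    · simp only [forallBool_iff] at hstep
      have hs := hstep (c n) (b (n + 1) 0) (b (n + 1) 1) (b (n + 1) 2)
      have hleaf : ∀ t, atMostOne (c n ^^ b (n + 1) t) (b n t ^^ b (n + 1) t) false = true :=
        fun t => atMostOne_swap (h.leaf n hn t)
      have hu := h.atMostOne_used (n := n) (by omega)
      rw [h.centre n hn, hu 0, hu 1, hu 2, hleaf 0, hleaf 1, hleaf 2] at hs
      simp only [Bool.and_self, Bool.not_true, Bool.false_or, Nat.ble_eq] at hs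
      have h1 : index b c (n + 1) = stateIndex (b 0 0) (b 0 1) (b 0 2)
          (b (n + 1) 0) (b (n + 1) 1) (b (n + 1) 2) _ _ _ _ := rfl
      rw [h1]
      simp only [used, varies, hn1]
      refine hs.trans ?_
      have h2 : trackCost b n + clawCost b c n = _ :=
        congrArg₂ _ (Fin.sum_univ_three _) (Fin.sum_univ_three _)
      rw [h2]
      exact Nat.add_le_add_right ih _

theorem exists_const {n : ℕ} (hv : varies b c (n + 1) = false) :
    ∃ β, ∀ j ≤ n, c j = β ∧ ∀ t, b (j + 1) t = β := by
  have hx : ∀ x y : Bool, (x ^^ y) = false ↔ y = x := by decide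
  induction n with
  | zero =>
    simp only [varies, Bool.or_eq_false_iff, hx] at hv
    refine ⟨c 0, fun j hj => ?_⟩
    obtain rfl : j = 0 := by omega
    refine ⟨rfl, fun t => ?_⟩
    fin_cases t
    exacts [hv.1.1.1.2, hv.1.1.2, hv.1.2]
  | succ n ih =>
    rw [varies] at hv
    have hb : Nat.ble 1 (n + 1) = true := by simp
    simp only [hb, Bool.true_and, Bool.or_eq_false_iff, hx] at hv
    obtain ⟨β, hβ⟩ := ih hv.1.1.1.1
    have hc : c (n + 1) = β := by rw [← hv.2.1.1, (hβ n le_rfl).2 0]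
    refine ⟨β, fun j hj => ?_⟩
    rcases Nat.lt_or_ge n j with hlt | hge
    · obtain rfl : j = n + 1 := by omega
      refine ⟨hc, fun t => ?_⟩
      rw [← hc]
      fin_cases t
      exacts [hv.1.1.1.2, hv.1.1.2, hv.1.2]
    · exact hβ j hge

/-- A stable bipartition of a long chain of claws is constant, or it has many crossing edges. -/
theorem const_or_le {n : ℕ} (h : StableChain b c (n + 1)) (hn : 3 ≤ n) :
    (∃ β, ∀ j ≤ n, c j = β ∧ ∀ t, b (j + 1) t = β) ∨
    ∀ β, 2 * ∑ t, (!(b 0 t ^^ β) && !(b (n + 2) (twist t) ^^ β)).toNat ≤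
      ∑ j ∈ Finset.range (n + 1), (trackCost b j + clawCost b c j) + trackCost b (n + 1) := by
  cases hv : varies b c (n + 1) with
  | false => exact .inl (exists_const hv)
  | true =>
    right
    intro β
    have hle := h.chainBound_le le_rfl
    rw [min_eq_right (by omega), index, hv] at hle
    have hf := finalCheck_eq
    simp only [finalCheck, forallBool_iff] at hf
    have := hf (b 0 0) (b 0 1) (b 0 2) (b (n + 1) 0) (b (n + 1) 1) (b (n + 1) 2)
      (used b c (n + 1) 0) (used b c (n + 1) 1) (used b c (n + 1) 2)
    rw [Bool.or_eq_true, Nat.ble_eq] at this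
    rcases this with h6 | hfin
    · refine le_trans ?_ ((h6.trans hle).trans (Nat.le_add_right _ _))
      have : ∀ x : Bool, x.toNat ≤ 1 := Bool.toNat_le
      refine (Nat.mul_le_mul_left 2 (Finset.sum_le_sum fun t _ => this _)).trans ?_
      simp
    · simp only [forallBool_iff] at hfin
      have hs := hfin (b (n + 2) 0) (b (n + 2) 1) (b (n + 2) 2) β
      have hu := h.atMostOne_used (n := n + 1) le_rfl
      rw [hu 0, hu 1, hu 2] at hs
      simp only [Bool.and_self, Bool.not_true, Bool.false_or, Nat.ble_eq] at hs
      refine le_trans (le_of_eq ?_) (hs.trans ?_)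
      · simp only [Fin.sum_univ_three]
        rfl
      · have h2 : trackCost b (n + 1) = _ := Fin.sum_univ_three _
        rw [h2]
        exact Nat.add_le_add_right hle _

end StableChain

/-- In a stable bipartition each vertex has at most one neighbour on the other side. -/
theorem Rotation.atMostOne_of_isStable {V : Type*} (R : Rotation V) {S : V → Bool}
    (h : IsStable R.graph S) (v : V) :
    atMostOne (S v ^^ S (R.nbr v 0)) (S v ^^ S (R.nbr v 1)) (S v ^^ S (R.nbr v 2)) = true := by
  have hx : ∀ x y : Bool, (x ^^ y) = true → x ≠ y := by decide
  have hij : ∀ i j, i ≠ j → ((S v ^^ S (R.nbr v i)) && (S v ^^ S (R.nbr v j))) = false := by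
    intro i j hij
    rw [Bool.eq_false_iff, Ne, Bool.and_eq_true]
    rintro ⟨h₁, h₂⟩
    exact hij (R.nbr_injective v (h v _ _ (R.adj_nbr v i) (R.adj_nbr v j) (hx _ _ h₁) (hx _ _ h₂)))
  simp only [atMostOne, hij 0 1 (by decide), hij 0 2 (by decide), hij 1 2 (by decide)]
  rfl

namespace Vert

section Cut

variable {ℓ : Fin 8 → ℕ} (S : Vert ℓ → Bool) (p : Fin 8)

/-- The values along the tracks of a piece. -/
def track : ℕ → Fin 3 → Bool
  | 0, t => S (port p true t)
  | j + 1, t => if h : j < ℓ p + 1 then S (leaf p ⟨j, h⟩ t) else S (port p false (twist t))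

/-- The values at the centres of the claws of a piece. -/
def centre (j : ℕ) : Bool := if h : j < ℓ p + 1 then S (ctr p ⟨j, h⟩) else false

theorem track_leaf (j : Fin (ℓ p + 1)) (t : Fin 3) : track S p (j + 1) t = S (leaf p j t) :=
  dif_pos j.2

theorem track_last (t : Fin 3) : track S p (ℓ p + 2) t = S (port p false (twist t)) :=
  dif_neg (lt_irrefl _)

theorem centre_ctr (j : Fin (ℓ p + 1)) : centre S p j = S (ctr p j) :=
  dif_pos j.2

theorem rotFun_leaf_zero (j : Fin (ℓ p + 1)) (t : Fin 3) :
    S (rotFun (leaf p j t, 0)).1 = track S p j t := by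
  obtain ⟨j, hj⟩ := j
  cases j with
  | zero => rfl
  | succ j => simp [rotFun, track, show j < ℓ p + 1 by omega]

theorem rotFun_leaf_one (j : Fin (ℓ p + 1)) (t : Fin 3) :
    S (rotFun (leaf p j t, 1)).1 = track S p (j + 2) t := by
  obtain ⟨j, hj⟩ := j
  by_cases h : j < ℓ p
  · simp [rotFun, track, h]
  · simp [rotFun, track, h]

/-- Twice the number of crossing edges inside a piece. -/
def pieceCost : ℕ :=
  ∑ t, ((rotation ℓ).cross S (port p true t, 0) + (rotation ℓ).cross S (port p false t, 0)) +
  ∑ t, ((rotation ℓ).cross S (port p true t, 1) + (rotation ℓ).cross S (port p false t, 1)) +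
  ∑ j, ∑ t, ((rotation ℓ).cross S (leaf p j t, 0) + (rotation ℓ).cross S (leaf p j t, 1)) +
  ∑ j, ∑ t, ((rotation ℓ).cross S (leaf p j t, 2) + (rotation ℓ).cross S (ctr p j, t))

theorem pieceCost_eq : pieceCost S p =
    2 * (∑ t, (S (port p true t) ^^ S (port p false t)).toNat +
      (∑ j ∈ Finset.range (ℓ p + 1), (StableChain.trackCost (track S p) j +
        StableChain.clawCost (track S p) (centre S p) j) +
      StableChain.trackCost (track S p) (ℓ p + 1))) := by
  have h₁ : ∑ t, ((rotation ℓ).cross S (port p true t, 0) +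
      (rotation ℓ).cross S (port p false t, 0)) =
      2 * ∑ t, (S (port p true t) ^^ S (port p false t)).toNat := by
    rw [Finset.mul_sum]
    refine Finset.sum_congr rfl fun t _ => ?_
    have : (rotation ℓ).cross S (port p false t, 0) =
        (S (port p true t) ^^ S (port p false t)).toNat := by rw [Bool.xor_comm]; rfl
    rw [this, two_mul]
    rfl
  have h₂ : ∑ t, ((rotation ℓ).cross S (port p true t, 1) +
      (rotation ℓ).cross S (port p false t, 1)) = StableChain.trackCost (track S p) 0 +
      StableChain.trackCost (track S p) (ℓ p + 1) := by
    rw [Finset.sum_add_distrib]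
    congr 1
    rw [StableChain.trackCost, ← sum_twist]
    refine Finset.sum_congr rfl fun t _ => ?_
    rw [track_last, Bool.xor_comm]
    exact congrArg (fun x => (S (port p false (twist t)) ^^ x).toNat)
      ((congrArg (fun u => S (leaf p (Fin.last (ℓ p)) u)) (twist_twist t)).trans
        (track_leaf S p (Fin.last (ℓ p)) t).symm)
  have h₃ : ∑ j, ∑ t, ((rotation ℓ).cross S (leaf p j t, 0) +
      (rotation ℓ).cross S (leaf p j t, 1)) = ∑ j ∈ Finset.range (ℓ p + 1),
      (StableChain.trackCost (track S p) j + StableChain.trackCost (track S p) (j + 1)) := by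
    rw [Finset.sum_range]
    refine Finset.sum_congr rfl fun j _ => ?_
    rw [StableChain.trackCost, StableChain.trackCost, ← Finset.sum_add_distrib]
    refine Finset.sum_congr rfl fun t _ => ?_
    rw [← rotFun_leaf_zero, ← rotFun_leaf_one, track_leaf, Bool.xor_comm (S (rotFun _).1)]
    rfl
  have h₄ : ∑ j, ∑ t, ((rotation ℓ).cross S (leaf p j t, 2) + (rotation ℓ).cross S (ctr p j, t)) =
      2 * ∑ j ∈ Finset.range (ℓ p + 1), StableChain.clawCost (track S p) (centre S p) j := by
    rw [Finset.sum_range, Finset.mul_sum]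
    refine Finset.sum_congr rfl fun j _ => ?_
    rw [StableChain.clawCost, Finset.mul_sum]
    refine Finset.sum_congr rfl fun t _ => ?_
    rw [track_leaf, centre_ctr, two_mul]
    congr 1
    rw [Bool.xor_comm]
    rfl
  rw [pieceCost, h₁, h₂, h₃, h₄, Finset.sum_add_distrib, Finset.sum_add_distrib]
  have h₅ := Finset.sum_range_succ (StableChain.trackCost (track S p)) (ℓ p + 1)
  have h₆ := Finset.sum_range_succ' (StableChain.trackCost (track S p)) (ℓ p + 1)
  omega

variable {S}

theorem stableChain (h : IsStable (rotation ℓ).graph S) :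
    StableChain (track S p) (centre S p) (ℓ p + 1) where
  leaf j hj t := by
    have := (rotation ℓ).atMostOne_of_isStable h (leaf p ⟨j, hj⟩ t)
    have h₀ := rotFun_leaf_zero S p ⟨j, hj⟩ t
    have h₁ := rotFun_leaf_one S p ⟨j, hj⟩ t
    have h₂ := track_leaf S p ⟨j, hj⟩ t
    have h₃ := centre_ctr S p ⟨j, hj⟩
    simp only at h₀ h₁ h₂ h₃
    rw [← h₀, ← h₁, h₂, h₃]
    have hperm : ∀ a b c d : Bool, atMostOne (a ^^ b) (a ^^ c) (a ^^ d) = true →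
        atMostOne (b ^^ a) (d ^^ a) (a ^^ c) = true := by decide
    exact hperm _ _ _ _ this
  centre j hj := by
    have := (rotation ℓ).atMostOne_of_isStable h (ctr p ⟨j, hj⟩)
    have h₂ := fun t => track_leaf S p ⟨j, hj⟩ t
    have h₃ := centre_ctr S p ⟨j, hj⟩
    simp only at h₂ h₃
    rw [h₂, h₂, h₂, h₃]
    exact this

/-- The number of ports of a piece with value different from `β`. -/
def deviation (S : Vert ℓ → Bool) (p : Fin 8) (β : Bool) : ℕ :=
  ∑ t, ((S (port p true t) ^^ β).toNat + (S (port p false t) ^^ β).toNat)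

/-- All claws of a piece lie on side `β`. -/
def ConstPiece (S : Vert ℓ → Bool) (p : Fin 8) (β : Bool) : Prop :=
  ∀ j, S (ctr p j) = β ∧ ∀ t, S (leaf p j t) = β

theorem constPiece_or (h : IsStable (rotation ℓ).graph S) (hℓ : 3 ≤ ℓ p) :
    (∃ β, ConstPiece S p β) ∨ ∀ β, 2 * deviation S p β ≤ pieceCost S p := by
  rcases (stableChain p h).const_or_le hℓ with ⟨β, hβ⟩ | hle
  · left
    refine ⟨β, fun j => ?_⟩
    have := hβ j (by omega)
    rw [centre_ctr] at this
    simpa only [track_leaf] using this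
  · right
    intro β
    rw [pieceCost_eq]
    refine Nat.mul_le_mul_left 2 (le_trans ?_ (Nat.add_le_add_left (hle (!β)) _))
    rw [Finset.mul_sum, ← Finset.sum_add_distrib]
    refine Finset.sum_le_sum fun t _ => ?_
    rw [track_last, twist_twist, track]
    generalize S (port p true t) = x
    generalize S (port p false t) = y
    revert x y β
    decide

theorem ConstPiece.deviation_le {β : Bool} (hc : ConstPiece S p β) :
    2 * deviation S p β ≤ pieceCost S p := by
  have h₁ : deviation S p β = StableChain.trackCost (track S p) 0 +
      StableChain.trackCost (track S p) (ℓ p + 1) := by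
    rw [deviation, Finset.sum_add_distrib]
    congr 1
    · refine Finset.sum_congr rfl fun t _ => ?_
      exact congrArg _ (congrArg _ ((track_leaf S p 0 t).trans ((hc 0).2 t)).symm)
    · rw [StableChain.trackCost, ← sum_twist]
      refine Finset.sum_congr rfl fun t _ => ?_
      rw [track_last, Bool.xor_comm]
      congr 2
      exact ((track_leaf S p (Fin.last (ℓ p)) t).trans ((hc _).2 _)).symm
  have h₂ := Finset.sum_range_succ' (StableChain.trackCost (track S p)) (ℓ p)
  rw [h₁, pieceCost_eq, Finset.sum_add_distrib]
  omega

end Cut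

end Vert

/-- The vertices outside the pieces, and the vertices with a free port. -/
abbrev OuterVertex : Type := (Fin 8 × Bool × Fin 3) ⊕ (Bool × Fin 3) ⊕ Fin 8

namespace Vert

/-- Whether the edge of an outer dart crosses. -/
def outerCross (s : OuterVertex → Bool) (e : OuterDart) : ℕ :=
  (s (outerVertex e) ^^ s (outerVertex (mate e))).toNat

/-- One dart of each outer edge. -/
def halfDarts : List OuterDart :=
  [.inr (.inl (false, 0, 0)), .inr (.inl (false, 0, 1)), .inr (.inl (false, 0, 2)),
    .inr (.inl (false, 1, 0)), .inr (.inl (false, 1, 1)), .inr (.inl (false, 1, 2)),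
    .inr (.inl (false, 2, 0)), .inr (.inl (false, 2, 1)), .inr (.inl (false, 2, 2)),
    .inr (.inl (true, 0, 0)), .inr (.inl (true, 0, 1)), .inr (.inl (true, 0, 2)),
    .inr (.inl (true, 1, 0)), .inr (.inl (true, 1, 1)), .inr (.inl (true, 1, 2)),
    .inr (.inl (true, 2, 0)), .inr (.inl (true, 2, 1)), .inr (.inl (true, 2, 2)),
    .inl (0, true, 1), .inl (1, true, 1), .inl (3, true, 1), .inl (4, true, 1), .inl (6, true, 1),
    .inl (0, true, 2), .inl (1, true, 2), .inl (3, true, 2), .inl (4, true, 2), .inl (6, true, 2),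
    .inr (.inr (0, 0)), .inr (.inr (0, 1)), .inr (.inr (1, 0)), .inr (.inr (1, 1)),
    .inr (.inr (2, 0)), .inr (.inr (2, 1)), .inr (.inr (3, 0)), .inr (.inr (3, 1)),
    .inr (.inr (4, 0)), .inr (.inr (4, 1)),
    .inr (.inr (5, 0)), .inr (.inr (5, 1)), .inr (.inr (5, 2)), .inr (.inr (6, 0)),
    .inr (.inr (6, 1)), .inr (.inr (6, 2)), .inr (.inr (4, 2))]

theorem nodup_halfDarts : (halfDarts ++ halfDarts.map mate).Nodup := by decide +kernel

theorem outerCross_mate (s : OuterVertex → Bool) (e : OuterDart) :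
    outerCross s (mate e) = outerCross s e := by
  rw [outerCross, outerCross, mate_mate, Bool.xor_comm]

theorem sum_outerCross (s : OuterVertex → Bool) :
    ∑ e, outerCross s e = 2 * (halfDarts.map (outerCross s)).sum := by
  have h : (Finset.univ : Finset OuterDart) = (halfDarts ++ halfDarts.map mate).toFinset := by
    refine (Finset.eq_univ_of_card _ ?_).symm
    rw [List.toFinset_card_of_nodup nodup_halfDarts]
    rfl
  rw [h, List.sum_toFinset _ nodup_halfDarts, List.map_append, List.sum_append, List.map_map,
    two_mul]
  congr 3
  funext e
  exact outerCross_mate s e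

theorem sum_halfDarts (s : OuterVertex → Bool) (x : Fin 8 → Bool → Fin 3 → Bool)
    (h : Bool → Fin 3 → Bool) (o : Fin 8 → Bool) (hx : ∀ p σ t, s (.inl (p, σ, t)) = x p σ t)
    (hh : ∀ σ t, s (.inr (.inl (σ, t))) = h σ t) (ho : ∀ i, s (.inr (.inr i)) = o i) :
    (halfDarts.map (outerCross s)).sum =
    (h false 0 ^^ x 0 false 0).toNat + ( (h false 0 ^^ x 3 false 0).toNat + (
     (h false 0 ^^ x 6 false 0).toNat + ( (h false 1 ^^ x 0 false 1).toNat + (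
     (h false 1 ^^ x 3 false 1).toNat + ( (h false 1 ^^ x 6 false 1).toNat + (
     (h false 2 ^^ x 0 false 2).toNat + ( (h false 2 ^^ x 3 false 2).toNat + (
     (h false 2 ^^ x 6 false 2).toNat + ( (h true 0 ^^ x 2 true 0).toNat + (
     (h true 0 ^^ x 5 true 0).toNat + ( (h true 0 ^^ x 7 true 0).toNat + (
     (h true 1 ^^ x 2 true 1).toNat + ( (h true 1 ^^ x 5 true 1).toNat + (
     (h true 1 ^^ x 7 true 1).toNat + ( (h true 2 ^^ x 2 true 2).toNat + (
     (h true 2 ^^ x 5 true 2).toNat + ( (h true 2 ^^ x 7 true 2).toNat + (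
     (x 0 true 1 ^^ x 1 false 1).toNat + ( (x 1 true 1 ^^ x 2 false 1).toNat + (
     (x 3 true 1 ^^ x 4 false 1).toNat + ( (x 4 true 1 ^^ x 5 false 1).toNat + (
     (x 6 true 1 ^^ x 7 false 1).toNat + ( (x 0 true 2 ^^ x 1 false 2).toNat + (
     (x 1 true 2 ^^ x 2 false 2).toNat + ( (x 3 true 2 ^^ x 4 false 2).toNat + (
     (x 4 true 2 ^^ x 5 false 2).toNat + ( (x 6 true 2 ^^ x 7 false 2).toNat + (
     (o 0 ^^ x 0 true 0).toNat + ( (o 0 ^^ x 1 false 0).toNat + ( (o 1 ^^ x 1 true 0).toNat + (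
     (o 1 ^^ x 2 false 0).toNat + ( (o 2 ^^ x 3 true 0).toNat + ( (o 2 ^^ x 4 false 0).toNat + (
     (o 3 ^^ x 4 true 0).toNat + ( (o 3 ^^ x 5 false 0).toNat + ( (o 4 ^^ x 6 true 0).toNat + (
     (o 4 ^^ x 7 false 0).toNat + ( (o 5 ^^ o 0).toNat + ( (o 5 ^^ o 3).toNat + (
     (o 5 ^^ o 7).toNat + ( (o 6 ^^ o 1).toNat + ( (o 6 ^^ o 2).toNat + ( (o 6 ^^ o 7).toNat + (
     (o 4 ^^ o 7).toNat + 0)))))))))))))))))))))))))))))))))))))))))))) := by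
  obtain rfl : (fun p σ t => s (.inl (p, σ, t))) = x := by
    funext p σ t
    exact hx p σ t
  obtain rfl : (fun σ t => s (.inr (.inl (σ, t)))) = h := by
    funext σ t
    exact hh σ t
  obtain rfl : (fun i => s (.inr (.inr i))) = o := funext ho
  rfl

theorem junction_xor (x y z : Bool) : (x ^^ y).toNat ≤ (z ^^ x).toNat + (z ^^ y).toNat := by
  revert x y z
  decide

theorem hub_xor (x y z w : Bool) : (!(x == y && y == z)).toNat ≤
    (w ^^ x).toNat + (w ^^ y).toNat + (w ^^ z).toNat := by
  revert x y z w
  decide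

theorem two_le_nodes : ∀ x₀ x₁ x₂ x₃ x₄ x₅ x₆ x₇ : Bool,
    (x₀ == x₁ && x₁ == x₂ && x₂ == x₃ && x₃ == x₄ && x₄ == x₅ && x₅ == x₆ && x₆ == x₇) = false →
    2 ≤ (x₀ ^^ x₁).toNat + (x₁ ^^ x₂).toNat + (x₃ ^^ x₄).toNat + (x₄ ^^ x₅).toNat +
      (x₆ ^^ x₇).toNat + (!(x₀ == x₃ && x₃ == x₆)).toNat + (!(x₂ == x₅ && x₅ == x₇)).toNat := by
  decide +kernel

/-- If the ports of each piece are on one side, and those of two pieces on different sides, then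
there are six crossing edges outside the pieces. -/
theorem six_le_of_ne (s : OuterVertex → Bool) (β : Fin 8 → Bool)
    (hs : ∀ p σ t, s (.inl (p, σ, t)) = β p) (hβ : ∃ p q, β p ≠ β q) :
    6 ≤ (halfDarts.map (outerCross s)).sum := by
  have h2 := two_le_nodes (β 0) (β 1) (β 2) (β 3) (β 4) (β 5) (β 6) (β 7) (by
    rw [Bool.eq_false_iff]
    simp only [Bool.and_eq_true, beq_iff_eq, Ne]
    rintro ⟨⟨⟨⟨⟨⟨h₀, h₁⟩, h₂⟩, h₃⟩, h₄⟩, h₅⟩, h₆⟩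
    obtain ⟨p, q, hpq⟩ := hβ
    have : ∀ p, β p = β 7 := by
      intro p
      fin_cases p <;> simp_all
    exact hpq ((this p).trans (this q).symm))
  have hhub := fun σ t => hub_xor (β (hubPiece σ 0)) (β (hubPiece σ 1)) (β (hubPiece σ 2))
    (s (.inr (.inl (σ, t))))
  have ho := fun p x => junction_xor (β p) (β (p + 1)) (s (.inr (.inr x)))
  rw [sum_halfDarts s (fun p _ _ => β p) _ _ hs (fun _ _ => rfl) fun _ => rfl]
  have := hhub false 0
  have := hhub false 1
  have := hhub false 2
  have := hhub true 0
  have := hhub true 1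
  have := hhub true 2
  have := ho 0 0
  have := ho 1 1
  have := ho 3 2
  have := ho 4 3
  have := ho 6 4
  simp only [hubPiece, Matrix.cons_val, Fin.reduceAdd] at *
  omega

/-- The possible values on one of the last two tracks, when all pieces are constant. -/
def pathCheck : Bool :=
  forallBool fun y₀ => forallBool fun y₁ => forallBool fun y₂ => forallBool fun y₃ =>
  forallBool fun y₄ => forallBool fun y₅ => forallBool fun y₆ => forallBool fun y₇ =>
    !(!(y₀ ^^ y₁) && !(y₁ ^^ y₂) && !(y₃ ^^ y₄) && !(y₄ ^^ y₅) && !(y₆ ^^ y₇)) ||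
    Nat.ble 3 (y₀.toNat + y₁.toNat + y₂.toNat + y₃.toNat + y₄.toNat + y₅.toNat + y₆.toNat +
      y₇.toNat) ||
    forallBool fun h₀ => forallBool fun h₁ =>
      !(atMostOne (h₀ ^^ y₀) (h₀ ^^ y₃) (h₀ ^^ y₆) &&
        atMostOne (h₁ ^^ y₂) (h₁ ^^ y₅) (h₁ ^^ y₇) && (!y₀ || h₀) && (!y₃ || h₀) &&
        (!y₆ || h₀) && (!y₂ || h₁) && (!y₅ || h₁) && (!y₇ || h₁)) ||
      !(y₀ || y₁ || y₂ || y₃ || y₄ || y₅ || y₆ || y₇ || h₀ || h₁)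

theorem pathCheck_eq : pathCheck = true := by decide +kernel

/-- The possible values on the first track, when all pieces are constant. -/
def treeCheck : Bool :=
  forallBool fun y₀ => forallBool fun y₁ => forallBool fun y₂ => forallBool fun y₃ =>
  forallBool fun y₄ => forallBool fun y₅ => forallBool fun y₆ => forallBool fun y₇ =>
    Nat.ble 3 (y₀.toNat + y₁.toNat + y₂.toNat + y₃.toNat + y₄.toNat + y₅.toNat + y₆.toNat +
      y₇.toNat) ||
    forallBool fun h₀ => forallBool fun h₁ =>
      !(atMostOne (h₀ ^^ y₀) (h₀ ^^ y₃) (h₀ ^^ y₆) &&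
        atMostOne (h₁ ^^ y₂) (h₁ ^^ y₅) (h₁ ^^ y₇) && (!y₀ || h₀) && (!y₃ || h₀) &&
        (!y₆ || h₀) && (!y₂ || h₁) && (!y₅ || h₁) && (!y₇ || h₁)) ||
      forallBool fun o₀ => forallBool fun o₁ => forallBool fun o₂ => forallBool fun o₃ =>
      forallBool fun o₄ =>
        !((!y₀ || o₀) && (!y₁ || o₀) && (!y₁ || o₁) && (!y₂ || o₁) && (!y₃ || o₂) &&
          (!y₄ || o₂) && (!y₄ || o₃) && (!y₅ || o₃) && (!y₆ || o₄) && (!y₇ || o₄)) ||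
        forallBool fun o₅ => forallBool fun o₆ => forallBool fun o₇ =>
          !(atMostOne (o₀ ^^ y₀) (o₀ ^^ y₁) (o₀ ^^ o₅) &&
            atMostOne (o₁ ^^ y₁) (o₁ ^^ y₂) (o₁ ^^ o₆) &&
            atMostOne (o₂ ^^ y₃) (o₂ ^^ y₄) (o₂ ^^ o₆) &&
            atMostOne (o₃ ^^ y₄) (o₃ ^^ y₅) (o₃ ^^ o₅) &&
            atMostOne (o₄ ^^ y₆) (o₄ ^^ y₇) (o₄ ^^ o₇) &&
            atMostOne (o₅ ^^ o₀) (o₅ ^^ o₃) (o₅ ^^ o₇) &&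
            atMostOne (o₆ ^^ o₁) (o₆ ^^ o₂) (o₆ ^^ o₇) &&
            atMostOne (o₇ ^^ o₄) (o₇ ^^ o₅) (o₇ ^^ o₆)) ||
          !(y₀ || y₁ || y₂ || y₃ || y₄ || y₅ || y₆ || y₇ || h₀ || h₁ || o₀ || o₁ || o₂ || o₃ ||
            o₄ || o₅ || o₆ || o₇) ||
          Nat.ble 6 ((h₀ ^^ y₀).toNat + (h₀ ^^ y₃).toNat + (h₀ ^^ y₆).toNat + (h₁ ^^ y₂).toNat +
            (h₁ ^^ y₅).toNat + (h₁ ^^ y₇).toNat + (o₀ ^^ y₀).toNat + (o₀ ^^ y₁).toNat +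
            (o₁ ^^ y₁).toNat + (o₁ ^^ y₂).toNat + (o₂ ^^ y₃).toNat + (o₂ ^^ y₄).toNat +
            (o₃ ^^ y₄).toNat + (o₃ ^^ y₅).toNat + (o₄ ^^ y₆).toNat + (o₄ ^^ y₇).toNat +
            (o₅ ^^ o₀).toNat + (o₅ ^^ o₃).toNat + (o₅ ^^ o₇).toNat + (o₆ ^^ o₁).toNat +
            (o₆ ^^ o₂).toNat + (o₆ ^^ o₇).toNat + (o₄ ^^ o₇).toNat +
            2 * (y₀.toNat + y₁.toNat + y₂.toNat + y₃.toNat + y₄.toNat + y₅.toNat + y₆.toNat +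
              y₇.toNat))

theorem treeCheck_eq : treeCheck = true := by decide +kernel

theorem outerVertex_mate_hubPiece :
    ∀ σ i t, outerVertex (mate (.inl (hubPiece σ i, σ, t))) = .inr (.inl (σ, t)) := by decide

theorem constant_or_le (s : OuterVertex → Bool) (y : Fin 8 → Fin 3 → Bool)
    (hy : ∀ p σ t, s (.inl (p, σ, t)) = y p t)
    (hport : ∀ p σ t, y p t = true → s (outerVertex (mate (.inl (p, σ, t)))) = true)
    (hhub : ∀ σ t, atMostOne (s (.inr (.inl (σ, t))) ^^ y (hubPiece σ 0) t)
      (s (.inr (.inl (σ, t))) ^^ y (hubPiece σ 1) t)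
      (s (.inr (.inl (σ, t))) ^^ y (hubPiece σ 2) t) = true)
    (hout : ∀ x, atMostOne (s (.inr (.inr x)) ^^ s (outerVertex (outMate x 0)))
      (s (.inr (.inr x)) ^^ s (outerVertex (outMate x 1)))
      (s (.inr (.inr x)) ^^ s (outerVertex (outMate x 2))) = true) :
    (∀ v, s v = false) ∨
      6 ≤ (halfDarts.map (outerCross s)).sum + 2 * ∑ p, ∑ t, (y p t).toNat := by
  rw [or_iff_not_imp_right, not_le]
  intro hlt
  rw [sum_halfDarts s (fun p _ t => y p t) _ _ hy (fun _ _ => rfl) fun _ => rfl] at hlt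
  simp only [Fin.sum_univ_eight, Fin.sum_univ_three] at hlt
  have himp : ∀ p σ t v, outerVertex (mate (.inl (p, σ, t))) = v → (!y p t || s v) = true := by
    rintro p σ t v rfl
    rw [Bool.or_eq_true, Bool.not_eq_true']
    cases h : y p t
    exacts [.inl rfl, .inr (hport p σ t h)]
  have hhubimp : ∀ σ i t, (!y (hubPiece σ i) t || s (.inr (.inl (σ, t)))) = true :=
    fun σ i t => himp _ σ t _ (outerVertex_mate_hubPiece σ i t)
  have hhub₀ : ∀ t, atMostOne (s (.inr (.inl (false, t))) ^^ y 0 t)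
      (s (.inr (.inl (false, t))) ^^ y 3 t) (s (.inr (.inl (false, t))) ^^ y 6 t) = true := hhub false
  have hhub₁ : ∀ t, atMostOne (s (.inr (.inl (true, t))) ^^ y 2 t)
      (s (.inr (.inl (true, t))) ^^ y 5 t) (s (.inr (.inl (true, t))) ^^ y 7 t) = true := hhub true
  have himp₀ : ∀ t, (!y 0 t || s (.inr (.inl (false, t)))) = true := hhubimp false 0
  have himp₃ : ∀ t, (!y 3 t || s (.inr (.inl (false, t)))) = true := hhubimp false 1
  have himp₆ : ∀ t, (!y 6 t || s (.inr (.inl (false, t)))) = true := hhubimp false 2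
  have himp₂ : ∀ t, (!y 2 t || s (.inr (.inl (true, t)))) = true := hhubimp true 0
  have himp₅ : ∀ t, (!y 5 t || s (.inr (.inl (true, t)))) = true := hhubimp true 1
  have himp₇ : ∀ t, (!y 7 t || s (.inr (.inl (true, t)))) = true := hhubimp true 2
  have hsum : ∀ t, ¬ 3 ≤ (y 0 t).toNat + (y 1 t).toNat + (y 2 t).toNat + (y 3 t).toNat +
      (y 4 t).toNat + (y 5 t).toNat + (y 6 t).toNat + (y 7 t).toNat := by
    intro t
    fin_cases t <;> simp only [Fin.zero_eta, Fin.mk_one, Fin.reduceFinMk] <;> omega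
  have hports : ∀ t, y 0 t = false ∧ y 1 t = false ∧ y 2 t = false ∧ y 3 t = false ∧
      y 4 t = false ∧ y 5 t = false ∧ y 6 t = false ∧ y 7 t = false → ∀ p, y p t = false := by
    rintro t ⟨h₀, h₁, h₂, h₃, h₄, h₅, h₆, h₇⟩ p
    fin_cases p
    exacts [h₀, h₁, h₂, h₃, h₄, h₅, h₆, h₇]
  have hpath : ∀ t ≠ 0, (∀ p, y p t = false) ∧ ∀ σ, s (.inr (.inl (σ, t))) = false := by
    intro t ht
    have hpq : ∀ p q, (∀ t ≠ 0, outerVertex (mate (.inl (p, true, t))) = .inl (q, false, t)) →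
        (∀ t ≠ 0, outerVertex (mate (.inl (q, false, t))) = .inl (p, true, t)) →
        (!(y p t ^^ y q t)) = true := by
      intro p q h₁ h₂
      replace h₁ := himp _ _ _ _ (h₁ t ht)
      replace h₂ := himp _ _ _ _ (h₂ t ht)
      rw [hy] at h₁ h₂
      revert h₁ h₂
      generalize y p t = a
      generalize y q t = b
      revert a b
      decide
    have hc := pathCheck_eq
    simp only [pathCheck, forallBool_iff] at hc
    specialize hc (y 0 t) (y 1 t) (y 2 t) (y 3 t) (y 4 t) (y 5 t) (y 6 t) (y 7 t)
    rw [hpq 0 1 (by decide) (by decide), hpq 1 2 (by decide) (by decide),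
      hpq 3 4 (by decide) (by decide), hpq 4 5 (by decide) (by decide),
      hpq 6 7 (by decide) (by decide), Bool.or_assoc, Bool.or_eq_true, Bool.or_eq_true,
      Nat.ble_eq] at hc
    replace hc := (hc.resolve_left (by decide)).resolve_left (hsum t)
    simp only [forallBool_iff] at hc
    specialize hc (s (.inr (.inl (false, t)))) (s (.inr (.inl (true, t))))
    rw [hhub₀, hhub₁, himp₀, himp₃, himp₆, himp₂, himp₅, himp₇] at hc
    simp only [Bool.and_self, Bool.not_true, Bool.false_or, Bool.not_eq_true', Bool.or_eq_false_iff,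
      and_assoc] at hc
    obtain ⟨h₀, h₁, h₂, h₃, h₄, h₅, h₆, h₇, h₈, h₉⟩ := hc
    exact ⟨hports t ⟨h₀, h₁, h₂, h₃, h₄, h₅, h₆, h₇⟩, fun σ => by cases σ <;> assumption⟩
  have htree : (∀ p, y p 0 = false) ∧ (∀ σ, s (.inr (.inl (σ, 0))) = false) ∧
      ∀ i, s (.inr (.inr i)) = false := by
    have hc := treeCheck_eq
    simp only [treeCheck, forallBool_iff] at hc
    specialize hc (y 0 0) (y 1 0) (y 2 0) (y 3 0) (y 4 0) (y 5 0) (y 6 0) (y 7 0)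
    rw [Bool.or_eq_true, Nat.ble_eq] at hc
    replace hc := hc.resolve_left (hsum 0)
    simp only [forallBool_iff] at hc
    specialize hc (s (.inr (.inl (false, 0)))) (s (.inr (.inl (true, 0))))
    rw [hhub₀, hhub₁, himp₀, himp₃, himp₆, himp₂, himp₅, himp₇] at hc
    simp only [Bool.and_self, Bool.not_true, Bool.false_or, forallBool_iff] at hc
    specialize hc (s (.inr (.inr 0))) (s (.inr (.inr 1))) (s (.inr (.inr 2))) (s (.inr (.inr 3)))
      (s (.inr (.inr 4)))
    rw [himp 0 true 0 (.inr (.inr 0)) rfl, himp 1 false 0 (.inr (.inr 0)) rfl,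
      himp 1 true 0 (.inr (.inr 1)) rfl, himp 2 false 0 (.inr (.inr 1)) rfl,
      himp 3 true 0 (.inr (.inr 2)) rfl, himp 4 false 0 (.inr (.inr 2)) rfl,
      himp 4 true 0 (.inr (.inr 3)) rfl, himp 5 false 0 (.inr (.inr 3)) rfl,
      himp 6 true 0 (.inr (.inr 4)) rfl, himp 7 false 0 (.inr (.inr 4)) rfl] at hc
    simp only [Bool.and_self, Bool.not_true, Bool.false_or, forallBool_iff] at hc
    specialize hc (s (.inr (.inr 5))) (s (.inr (.inr 6))) (s (.inr (.inr 7)))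
    have h₀ := hout 0
    have h₁ := hout 1
    have h₂ := hout 2
    have h₃ := hout 3
    have h₄ := hout 4
    have h₅ := hout 5
    have h₆ := hout 6
    have h₇ := hout 7
    simp only [outMate, Matrix.cons_val, outerVertex, hy] at h₀ h₁ h₂ h₃ h₄ h₅ h₆ h₇
    rw [h₀, h₁, h₂, h₃, h₄, h₅, h₆, h₇, Bool.or_assoc, Bool.or_eq_true, Bool.or_eq_true, Nat.ble_eq] at hc
    replace hc := (hc.resolve_left (by decide)).resolve_right (by omega)
    simp only [Bool.not_eq_true', Bool.or_eq_false_iff, and_assoc] at hc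
    obtain ⟨h₀, h₁, h₂, h₃, h₄, h₅, h₆, h₇, h₈, h₉, hc⟩ := hc
    refine ⟨hports 0 ⟨h₀, h₁, h₂, h₃, h₄, h₅, h₆, h₇⟩, fun σ => by cases σ <;> assumption,
      fun i => ?_⟩
    obtain ⟨h₀, h₁, h₂, h₃, h₄, h₅, h₆, h₇⟩ := hc
    fin_cases i
    exacts [h₀, h₁, h₂, h₃, h₄, h₅, h₆, h₇]
  rintro (⟨p, σ, t⟩ | ⟨σ, t⟩ | i)
  · rw [hy]
    by_cases ht : t = 0
    exacts [ht ▸ htree.1 p, (hpath t ht).1 p]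
  · by_cases ht : t = 0
    exacts [ht ▸ htree.2.1 σ, (hpath t ht).2 σ]
  · exact htree.2.2 i

end Vert

namespace Vert

variable {ℓ : Fin 8 → ℕ} {S : Vert ℓ → Bool}

theorem sum_cross_eq (S : Vert ℓ → Bool) : ∑ d, (rotation ℓ).cross S d =
    ∑ e, outerCross (S ∘ ofVertex) e + ∑ p, pieceCost S p := by
  rw [sum_eq]
  congr 1

theorem sum_deviation (S : Vert ℓ → Bool) (s : OuterVertex → Bool) (β : Fin 8 → Bool)
    (hs : ∀ p σ t, s (.inl (p, σ, t)) = β p) (hs' : ∀ w, s (.inr w) = S (ofVertex (.inr w))) :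
    ∑ e, (S (ofVertex (outerVertex e)) ^^ s (outerVertex e)).toNat =
      ∑ p, deviation S p (β p) := by
  have h : ∀ w, (S (ofVertex (.inr w)) ^^ s (.inr w)).toNat = 0 := by
    intro w
    rw [hs', Bool.xor_self]
    rfl
  simp only [Fintype.sum_sum_type, Fintype.sum_prod_type, outerVertex, h, Finset.sum_const_zero,
    add_zero, hs, deviation, Fintype.sum_bool, Finset.sum_add_distrib]
  rfl

/-- If the pieces can be assigned to sides, not all to the same side, so that deviating ports are
paid for inside the pieces, then the cut has at least six edges. -/
theorem six_le_ncard_of_ne (β : Fin 8 → Bool) (hd : ∀ p, 2 * deviation S p (β p) ≤ pieceCost S p)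
    (hβ : ∃ p q, β p ≠ β q) : 6 ≤ (edgeCut (rotation ℓ).graph S).ncard := by
  set s : OuterVertex → Bool := Sum.elim (fun q => β q.1) (fun w => S (ofVertex (.inr w))) with hs
  have h6 := six_le_of_ne s β (fun _ _ _ => rfl) hβ
  have hcut := (rotation ℓ).sum_cross_le S
  rw [sum_cross_eq] at hcut
  have hdev := sum_deviation S s β (fun _ _ _ => rfl) fun _ => rfl
  have hpieces := Finset.sum_le_sum fun p (_ : p ∈ Finset.univ) => hd p
  rw [← Finset.mul_sum, ← hdev] at hpieces
  have hmate := Equiv.sum_comp (Function.Involutive.toPerm mate mate_mate)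
    fun e => (S (ofVertex (outerVertex e)) ^^ s (outerVertex e)).toNat
  have hxor : ∀ a b c d : Bool,
      (a ^^ b).toNat ≤ (c ^^ d).toNat + (c ^^ a).toNat + (d ^^ b).toNat := by decide
  have houter : ∑ e, outerCross s e ≤ ∑ e, (outerCross (S ∘ ofVertex) e +
      (S (ofVertex (outerVertex e)) ^^ s (outerVertex e)).toNat +
      (S (ofVertex (outerVertex (mate e))) ^^ s (outerVertex (mate e))).toNat) :=
    Finset.sum_le_sum fun e _ => hxor _ _ _ _
  rw [Finset.sum_add_distrib, Finset.sum_add_distrib, sum_outerCross] at houter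
  have hmate' : ∑ e, (S (ofVertex (outerVertex (mate e))) ^^ s (outerVertex (mate e))).toNat =
    ∑ e, (S (ofVertex (outerVertex e)) ^^ s (outerVertex e)).toNat := hmate
  omega

theorem six_le_ncard_of_const (h : IsStable (rotation ℓ).graph S) (hne : ∃ a b, S a ≠ S b)
    (β : Bool) (hc : ∀ p, ConstPiece S p β) : 6 ≤ (edgeCut (rotation ℓ).graph S).ncard := by
  have hport := fun p σ t => (rotation ℓ).atMostOne_of_isStable h (port p σ t)
  have hnbr : ∀ p σ t, S ((rotation ℓ).nbr (port p σ t) 1) = β := by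
    intro p σ t
    cases σ
    exacts [(hc p _).2 _, (hc p _).2 _]
  have hy : ∀ p σ t, S (port p σ t) = S (port p true t) := by
    intro p σ t
    cases σ
    · have h₀ := hport p false t
      have h₁ := hport p true t
      rw [hnbr] at h₀ h₁
      have : ∀ x y z w β : Bool, atMostOne (x ^^ y) (x ^^ β) (x ^^ z) →
        atMostOne (y ^^ x) (y ^^ β) (y ^^ w) → x = y := by decide
      exact this _ _ _ _ _ h₀ h₁
    · rfl
  have hout : ∀ p σ t, (S (port p σ t) ^^ β) = true →
      (S (ofVertex (outerVertex (mate (.inl (p, σ, t))))) ^^ β) = true := by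
    intro p σ t
    have h₀ := hport p σ t
    rw [hnbr] at h₀
    have h₁ : S ((rotation ℓ).nbr (port p σ t) 2) =
        S (ofVertex (outerVertex (mate (.inl (p, σ, t))))) := by
      rw [← ofOuter_fst, ← rotFun_ofOuter]
      rfl
    rw [h₁] at h₀
    revert h₀
    have : ∀ a b c d : Bool, atMostOne (a ^^ b) (a ^^ c) (a ^^ d) = true →
      (a ^^ c) = true → (d ^^ c) = true := by decide
    exact this _ _ _ _
  have hxor : ∀ a b c : Bool, ((a ^^ c) ^^ (b ^^ c)) = (a ^^ b) := by decide
  have hcross : outerCross (fun v => S (ofVertex v) ^^ β) = outerCross (S ∘ ofVertex) := by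
    funext e
    exact congrArg Bool.toNat (hxor _ _ _)
  have hhub : ∀ σ t, atMostOne ((S (hub σ t) ^^ β) ^^ (S (port (hubPiece σ 0) true t) ^^ β))
      ((S (hub σ t) ^^ β) ^^ (S (port (hubPiece σ 1) true t) ^^ β))
      ((S (hub σ t) ^^ β) ^^ (S (port (hubPiece σ 2) true t) ^^ β)) = true := by
    intro σ t
    have h₀ := (rotation ℓ).atMostOne_of_isStable h (hub σ t)
    simp only [hxor]
    have h₁ : ∀ i, S ((rotation ℓ).nbr (hub σ t) i) = S (port (hubPiece σ i) true t) :=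
      fun i => hy _ _ _
    rw [h₁, h₁, h₁] at h₀
    exact h₀
  have hvert : ∀ x, atMostOne
      ((S (out x) ^^ β) ^^ (S (ofVertex (outerVertex (outMate x 0))) ^^ β))
      ((S (out x) ^^ β) ^^ (S (ofVertex (outerVertex (outMate x 1))) ^^ β))
      ((S (out x) ^^ β) ^^ (S (ofVertex (outerVertex (outMate x 2))) ^^ β)) = true := by
    intro x
    have h₀ := (rotation ℓ).atMostOne_of_isStable h (out x)
    simp only [hxor]
    have h₁ : ∀ i, S ((rotation ℓ).nbr (out x) i) = S (ofVertex (outerVertex (outMate x i))) := by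
      intro i
      rw [show outMate x i = mate (.inr (.inr (x, i))) from rfl, ← ofOuter_fst]
      rfl
    rw [h₁, h₁, h₁] at h₀
    exact h₀
  rcases constant_or_le (fun v => S (ofVertex v) ^^ β) (fun p t => S (port p true t) ^^ β)
    (fun p σ t => congrArg (· ^^ β) (hy p σ t)) (fun p σ t hp => hout p σ t (by rwa [hy]))
    hhub hvert with hall | h6
  · exfalso
    have hx' : ∀ β x : Bool, (x ^^ β) = false → x = β := by decide
    have hx := hx' β
    have : ∀ v, S v = β := by
      intro v
      cases v with
      | port p s t => exact hx _ (hall (.inl (p, s, t)))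
      | hub s t => exact hx _ (hall (.inr (.inl (s, t))))
      | out x => exact hx _ (hall (.inr (.inr x)))
      | leaf p j t => exact (hc p j).2 t
      | ctr p j => exact (hc p j).1
    obtain ⟨a, b, hab⟩ := hne
    exact hab ((this a).trans (this b).symm)
  · have hcut := (rotation ℓ).sum_cross_le S
    rw [sum_cross_eq, sum_outerCross, ← hcross] at hcut
    have hpieces := Finset.sum_le_sum fun p (_ : p ∈ Finset.univ) => (hc p).deviation_le
    have hdev : ∀ p, deviation S p β = 2 * ∑ t, (S (port p true t) ^^ β).toNat := by
      intro p
      rw [deviation, Finset.mul_sum]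
      refine Finset.sum_congr rfl fun t _ => ?_
      rw [hy p false t, two_mul]
    simp only [hdev, ← Finset.mul_sum] at hpieces
    omega

theorem six_le_ncard (hℓ : ∀ p, 3 ≤ ℓ p) (h : IsStable (rotation ℓ).graph S)
    (hne : ∃ a b, S a ≠ S b) : 6 ≤ (edgeCut (rotation ℓ).graph S).ncard := by
  have hpiece : ∀ p, ∃ β, 2 * deviation S p β ≤ pieceCost S p ∧
      (ConstPiece S p β ∨ 2 * deviation S p (!β) ≤ pieceCost S p) := by
    intro p
    rcases constPiece_or p h (hℓ p) with ⟨β, hβ⟩ | hβ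
    exacts [⟨β, hβ.deviation_le, .inl hβ⟩, ⟨true, hβ _, .inr (hβ _)⟩]
  choose β hβ hβ' using hpiece
  by_cases hβne : ∃ p q, β p ≠ β q
  · exact six_le_ncard_of_ne β hβ hβne
  push Not at hβne
  by_cases hall : ∀ p, ConstPiece S p (β p)
  · exact six_le_ncard_of_const h hne (β 0) fun p => hβne p 0 ▸ hall p
  push Not at hall
  obtain ⟨p, hp⟩ := hall
  have hp' := (hβ' p).resolve_left hp
  refine six_le_ncard_of_ne (Function.update β p (!β p)) (fun q => ?_) ⟨p, p + 1, ?_⟩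
  · rcases eq_or_ne q p with rfl | hq
    · rwa [Function.update_self]
    · rw [Function.update_of_ne hq]
      exact hβ q
  · rw [Function.update_self, Function.update_of_ne (by simp), hβne (p + 1) p]
    simp

theorem cyclicallyConnected (hℓ : ∀ p, 3 ≤ ℓ p) : CyclicallyConnected (rotation ℓ).graph 6 :=
  cyclicallyConnected_of_stable (rotation ℓ).isCubic fun _ h hne => six_le_ncard hℓ h hne

theorem connected (hℓ : ∀ p, 3 ≤ ℓ p) : (rotation ℓ).graph.Connected :=
  haveI : Nonempty (Vert ℓ) := ⟨out 0⟩
  connected_of_stable fun _ h hne => by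
    have := six_le_ncard hℓ h hne
    omega

end Vert

/-- The sum of the colours of three edges. -/
def colSum (a : Fin 3 → Kol) : ZMod 2 × ZMod 2 := (a 0).1 + (a 1).1 + (a 2).1

/-- Two triples of colours which can be the colours of the edges entering and leaving a claw. -/
def IsStep (a b : Fin 3 → Kol) : Prop :=
  (∀ t, a t ≠ b t) ∧ Function.Injective fun t => (a t).1 + (b t).1

/-- A cyclic order of the three colours. -/
def nextCol (x : ZMod 2 × ZMod 2) : ZMod 2 × ZMod 2 := (x.2, x.1 + x.2)

/-- For a triple with zero sum, its orientation; for a triple with nonzero sum, which colour is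
repeated. -/
def sense (a : Fin 3 → Kol) : Bool :=
  if colSum a = 0 then decide (nextCol (a 0) = a 1)
  else decide (nextCol (colSum a) = a 0) || decide (nextCol (colSum a) = a 1)

theorem Fin.forall_three_fun {α : Type*} {P : (Fin 3 → α) → Prop} :
    (∀ a, P a) ↔ ∀ x y z, P ![x, y, z] :=
  ⟨fun h x y z => h _, fun h a => by
    have := h (a 0) (a 1) (a 2)
    rwa [show ![a 0, a 1, a 2] = a by ext i; fin_cases i <;> rfl] at this⟩

instance (a b : Fin 3 → Kol) : Decidable (IsStep a b) := inferInstanceAs (Decidable (_ ∧ _))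

theorem colSum_eq_of_isStep : ∀ a b, IsStep a b → colSum b = colSum a := by
  simp only [Fin.forall_three_fun]
  decide +kernel

theorem sense_of_isStep :
    ∀ a b, IsStep a b → sense b = (sense a ^^ decide (colSum a ≠ 0)) := by
  simp only [Fin.forall_three_fun]
  decide +kernel

theorem isStep_of_colSum_eq : ∀ a b, (∀ t, a t ≠ b t) → colSum a = colSum b → IsStep a b := by
  simp only [Fin.forall_three_fun]
  decide +kernel

theorem val_third {x y z : Kol} : x ≠ y → x ≠ z → y ≠ z → z.1 = x.1 + y.1 := by
  suffices h : ∀ x y z : Kol, x ≠ y ∧ x ≠ z ∧ y ≠ z → z.1 = x.1 + y.1 from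
    fun h₀ h₁ h₂ => h x y z ⟨h₀, h₁, h₂⟩
  decide +kernel

theorem colSum_third {a b c : Fin 3 → Kol} (h₀ : ∀ t, a t ≠ b t) (h₁ : ∀ t, a t ≠ c t)
    (h₂ : ∀ t, b t ≠ c t) : colSum c = colSum a + colSum b := by
  simp only [colSum, val_third (h₀ _) (h₁ _) (h₂ _)]
  abel

theorem colSum_twist (a : Fin 3 → Kol) : colSum (a ∘ twist) = colSum a := by
  simp only [colSum, Function.comp_apply]
  exact add_right_comm _ _ _

theorem sense_twist :
    ∀ a : Fin 3 → Kol, sense (a ∘ twist) = (sense a ^^ decide (colSum a = 0)) := by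
  simp only [Fin.forall_three_fun]
  decide +kernel

theorem colSum_steps {x : ℕ → Fin 3 → Kol} {n : ℕ} (h : ∀ j < n, IsStep (x j) (x (j + 1))) :
    colSum (x n) = colSum (x 0) := by
  induction n with
  | zero => rfl
  | succ n ih =>
    rw [colSum_eq_of_isStep _ _ (h n n.lt_succ_self), ih fun j hj => h j (hj.trans n.lt_succ_self)]

theorem sense_steps {x : ℕ → Fin 3 → Kol} {n : ℕ} (h : ∀ j < n, IsStep (x j) (x (j + 1))) :
    sense (x n) = (sense (x 0) ^^ (decide (colSum (x 0) ≠ 0) && decide (n % 2 = 1))) := by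
  induction n with
  | zero => simp
  | succ n ih =>
    have h' : ∀ j < n, IsStep (x j) (x (j + 1)) := fun j hj => h j (hj.trans n.lt_succ_self)
    rw [sense_of_isStep _ _ (h n n.lt_succ_self), ih h', colSum_steps h']
    rcases Nat.mod_two_eq_zero_or_one n with hn | hn
    · simp [hn, show (n + 1) % 2 = 1 by omega]
    · simp [hn, show (n + 1) % 2 = 0 by omega]

/-- An odd number of steps cannot close up with a twist. -/
theorem not_isStep_twist {x : ℕ → Fin 3 → Kol} {n : ℕ} (hn : n % 2 = 1)
    (h : ∀ j < n, IsStep (x j) (x (j + 1))) : x n ≠ x 0 ∘ twist := by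
  intro hx
  have h₁ := sense_steps h
  rw [hx, sense_twist] at h₁
  by_cases h0 : colSum (x 0) = 0 <;> simp [h0, hn] at h₁

namespace Vert

variable {ℓ : Fin 8 → ℕ} {c : Vert ℓ × Fin 3 → Kol}

/-- The colours along a piece, starting and ending at the edges between the two ends. -/
def pieceColors (c : Vert ℓ × Fin 3 → Kol) (p : Fin 8) (j : ℕ) (t : Fin 3) : Kol :=
  if j = 0 then c (port p true t, 0)
  else if h : j - 1 < ℓ p + 1 then c (leaf p ⟨j - 1, h⟩ t, 0)
  else if j = ℓ p + 2 then c (port p false (twist t), 1)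
  else c (port p false (twist t), 0)

theorem pieceColors_leaf (j : Fin (ℓ p + 1)) (t : Fin 3) :
    pieceColors c p (j + 1) t = c (leaf p j t, 0) :=
  dif_pos j.2

theorem pieceColors_end (t : Fin 3) :
    pieceColors c p (ℓ p + 2) t = c (port p false (twist t), 1) := by
  simp [pieceColors]

theorem pieceColors_last (t : Fin 3) :
    pieceColors c p (ℓ p + 3) t = c (port p false (twist t), 0) := by
  simp [pieceColors]

theorem colSum_third_port {c : Vert ℓ × Fin 3 → Kol} {p : Fin 8} {s : Bool}
    (h : ∀ t, Function.Injective fun i => c (port p s t, i)) :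
    colSum (fun t => c (port p s t, 2)) =
      colSum (fun t => c (port p s t, 0)) + colSum (fun t => c (port p s t, 1)) :=
  colSum_third (fun t => (h t).ne (by decide)) (fun t => (h t).ne (by decide))
    fun t => (h t).ne (by decide)

theorem pieceColors_succ_leaf (hc : ∀ d, c (rotFun d) = c d) (p : Fin 8)
    (j : Fin (ℓ p + 1)) (t : Fin 3) :
    pieceColors c p (j + 1 + 1) t = c (leaf p j t, 1) := by
  rw [← hc]
  obtain ⟨j, hj⟩ := j
  by_cases h : j < ℓ p
  · simp [rotFun, pieceColors, h]
  · simp [rotFun, pieceColors, show j = ℓ p by omega]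

theorem pieceColors_one (hc : ∀ d, c (rotFun d) = c d) (p : Fin 8) (t : Fin 3) :
    pieceColors c p 1 t = c (port p true t, 1) := by
  rw [← hc]
  exact pieceColors_leaf (0 : Fin (ℓ p + 1)) t

theorem isStep_pieceColors (hc : ∀ d, c (rotFun d) = c d) (p : Fin 8)
    (hleaf : ∀ j t, Function.Injective fun i => c (leaf p j t, i))
    (hctr : ∀ j, Function.Injective fun i => c (ctr p j, i))
    {j : ℕ} (h₀ : 0 < j) (hj : j < ℓ p + 2) :
    IsStep (pieceColors c p j) (pieceColors c p (j + 1)) := by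
  obtain ⟨k, rfl⟩ : ∃ k : Fin (ℓ p + 1), j = k + 1 := ⟨⟨j - 1, by omega⟩, by simp; omega⟩
  have h : ∀ t, (c (leaf p k t, 2)).1 = (pieceColors c p (k + 1) t).1 +
      (pieceColors c p (k + 1 + 1) t).1 := by
    intro t
    rw [pieceColors_leaf, pieceColors_succ_leaf hc]
    exact val_third ((hleaf k t).ne (by decide)) ((hleaf k t).ne (by decide))
      ((hleaf k t).ne (by decide))
  refine ⟨fun t => ?_, fun t t' ht => ?_⟩
  · rw [pieceColors_leaf, pieceColors_succ_leaf hc]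
    exact (hleaf k t).ne (by decide)
  · simp only [← h] at ht
    have := hc (leaf p k t, 2)
    have := hc (leaf p k t', 2)
    simp only [rotFun] at *
    refine hctr k ?_
    simp_all [Subtype.ext_iff]

theorem colSum_pieceColors (hc : ∀ d, c (rotFun d) = c d) (p : Fin 8)
    (hleaf : ∀ j t, Function.Injective fun i => c (leaf p j t, i))
    (hctr : ∀ j, Function.Injective fun i => c (ctr p j, i)) :
    colSum (pieceColors c p (ℓ p + 2)) = colSum fun t => c (port p true t, 1) := by
  have h := colSum_steps (x := fun j => pieceColors c p (j + 1)) (n := ℓ p + 1)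
    fun j hj => isStep_pieceColors hc p hleaf hctr (by omega) (by omega)
  rw [h]
  congr 1
  funext t
  exact pieceColors_one hc p t

theorem colSum_port_false (hc : ∀ d, c (rotFun d) = c d) (p : Fin 8)
    (hleaf : ∀ j t, Function.Injective fun i => c (leaf p j t, i))
    (hctr : ∀ j, Function.Injective fun i => c (ctr p j, i))
    (htrue : ∀ t, Function.Injective fun i => c (port p true t, i))
    (hfalse : ∀ t, Function.Injective fun i => c (port p false t, i)) :
    colSum (fun t => c (port p false t, 2)) = colSum fun t => c (port p true t, 2) := by
  rw [colSum_third_port hfalse, colSum_third_port htrue,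
    ← colSum_pieceColors hc p hleaf hctr, ← colSum_twist fun t => c (port p false t, 1)]
  congr 2
  · funext t
    exact hc (port p true t, 0)
  · funext t
    rw [pieceColors_end]
    rfl

theorem colSum_port_true_ne_zero (hc : ∀ d, c (rotFun d) = c d) (p : Fin 8)
    (hleaf : ∀ j t, Function.Injective fun i => c (leaf p j t, i))
    (hctr : ∀ j, Function.Injective fun i => c (ctr p j, i))
    (htrue : ∀ t, Function.Injective fun i => c (port p true t, i))
    (hℓ : Even (ℓ p))
    (hfalse : ∀ t, c (port p false t, 0) ≠ c (port p false t, 1)) :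
    colSum (fun t => c (port p true t, 2)) ≠ 0 := by
  intro h0
  rw [colSum_third_port htrue] at h0
  have hsum : colSum (fun t => c (port p true t, 0)) = colSum (fun t => c (port p true t, 1)) := by
    rwa [← CharTwo.sub_eq_add, sub_eq_zero] at h0
  have hlast : pieceColors c p (ℓ p + 3) = pieceColors c p 0 ∘ twist := by
    funext t
    rw [pieceColors_last]
    exact hc (port p true (twist t), 0)
  refine not_isStep_twist (x := pieceColors c p) (n := ℓ p + 3) ?_ (fun j hj => ?_) hlast
  · obtain ⟨k, hk⟩ := hℓ
    omega
  rcases Nat.eq_zero_or_pos j with rfl | hj₀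
  · refine isStep_of_colSum_eq _ _ (fun t => ?_) ?_
    · rw [pieceColors_one hc]
      exact (htrue t).ne (by decide)
    · rw [funext fun t => pieceColors_one hc p t]
      exact hsum
  rcases (by omega : j < ℓ p + 2 ∨ j = ℓ p + 2) with hj' | rfl
  · exact isStep_pieceColors hc p hleaf hctr hj₀ hj'
  · refine isStep_of_colSum_eq _ _ (fun t => ?_) ?_
    · rw [pieceColors_end, pieceColors_last]
      exact (hfalse _).symm
    · rw [hlast, colSum_twist, colSum_pieceColors hc p hleaf hctr]
      exact hsum.symm

end Vert

/-- The Petersen graph minus a vertex has no nowhere-zero flow of this kind. -/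
theorem petersen_flow : ∀ f₀ f₁ f₂ f₃ f₄ f₅ f₆ : ZMod 2 × ZMod 2,
    f₆ + (f₂ + f₅) = (f₀ + f₁ + (f₄ + f₅)) + (f₁ + f₂ + (f₃ + f₄)) →
      (0 : ZMod 2 × ZMod 2) ∈ [f₀, f₁, f₂, f₃, f₄, f₅, f₆, f₂ + f₅, f₀ + f₁, f₁ + f₂, f₃ + f₄,
        f₄ + f₅, f₀ + f₁ + (f₄ + f₅), f₁ + f₂ + (f₃ + f₄), f₆ + (f₂ + f₅)] := by
  decide +kernel

namespace Vert

variable {ℓ : Fin 8 → ℕ}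

theorem ofVertex_ne_hub {y : (Fin 8 × Bool × Fin 3) ⊕ (Bool × Fin 3) ⊕ Fin 8} {t : Fin 3}
    (h : y ≠ .inr (.inl (false, t))) : (ofVertex y : Vert ℓ) ≠ hub false t :=
  (ofVertex_injective (ℓ := ℓ)).ne (a₂ := .inr (.inl (false, t))) h

/-- Removing two vertices of a hub leaves a graph without colouring. -/
theorem not_threeEdgeColorable_induce (hℓ : ∀ p, Even (ℓ p)) :
    ¬ThreeEdgeColorable ((rotation ℓ).graph.induce ({hub false 0, hub false 1}ᶜ : Set (Vert ℓ))) := by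
  intro hcol
  obtain ⟨c, hc, h⟩ := (rotation ℓ).exists_dart_coloring hcol
  have hA : ∀ v : Vert ℓ, (∀ t, v ≠ hub false t) → v ∈ ({hub false 0, hub false 1}ᶜ : Set (Vert ℓ)) :=
    fun v hv => by simp [hv]
  have hinj : ∀ v, (∀ t, v ≠ hub false t) → (∀ i t, (rotFun (v, i)).1 ≠ hub false t) →
      Function.Injective fun i => c (v, i) := by
    intro v hv hv' i j hij
    by_contra hne
    exact h v i j (hA _ hv) (hA _ (hv' i)) (hA _ (hv' j)) hne hij
  have hleaf : ∀ p j t, Function.Injective fun i => c (leaf p j t, i) := by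
    refine fun p j t => hinj _ (by simp) fun i t' => ?_
    fin_cases i
    · simp only [rotFun]; split_ifs <;> simp
    · simp only [rotFun]; split_ifs <;> simp
    · simp [rotFun]
  have hctr : ∀ p j, Function.Injective fun i => c (ctr p j, i) :=
    fun p j => hinj _ (by simp) (by simp [rotFun])
  have hport : ∀ p s, (∀ t t', outerVertex (mate (.inl (p, s, t))) ≠ .inr (.inl (false, t'))) →
      ∀ t, Function.Injective fun i => c (port p s t, i) := by
    intro p s hps t
    refine hinj _ (by simp) fun i t' => ?_
    fin_cases i
    · cases s <;> simp [rotFun]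
    · cases s <;> simp [rotFun]
    · have : (rotFun (port p s t, 2) : Vert ℓ × Fin 3).1 = _ := ofOuter_fst (mate (.inl (p, s, t)))
      exact this ▸ ofVertex_ne_hub (hps t t')
  have htrue : ∀ p t, Function.Injective fun i => c (port p true t, i) :=
    fun p => hport p true (by revert p; decide)
  have houter : ∀ e, c (ofOuter (mate e)) = c (ofOuter e) := by
    intro e
    rw [← rotFun_ofOuter]
    exact hc _
  set f : Fin 8 → ZMod 2 × ZMod 2 := fun p => colSum fun t => c (port p true t, 2) with hf
  have hne : ∀ p, f p ≠ 0 := by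
    intro p
    refine colSum_port_true_ne_zero hc p (hleaf p) (hctr p) (htrue p) (hℓ p) fun t => ?_
    exact h _ _ _ (hA _ (by simp)) (hA _ (by simp [rotation, Rotation.nbr, rotFun]))
      (hA _ (by simp [rotation, Rotation.nbr, rotFun])) (by decide)
  have hout : ∀ x, Function.Injective fun i => c (out x, i) := by
    refine fun x => hinj _ (by simp) fun i t => ?_
    have hx : ∀ x i t, outerVertex (outMate x i) ≠ .inr (.inl (false, t)) := by decide
    have : (rotFun (out x, i) : Vert ℓ × Fin 3).1 = _ := ofOuter_fst (mate (.inr (.inr (x, i))))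
    exact this ▸ ofVertex_ne_hub (hx x i t)
  have hhub : ∀ t, Function.Injective fun i => c (hub true t, i) :=
    fun t => hinj _ (by simp) fun i t' => by simp [rotFun, mate, ofOuter]
  have hsum : ∀ v : Vert ℓ, (Function.Injective fun i => c (v, i)) →
      (c (v, 2)).1 = (c (v, 0)).1 + (c (v, 1)).1 := fun v hv =>
    val_third (hv.ne (by decide)) (hv.ne (by decide)) (hv.ne (by decide))
  have hjunction : ∀ p x, mate (.inr (.inr (x, 0))) = .inl (p, true, 0) →
      mate (.inr (.inr (x, 1))) = .inl (p + 1, false, 0) →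
      mate (.inl (p, true, 1)) = .inl (p + 1, false, 1) →
      mate (.inl (p, true, 2)) = .inl (p + 1, false, 2) →
      (∀ t t', outerVertex (mate (.inl (p + 1, false, t))) ≠ .inr (.inl (false, t'))) →
      (c (out x, 2)).1 = f p + f (p + 1) := by
    intro p x h₀ h₁ h₂ h₃ hp
    have h₀' := houter (.inr (.inr (x, 0)))
    have h₁' := houter (.inr (.inr (x, 1)))
    have h₂' := houter (.inl (p, true, 1))
    have h₃' := houter (.inl (p, true, 2))
    rw [h₀] at h₀'
    rw [h₁] at h₁'
    rw [h₂] at h₂'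
    rw [h₃] at h₃'
    simp only [ofOuter] at h₀' h₁' h₂' h₃'
    have hfalse : f (p + 1) = _ := (colSum_port_false hc (p + 1) (hleaf _) (hctr _) (htrue _)
      (hport _ _ hp)).symm
    rw [hfalse, hsum _ (hout x), hf]
    simp only [colSum, ← h₀', ← h₁', h₂', h₃']
    generalize (c (port p true 0, 2)).1 = a
    generalize (c (port (p + 1) false 0, 2)).1 = b
    generalize (c (port p true 1, 2)).1 = d
    generalize (c (port p true 2, 2)).1 = e
    revert a b d e
    decide +kernel
  have hg₀ : _ = f 0 + f 1 := hjunction 0 0 rfl rfl rfl rfl (by decide)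
  have hg₁ : _ = f 1 + f 2 := hjunction 1 1 rfl rfl rfl rfl (by decide)
  have hg₂ : _ = f 3 + f 4 := hjunction 3 2 rfl rfl rfl rfl (by decide)
  have hg₃ : _ = f 4 + f 5 := hjunction 4 3 rfl rfl rfl rfl (by decide)
  have hg₄ : _ = f 6 + f 7 := hjunction 6 4 rfl rfl rfl rfl (by decide)
  have hmate : ∀ x i, c (ofOuter (outMate x i)) = c (out x, i) := fun x i =>
    houter (.inr (.inr (x, i)))
  have hq₁ : (c (out 5, 2)).1 = f 0 + f 1 + (f 4 + f 5) := by
    rw [hsum _ (hout 5), ← hmate 5 0, ← hmate 5 1, ← hg₀, ← hg₃]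
    rfl
  have hq₂ : (c (out 6, 2)).1 = f 1 + f 2 + (f 3 + f 4) := by
    rw [hsum _ (hout 6), ← hmate 6 0, ← hmate 6 1, ← hg₁, ← hg₂]
    rfl
  have ho : f 6 + f 7 = (c (out 5, 2)).1 + (c (out 6, 2)).1 := by
    have h₀ : c (out 4, 2) = c (out 7, 0) := hmate 7 0
    have h₁ : c (out 5, 2) = c (out 7, 1) := hmate 7 1
    have h₂ : c (out 6, 2) = c (out 7, 2) := hmate 7 2
    rw [← hg₄, h₀, h₁, h₂, hsum _ (hout 7), add_comm, add_assoc, CharTwo.add_self_eq_zero, add_zero]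
  have hf₇ : f 7 = f 2 + f 5 := by
    have hmate' : ∀ t i, c (port (hubPiece true i) true t, 2) = c (hub true t, i) := fun t i =>
      houter (.inr (.inl (true, t, i)))
    have h₂ : f 2 = colSum fun t => c (hub true t, 0) := congrArg colSum (funext fun t => hmate' t 0)
    have h₅ : f 5 = colSum fun t => c (hub true t, 1) := congrArg colSum (funext fun t => hmate' t 1)
    have h₇ : f 7 = colSum fun t => c (hub true t, 2) := congrArg colSum (funext fun t => hmate' t 2)
    rw [h₂, h₅, h₇]
    exact colSum_third (fun t => (hhub t).ne (by decide)) (fun t => (hhub t).ne (by decide))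
      fun t => (hhub t).ne (by decide)
  have hP := petersen_flow (f 0) (f 1) (f 2) (f 3) (f 4) (f 5) (f 6)
  rw [← hf₇, ← hq₁, ← hq₂, ← hg₀, ← hg₁, ← hg₂, ← hg₃] at hP
  specialize hP ho
  have hne' : ∀ k : Kol, (0 : ZMod 2 × ZMod 2) ≠ k.1 := fun k => k.2.symm
  rw [← hg₄] at hP
  simp only [List.mem_cons, List.not_mem_nil, (hne _).symm, hne', or_false] at hP

end Vert

/-- Certificates of criticality: bit `k` of the entry of an edge gives the colour of this edge in a
colouring of the short superposition with both ends of the edge `k` removed. -/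
def certificate : List (ℕ × ℕ) := [
  (17361035629585667035946437050032848393476457019649579132533310808178024148727464483680221610213638135,
    17498005798263598071743608030298815540577208626305599035255367503562183529618114226291092882808635390),
  (137103798238973224557249763587437566804410224662845300441693121632517956257700536492822038932619263,
    17498005798264095394980017816940970922825355447145699491406164851279623993595007385788105416183906252),
  (17497872168699571943565070527124412827384669083258170900630946991009182165437845148589405562665992356,
    4065851304110451985624846998881282236120481815006100720632456480322074674648803702619270833787338587),
  (17498005798264095394980017816940970922825355447145699491406164851279623993595007385788105416184430590,
    137103667868670739150140242406913508604207917368868105821773080919529192625438024801611412331036673),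
  (17497872299073853014863458341442179943570045957272951744457245813461694635933393609419055016814051346,
    3928880874723247342907273534710056054252575306688455166170792609710687011893475965450752143115943919),
  (13433090944009043310620323192445452715109971778572262637365506687896577406505020763081162443319639935,
    17497203108307216834279007828674946143946428050567208111201298051950872622560555084646111599384887431),
  (17360902130395424655829877574534057414221147529776831385584391770360094800969569360986494003773699917,
    17498005798264095394980017816940970922825355447145699491406164851279623993595007385788105416182333367),
  (137103667868670739150140242406913508604207917368868105821773080919529197577297351639272843190992893,
    17497872299073853014863458341442179943570045957272951744457245813461694635933393609419055085521731106),
  (4065048353445294464476254099994309186970693158446184600989577201200975939799741072238331941446519259,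
    13432957444819298253740173503588817118102809109539615346567384997796088517772159473046786008180817660),
  (13569794114307981555893604581640304050444544868003088414642117350797199464003122431444970601289391866,
    4065315351824784578236553477707580380985018496511479182585820581401953722217322979144746227324643839),
  (17498005798263598071743608030298815540577208626305599035255367503562183529618114226291092876145946599,
    13432823945629553196860023814732181521095646440506968055769263307695599629039298183012409519639925213),
  (17361169128775412092826586738889483990483619688682226423331432498278513042412185100552259398891175862,
    4065048353444797141239844313352153804722546337606084144838779853483535475822847912741319408123152203),
  (17360902130395424655829877574534057414221147529776831385584391770360094800969569360986493997312375565,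
    17498005798264095394980017816940970922825355447145699491406164851279623993595007385788105415211320567),
  (137103667868670739150140242406913508604207917368868105821773080919529197577297351639272825440564477,
    17497872299073853014863458341442179943570045957272951744457245813461694635933393609419055085035146026),
  (4065048353445294464476254099994309186970693158446184600989577201200975939799741072238331965658300251,
    13432957444819298253740173503588817118102809109539615346567384997796088517772159473046786007524421812),
  (17498005798264095394980017816940970922825355447145699491406164851279623988643148058950444045448511478,
    133499190242380116559475498790979255309489872747746948919037817929357661613776369050347829755769),
  (17361302627964659826470326641103964205242635536874773257978756840661561467168153231089623269113315299,
    17497738669510324209921330624909932612625653235065624065983622648626133745633736344889703057407803359),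
  (13569660615118236499013454892783668453437382198970441123843995660696710580222120468248255561764913342,
    4065315482198568326298531505383192114922248549686159570261322056137025723784118953639721766761660367),
  (136970168678925682269990553550277911597045248336220815023651390819040308844436061604896339346587657,
    17498005798263598071743608030298815540577208626305599035255367503562183529618114226291092882808635390),
  (4065048483819575535774641914312076303156070032460965444815876023653488415247148859905642817789067103,
    13432957444819298253740173503588817118102809109539615346567384997796088512820300146209124594512593060),
  (17361035499210888641411639449072925895042933324794697832556214638008071214255022863353559614096408573,
    17497872299074350338099868128084335325818192778113052200608043161179135104862146095753728912335044659),
  (137103667868670739150140242406913508604207917368868105821773080919529192625438024801611412412827899,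
    17360902130395424655829877574534057414221147529776831385584391770360094800969569360986494003851296694),
  (17361035629585667035946437050032848393476457019649579132533310808178024153679323810517882972359622527,
    13569258422731090432189303757729705847828089630329992072184291279386866339363145196706403603731186125),
  (17497872299073853014863458341442179943570045957272951744457245813461694640885252936256716447611090820,
    4065851043401675701940854301618178583601473734184575525043646652812286846857300213883313224786378363),
  (4065315351824784578236553477707580380985018496511479182585820581401953722217322979144746227322547191,
    13432690446439310816743464339233390541840336950634220308820344269877670271377684406643359188861883976),
  (17360902130395921979066287361176212796469294350616931841735189118077535259994603193645845113065477274,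
    4065315351824784578236553477707580380985018496511479182585820581401953722217322979144746227207204863),
  (13569794114307484232657194794998148668196398047162987958491320003079759004978088598785619492098277229,
    17498005798264095394980017816940970922825355447145699491406164851279623993595007385788105416064891319),
  (4065315351824784578236553477707580380985018496511479182585820581401953722217322979144746233901316087,
    13432690446439310816743464339233390541840336950634220308820344269877670271377684406643359189564452104),
  (17360902130395921979066287361176212796469294350616931841735189118077535259994603193645845131050794778,
    4065315351824784578236553477707580380985018496511479182585820581401953722217322979144746227156900599),
  (13569794114307484232657194794998148668196398047162987958491320003079759004978088598785619468356274413,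
    17498005798264095394980017816940970922825355447145699491406164851279623993595007385788105415647508479),
  (137103667868670739150140242406913508604207917368868105821773080919529197577297351639272790681752827,
    17497872299073853014863458341442179943570045957272951744457245813461694635933393609419055069327784846),
  (17497605300694860224339568750371064131803867440047757619011799780978157322444564188847314739962538782,
    400627944013565175246667529829289455011701952823172371461240471419605622884817267452689925911797),
  (17361302627964659826470326641103964205242635536874773257978756840661561467168153231089623309240762341,
    17497738669510324209921330624909932612625653235065624065983622648626133745633736344889703058082779003),
  (17361035629585169712710027263390693011228310198809478676382513460460583689702430651020870438984056831,
    17497872299074350338099868128084335325818192778113052200608043161179135099910286768916067601729945735),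
  (13569660484743955427715067078465901337252005324955660280017696838244198104774712680580944762645889212,
    4065315482198568326298531505383192114922248549686159570261322056137025728735978280477383146088595323),
  (4065315482199065649534941292025347497170395370526260026412119403854466192712871439974395690868457283,
    13432823815255272125561636000414414404910269566492187211942964485243087158543749722182760084550320124),
  (17211116020877710279228236501954163143582486053532193634189190041740925718393597255422053637163057152,
    423592947685323361025062704181659114577442483044331634493585472439320342603230452423197113240780799),
  (4339257272217202991132493096026924102805993325346898977178616224955648327037341576555545297579147228,
    17224599439078265620381269501351701345420633548689398844651275238423273754734561657450022169426788351),
  (13433090813634264916085525591485530216676448083717381337388410517726624472032579142718471590059180067,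
    17497204542385020082884900641440109224381974818361861357377594629250713143837028553616355371312480255),
  (17497471801505115167459419061514428534796704771015110328213678090877668433711702898812938244797235199,
    17361302627965157149706736427746119587490782357714873714129554188379001931145046390568620894355193855),
  (17348219707333836979194152494918488176674122869655610376061834061998120561002662316963502116810784803,
    13581941497644190535860576443247895376376125826921099054806449191313784372732069345737385372612034559),
  (4065584045022185588180554923904907389587148396119280943447403272611309074343432238321770186673749980,
    13569659963298552759108133631978992626317767196266984344395425711047956476389407424915619114628677631),
  (137504165437408586554179522334664917377549103626709522065340803503555399798991603114997456018866176,
    17497738799884605281219718439227699728811030109080404909809921471078646216129281265011874291702038527),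
  (17497470758542695284202542892070236069195086312663292771254317765173758369220336746389859446024044543,
    3916331298999394972879740751406346740463554958289895018195959040166817398328664159546446732207325184),
  (13445772715215139974329222373021158603670810335502794024582085410954084136302903737819946118979518463,
    4065049005264480881145165574156829631842161340309540924287349803132289579655560959390087892294434816),
  (17360768631206176922186137672319577199462131681584284550937067427977046371261741894215341367422353407,
    17498005798264095394980017816940970922825355447145699491406164851279623993595007384635117940879917055),
  (17484922877669079820725348308990682416123413880413769452346651108271896493765823964397217009836752895,
    13581941497644190535860576443247895376376125826921099054806449191313784372732069336639859038625988607),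
  (4065584044985880991922640499027564485472430474791947644439196889238155204030231613356238407882244096,
    13432956792999614513834852242784141290983194106836158567118815048147334413939446421787580550671761407),
  (137504165437408586554179522334664917377549103626709522065340803503555399798991531637796023975280640,
    17497738799884605281219718439227699728811030109080404909809921471078646216129281337633231921655840767),
  (17497470758542695284202542892070236069195086312663292771254317765173758369220336727220859378167971839,
    3916331298999394972879740751406346740463554958289895018195959040166817398328664014268023732676067328),
  (13445772715215139974329222373021158603670810335502794024582085410954084136302903683195544346044661759,
    4065049005264480881145165574156829631842161340309540924287349803132289579655561177315816996195008512),
  (17497471801505115167459419061514428534796704771015110328213678090877668433711702308499113556301578239,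
    17361168085812992209569710569445291524882001230330408866372072172574602972968959546627506369281916927),
  (17074813348148007204595404179329218599269400971199309729306944449141770322142217178563182131986038819,
    13581942540606610419117452612692087841977744285272916611765809517017694442175294234551453520840622079),
  (4338990404208015362779303239494176966991870294575581590202292885467659313203879147071327279529852892,
    13569793462488297815988283320835628223324929865299631635193547401148445365122268199703255149287833599),
  (287156775765875229512080692700078973257194731678800438813218189739676057618992037290480478657183743,
    17210982521687965222348086813097527546575323384499546343391068351640436824708876638532001441377157120),
  (17497872299074350338099868128084335325818192778113052200608043161179135099910286768916067344029581276,
    4065849348551438795390516101394022922884125818035538695976479740170279118650717494234830278910017571),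
  (13295718564355018277473995966641645291168058242000943678480482628712586747792946199721291098169540643,
    4202287233909077117506021850299325631657297205144755812925682222567037250753921693644719926919299036),
  (17361035629585667035946437050032848393476457019649579132533310808178024153679320269792394167919312895,
    136970168678428359033580766908122529348898427496120358872854043101599839915687115995715646311628800),
  (150321130651658526563340246893217599781501711972495835496177875387369056967015707934608997777670108,
    17497738799884605281219718439227699728811030109080404909809921471078646216129281266292378727549501439),
  (17484654836290865227450258336955875852392752162669324014782841018993854776543678794858013983202869283,
    17361302627965157149706736427746119587490782357714873714129554188379001931145046387270503825445748735),
  (17497738799884605281219718439227699728811030109080404909809921471078646216129281275398833095953088511,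
    266998379490113760299377713271194014325338065294581596243380200977777465726119623296425736011776),
  (13617960316415685032144432821023360332210701214336759211360829113593124203854063095056550558957568,
    17497738799884605281219718439227699728811030109080404909809921471078646216129281270778060713433759743),
  (17484654836327169823708172761833218756507470083996657313791047402367008646856879425011870653608886271,
    17498005798264095394980017816940970922825355447145699491406164851279623993595007381174853693199089663),
  (17497738799884605281219718439227699728811030109080404909809921471078646216129281336499384744767651839,
    266998379490113760299377713271194014325338065294581596243380200977777465726049307860969833103360),
  (13617960316415685032144432821023360332210701214336759211360829113593124203854061510757051956985856,
    17497738799884605281219718439227699728811030109080404909809921471078646216129281420668328061066805247),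
  (17484654836327169823708172761833218756507470083996657313791047402367008646856879438129673293627654143,
    17498005798264095394980017816940970922825355447145699491406164851279623993595007172472813285502091263),
  (17361035629585667035946437050032848393476457019649579132533310808178024153679321005228810821720604671,
    137104710830593299170606625208950591957679554880585206630336058905998798091773739736453402173898752),
  (423727489837488301162088562482487177186223610428796482251067488243719295827461013371188461472055260,
    17497737756922185397962842269783507263209411650728587352850561145374736146686056227598695300337762303),
  (17211248477105035452851510021366606274988030264213023368027951406137504537683232236467377485308756003,
    17361169128775412092826586738889483990483619688682226423331432498278513042412184804241062129857200127),
  (17211383019257200392988535879667434337596811391597488215785433421941903495859319835470540240381280256,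
    423860989027233358042238251339122774193386279461443773049189178344208189512178586416703021709787135),
  (423325949305833247264763326468387920563117144979037052897342092238342565137512004657056876372951039,
    17348219707370141575452066919795831080788840790982943675070040445371274426364003042789927032618221532),
  (17361302627965157149706736427746119587490782357714873714129554188379001926193187063519286226554191871,
    17223930900130815856465730462746987990668483823847011534693100078843765371313824878228235756161728547),
  (1237982540583726101706047488,
    17498005798264095394980017816940970922825355447145699491406164851279623993594964884489759589377507327),
  (17498005276782885453351579732218874690024546217969790712926484688427668958873319088438123681764343807,
    17498005798264095394980017816940970922825355447145699491406164851279542848791515621672631863080910847),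
  (4189470138069895195047940843776693180001970019373558755666683078640392762658569510117423960591171584,
    13582476537365590646638051368118630230006394961403505774958296277419649989679000579294864347636957183),
  (17498005798009465897938207056157415211774183177014265942197922819950106436187769684032308053012381695,
    17498005798264095394980017816940970922825355447145699491406164851279623993594964884489759589377507327),
  (1068517036206373004121681843626697267488742488555498530589934292331112492528619151938554408468480,
    17496937804746134939938820306087886146768054094884521165021191330475469509981955125268267201869119487),
  (17497337778797124192616345201667251016579354711755085865269939987289084058426986380424140280888819711,
    3929148152394991115276063067106599367288163057609019930200337975019270039241413710855896393440034816),
  (667496203354781442559205066733696086985615294670003198850481831962070398571146982824104008089600,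
    17497338302315370110579269372657792937789542101982463037415556400777179490507198977210603744186597375),
  (17498005798264095394980017816940970922825355447145699491406164851279623835035408924645553957918212095,
    1735489466685739441945955136262761093114697424414780375581971306598907470015850670732334287814656),
  (17496937804746134939938820306087886146768054094884521165021191330475388600490429260585613804391366655,
    13568857645869104279703954749834371555537192389536679561205826876260353914738232656483182552119508991),
  (17498005798009465897938207056157415211774183177014265942197922819950106347053890955070393875251068927,
    17498005798264095394980017816940970922825355447145699491406164851279623358727613215165594319236104191),
  (3929548649964226285916512133676506158309651064706961802594703045321060592631353356376600264155594752,
    17496937804746134939938820306087886146768054094884521165021191330475470124110755765447896206996930559),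
  (13568857645869104279703954749834371555537192389536679561205826876260353419557060118131778939896463359,
    3929148152394991115276063067106599367288163057609019930200337975019271288020488277875138817526071296),
  (667496203354781442559205066733696086985615294670003198850481831967062466544071435574857749757952,
    17497338302315370110579269372657792937789542101982463037415556400777174578303056874548307786914070527),
  (17498005798264095394980017816940970922825355447145699491406164851279613850069049096826873948542074879,
    1735489466685739441945955136262761093114697424414780375581971306597580554018493882187062993485824),
  (17496937804746134939938820306087886146768054094884521165021191330475403576308658196188453532078178303,
    13568857645869104279703954749834371555537192389536679561205826876260350170805246012084600442122665983),
  (17497471801250485670417608300730872823745532500883676779005436059548145722066479352481094534883704831,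
    17224599457666218904433455038551268252156209268284047936852943525478339302483195547848265565292462079),
  (4189871157120340307316827995068696203824267255647409406540728311794098414682859112062292926421532672,
    17496937804746134939938820306087886146768054094884521165021191330475510054838699274358824934712541183),
  (13309069135471970485824237643868723898051226874726821120452288370189196359134229707140101841579147263,
    4202554492992867605822625845496302037957309236470671484753559300820595275829426121276719688081997824),
  (17496937804746134939938820306087886146768054094884521165021191330475712883732079286581230977979252735,
    275008330874817173108359044669329834755098207253419044130681607007110789694299972113802195500007424),
  (13309202634661715542704387332725359495058389543759468411250410060289720647306852102370857281659076607,
    17484387968317982195354982905300471620693347053225339926814724062879019625595675242095589588463517695),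
  (4189470659805734633718189689282345123853951518680901083354605272822189864675210038661084290081619968,
    13308535138458360761261828127658625798971403928464798408051559578457515268771595067231733754642825215),
  (17497338302315370110579269372657792937789542101982463037415556400777179490507534265230887488996769791,
    667495948725284400748444283177985035813345163236453990608450502444503087775352012121584481337344),
  (17496937281227889021975896135097344225557866704657143992875574916987293059469797877118335947338940415,
    17497338302315370110579269372657792937789542101982463037415556400777179530122753612685427870265245695),
  (1736012984931657404870126126804682303302087651791952521198384794775367888040429245692001682194432,
    17498005798264095394980017816940970922825355447145699491406164851279623953979485806878661377622278143),
  (17497338302315370110579269372657792937789542101982463037415556400777179490506670072164522343922663423,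
    667495948725284400748444283177985035813345163236453990608450502445137955202579200012768946159616),
  (13568457148299869109063505683264464764515704382438737688811461805958563401061487295837115591920975871,
    17497338302315370110579269372657792937789542101982463037415556400777178955609243155457582291084115967),
  (3930216145912951570317260577959684143345464409870198256585311495823505650218995003424936051332874240,
    17498005798264095394980017816940970922825355447145699491406164851279622784431293837217889462723280895),
  (17497338302315370110579269372657792937789542101982463037415556400777175211516640523938006172864348159,
    667495948725284400748444283177985035813345163236453990608450502448782465223124126780579226058752),
  (13568457148299869109063505683264464764515704382438737688811461805958574812183733876108264766663819263,
    17497338302315370110579269372657792937789542101982463037415556400777177747136997396775071268393189375),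
  (3930216145912951570317260577959684143345464409870198256585311495823493526712539572727034654379474944,
    17498005798264095394980017816940970922825355447145699491406164851279621457587794250674358984749613055),
  (17497872299074350338099868128084335325818192778113052200608043161179130131880505116717428851764887551,
    274073836546601774947311222672880655704959524024888008543829776303734106403762349179637480162328576),
  (13308134641143755087663189821872274719001088191498290084865436539485525580885134100802818781464231935,
    17497338302315370110579269372657792937789542101982463037415556400777140351797297003335198834662834175),
  (4190004656310085364196977683925331800831429924680056697338850001894627768641181944479205106829492224,
    17224599457666218904433455038551268252156209268284047936852943525478302540555342638214890702164197375),
  (1601990531570179603607027063182875137124298523201038785702312535429947603345980050786023269990400,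
    17496403807987154712418221550661343758739403418753932001828704570073716762588739556540341664048218111),
  (17496937804746134939938820306087886146768054094884521165021191330475510057624083252216862031816425471,
    14685823464073654666232422493584078189309746181537890976414309204718301803880097980275209596305408),
  (17497471801250485670417608300730872823745532500883676779005436059548024028228134415922627515764441087,
    17484921965076962422875581660727014008721997729355929090007210823280812922797395117055593958724337663),
  (17498005798239229233159528484833201810418014405140676683866297380337009064515733545093826889465724927,
    8467052610390487566613866043256104582285120725089276039226484820244541922002759834403882547753779199),
  (17461687760876931331092399047696734987324889132164952882881500653144622405191119092300883795218792447,
    17428617564251025803675780862538106260551547982937761726169345573598300155792611498867750006169796608),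
  (9068470650737520771068835495729101043492776700163406816290222309681341630255536960770381113888604159,
    17462628494285782895387233794379675634393890006968343007903010917064290859164544346981556984884494336),
  (9033222674160444553407100241232783506184059058943783502295822617059161979443363965944815797500116991,
    17497872299038045741841953703206992421703474856785718901599836777803060567566019611930765571735420928),
  (36449450724678546769844968967172409533827909964425383442778748766342849498725522892409262959493119,
    17498005798264095394980017816940970922825355447145699491406164510992064775798009094784967488086999039),
  (8439151279662156132619564558743312537105058393194645772471608315248881691044445758299348939416010752,
    17489461850101513471666865837714388188937365435599960005730188783370056509657159444404017673369812991),
  (17487325863059624682747553376302354049845000880996397879172973378573347720001129950248406454816997375,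
    8475592386684491673915941452304012928337057711303927963312418435772739008409891191315775530639294463),
  (17497868127224670805072363450307565463411718944705781972770599136069186937232767960223931188348190720,
    9022546910769348777944226053493593591495460404874418818891871168063327782751982425734203241897394175),
  (17498005798224806859303644672210695725221756600777763455470877209502824585901025524299854700116705279,
    8543948198886519571066404103925638002707932873072784684179728940709237006783635612655283815317504),
  (9033093346784074433296540805275574867468652301991073140326965135248173062391697601828983262358274048,
    17498005798264095394980017816940970922825355447145699491406143048741713737563579517450747923713228799),
  (8467052610374573223048752870707132350344422458206061442400962182397659475355555804940151020196986879,
    17497872299074350338099868128084335325818192778113052200608029209246419011575508404840485211286274048),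
  (8677447388631576451216092960561235009870601905720075482282363264996631195434770068729082949926911,
    17489461850065208875408951412837045284822647514272626706722017813522819699706711947633675060710998015),
  (17487321691209945149720048698525584187438527047589127651335481774684824532827276036621423739341373439,
    8475596558534171206943446130080782790743531544711198191137229715358100665944306259389668656899162111),
  (17497872299074350338099868128084335325818192778113052200595289280804509058623489251107145844797734912,
    9022542738919669244916721375716823729088986571467148591067266796424520113592968049607673630156652543),
  (17498005798224806859303644672210695725221756600777763455483678669881407710298377467376819892838727679,
    8543948198886519571066404103925638002707932873072784683972810526484781825170444547811169588477952),
  (10684107056139538205608264984008264379415682916973664688246096334760250330254462069203463393247232,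
    17489461850118422461704798583547671185374357344163375514876811577034792042049861345512551990205349887),
  (80072341042353674743716740710482285253294821759486797764309823309953111062763734105020023623909375,
    17497872299074350338099868128084335325818192778113052200594592020964443974723931416261339939082338304),
  (17418066956448786019847184763248777903190234857426394195757653750798445340743457481546159278780317695,
    17498005798210881808684170646230345022273645617254950683264786452908682497405811078142006832077471743),
  (17498005798261111455561559097088038629336474522105096754501380764974656691179990002079247059910655999,
    9030953187876591767784610493537798634029115647097026189084464117339724855453606508366298068683849728),
  (17487321691190549543500067019481524279760801034825209861454436280402470325523867951887149118393417727,
    8406341823755108440559829875686382745561953804304848314154427693878099568878551862787541062643613695),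
  (17497872299057441348061935382251052329381200869549636691458632933876161479964216525766141812219576320,
    69388234021026763086793540677350778244156597649545063649576841160371261432686438872555944023162879),
  (8475463059308121553805382016346804289621650954351217601343533026343831406863722031933916979363053568,
    9022546910805653374202140478370936495610178326201752117900074488983448411214103968329669729994145791),
  (17461694018578841438117827214607203972705164039621191626598953178899916555939188590615074575097004031,
    8475458887494746617035791763447377331329895042271280672514294023493470834922953595799979109726027776),
  (9058854518641227798036826402927933583323895900318989754869846900139169233771738782773293595590918143,
    17498005798227790798722103392063628018710637525818366192397955745564458006037541793452843084357304319),
  (8475592386684491673915941452304012928337057711303927963312396633400982251851577807091393920703135743,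
    9022413411579603721064076364636957994488297735841771528093768218044795241216544062809687378016337920),
  (9031090858928946761838919312867244031894569491379555567640779273501988418447029423653762176110297087,
    8475592386684491673915941452304012928337057711303927963312407546513404254908404348574743215879487487),
  (17489328350914752354205174868710684885419083691607915451859148351138406581875992126837335827264045056,
    17498005798264095394980017816940970922825355447145699491406132159929565551003404704216904605307502591),
  (8475596558534171206943446130080782790743531544711198191149839235320210015535916432385221386592845823,
    9022409239729924188036571686860188132081823902434501300268956938459433583682128994735794251756470272),
  (9031086687079267228811414635090474169488095657972285339816165349316862220834013561846754144545669119,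
    8475596558534171206943446130080782790743531544711198191137033696223694864129080380676148460785762303),
  (17489328350914752354205174868710684885419083691607915451846542898637005151436701337092991632885678080,
    17498005798264095394980017816940970922825355447145699491405990618732392498392218900566257989178097663),
  (17498005798262106102034378670372349393832768163785297666788950289987986215513481878810243182245183487,
    9030953187875597121311790920253487869532822005416825276798288388898707346637193200213077220778835968),
  (17418066956411486777116450765087124234579223294418859984453427515341431840465756998213364069169102847,
    8475596558534171206943446130080782790743531544711198191149077088595375734926769323315156740535746559),
  (79938841854597910809206198422468217238719436087241331572391041235919218116881363738674495494291456,
    17489461850118422461704798583547671185374357344163375514863570428490256741679706265655936348460154879),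
  (17487321691210939796192868271809894951934820689269328563625490530104063070086405121285949694438014975,
    8475596558533176560470626556796472026247237903030997278845478800617450501342509021668285718617653247),
  (17428617564295287571716251873689935280636615037706702323599158636272921678478189249925813029329436672,
    9091797473698732011300337630111223774270564311873498468063309987716704443587531492527329830642909183),
  (80072341021963422050915488382111613079275167315368095584892943032446910732728435580367063413161983,
    17428617564296282218189071446974246045132908679386903235897965727925460386474590327812433192731803648),
  (4531496515330468620111138511715614621980333041067641101322432963334878047528200237387285558875652096,
    12969713282075461424044657374984177535752502182456248307446870061023258209307192039058680654468218879),
  (16370467515242726077913547431007300256442511259600494260879947763540660936924616445181806515297714175,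
    17429554080573676251108917960990707753779251408796366762778167946522233131720820131136618221583466495),
  (1725877487830285141960046908062693201932334292977181638143717908943893429681540089100788657031217151,
    17497868127152061612556534600552879655182283101284817911013200146687526228861926829633585557027160064),
  (17469169954691209824815499486708115062542643216499229740781361433708714470503719090257320712475770879,
    17498005798264095394980017816940970922825355447145699491227758889691379008462721639606918524136587263),
  (6254032332870580734214009708754052417247397291244692021435400472982954277892753662838458596894703616,
    11324986577053947124748386375003885861997242286407417598445330557554840305474010845284174979022192639),
  (16393965458562695855333645008663550260906377927582524711527958061384385059307711496890413458160353279,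
    1138370490804789652008954639194475200904796326283848173655278855082762508916161034998032939987501055),
  (28835843572885570164518330232855860282712230646797137517517273531041271298675767617214263421042688,
    17498005798264095394980017816940970922825355447145418872565845584212874763302266834758304846313422847),
  (17497989110865377262869999105833891473199460112749607877223814625395389424279847843998275676258959359,
    6173019221210148270231631441937085060828113160738188353644737807349608919910559267129308400618307584),
  (12348030492493632332522399627571418617122831009860601241111707362682800785236380585758319014320275455,
    16359635307459305742971063177746495721920559120861664241259564562505451769845400758215071107683188736),
  (17469169954691209824815499486708115062542643216498808818319076284726552641863895014601193849224167423,
    17498005798264095394980017816940970922825355447142701596876947531963357793019042881115249707426250751),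
  (6288345796575252714466572828564027506607320763567075667064790278236512899893190487431215798867197951,
    11324986577053947124748386375003885861997242286410320209026553019048222129217226170755791315376537599),
  (16359651994858023875081081888853575171546454455254669112602954984011884438695568610085562608299016192,
    1138370490804789652008954639194475200904796326289742714119204856097822605525988789521143149554040831),
  (28835843572885570164518330232855860282712230670381926262664472951254396492028685896760218827620352,
    17498005798264095394980017816940970922825355447122209768953739372023413383845793305661790534812827647),
  (17497989110865377262869999105833891473199460112486959528303132919274122701821781071404347468204212223,
    6173019221210148270231631441937085060828113160731918241692368350815852606829872440839216781621985280),
  (12348030492493632332522399627571418617122831010146807807350429238192685000513335543018465356092014591,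
    16359635307459305742971063177746495721920559120843999821344620379091531297666207483428557804265275392),
  (17486257850978577105474659660357471479459464852653720656952684926291330232117713667714831887588392959,
    16934105220780975133227732086512209164570241453051974640038617178905122127342703706358716653566427135),
  (6237077935845567702950828073716017405567174166585993972289679609314542679081426138228918735448571903,
    11342074473341314405407546548653242278914063922969323092085044674374298477520280139812541785027117055),
  (16393831959300341605937666470052228855669779415703694920238958060898432125155585482608108920364859392,
    1685183172000542633102080195973880542243088684198605801074682637674166493364302600968197288421752831),
  (12965441308003619603879867331571838431523296773411535001929276723006144392997166476231283091800326143,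
    5079377171456228772193276042148537832640351031457467598605631525074498473539220608635348980145848320),
  (15781744442569391761728353146409720378665500800380859258515811087957179101641934664449997086048387072,
    17454213873535875688442555675987644443336024674468944646945116948115540584413973131124840574031495167),
  (1127669696358883799948696585656607140416205782528907389515130423219898156971474748167194569183592447,
    17497069281941444947546880718488369429597652021287047686655744568380626789389010668368876836808032256),
  (17498005798264095394980017816940970922825355447145418874171499238507079629492838550388986874744012799,
    280618661913305478504245160454804848613677823164416),
  (11243990152792232792876026819293997955203853490297192623469211090556079053227850538114098595759128575,
    17498005798264095394980017816940970922825355447145605952090068364904449225384570112413483379640500223),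
  (6254015645471862602103990997646972967621501956848460108804857251242411679066797235676722432976093184,
    17498005798264095394980017816940970922825355447145512412060348032176294516644989854314113774905196543),
  (17498005798264095394980017816940970922825355447145418869711350198800955001185694895859314573547929599,
    3278513369536586383015430868705055702656278629187584),
  (11209676689087560812623463699484022865843930017973967123994952907925947517333478253149743064891260928,
    17498005798264095394980017816940970922825355447142890420141038876161416938062229333691111116374015999),
  (6288329109176534582356554117456948056981425429174632000040123573861766471891069201738376625046683647,
    17498005798264095394980017816940970922825355447139992027433560283955973611818625223839996575131631615),
  (17498005798264095394980017816940970922825355447125201496345676508887033531568083819066161933722845183,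
    20501100751467670561291644857193088823360251318239232),
  (11209676689087560812623463699484022865843930018243350303674581633059797550943028708716457904108994560,
    17498005798264095394980017816940970922825355447137187499633058076672802920206945168029582057747251199),
  (6288329109176534582356554117456948056981425428901895095319295736377048878917081610423803545600917503,
    17498005798264095394980017816940970922825355447133710382427803955325153422125876514723268523303370751),
  (17480917901976728114320857643291614505908533810943350334676279791271922696708330434061377370706673663,
    563900577483120261752285730428761758255113994117214573819973151630712476001517759555703643989606400),
  (11260944549817245824139208454332032966884076615170553352378116149881101282542923594136461918223728640,
    17480917901976728114320857643291614505908533810590157649034916677369096902839862190924452265719758847),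
  (6254149144734216851499969536258294372858100468345111995540140355289168214033325810336671134927290367,
    16951193117068342413886892260161565581487063089248793360393026685793550196159504687179455739681832959),
  (4544312437545994080605508641952631934667949268417711843295972149619698657050670498856026694949535744,
    12982529204290986884539027505221194848440118409398819705436872805863776796357018714130283514717798399),
  (12977189218113231325280854413756204061418035927707682790738047198003376796417725711349156694810689535,
    6199723249651000696109933409241055123400622296086880550345948989084399004310941476263419600353361920),
  (17474509940868965384073672578173105849564725696825070750520657603872618884965098025704630710697983999,
    15813759142586203209311074719419691873809970188805698727029507907611072186522054581182507717297700863),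
  (17498005798264095394980017816940970922825355434885735164479053984412847776392533916838192438715613183,
    1166365734968422731502994368533386875004715728686341102099268852420660138568539022508068159530991616),
  (17496937804236875945855198784520774619355426606127152873373661645870105228857510081585989496644567039,
    16314543824873027895271632908783365129153300596345712757765248614941405833517579578519477510989676543),
  (5169071883220460824787841259780081515977371847267137234356386499933337669104752045591457513995239423,
    12367264813080004267087039340875540573706009738051806239099776775824459629952534592954472682546528255),
  (17498005793171505454143802601269856701801910042984532966375435366330925843058744952761024528542334975,
    16331640064823449645727888013108918314127673339247959684556348186836069192042254338102539786290987007),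
  (17412441153188231772284729720680732162421578081228645329429648828693975433460695454761502203986313215,
    1183461985613283357715301425768279924128323817108797095636533740155060856203715605848648142295138304),
  (16876185304432093309340963526400535395784695421252282652905604755168935173945413735822347021838188544,
    16359789662950808289260750400716340810690177424932105045403671325864010698315746682111695731891896319),
  (1166374090380738661481298720130489308158731261303325242551525793569917270518830189512885220096868352,
    17497997446416592423587064116313648444358825657602980942895230687246160276986668574570478316151635967),
  (679243876368026821776459434550351718862179646647991901006692690089759369078691102537568844962070527,
    17480901210503938029541866759647643679455445509823110986930359901295441212680627993791157995906793471),
  (16359772975515785560892817264731918404317322372783024197478911522457437120944104335427529625235881983,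
    1138232822748309834087200552209052518521692047738876711269360006607086754772341775807729530048610304),
  (17425265422158670263335838335873957732336542355784353206143717215830487392933100748832414402724495359,
    16404380435836284836535852278504817283583399278647933315595483612831392548828649001806801624776048639),
  (17497997446416592423587064116313648444281691356442259409249686352669057883008362060077954603300159487,
    1110738302035470895275270296356803360846927768870689375630975617485095243195302230181267039055773696),
  (16863369382216567848846593396163518082984994494685809416208849420962203044885339285400582729026764800,
    16359772975515785560892817264731918404895085647813220455024649088337740360881413437602332753906368511),
  (1166374090380738661481298720130489276919970041855795862105948851746270342159722355163646330966900736,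
    17497997446416592423587064116313648444165780357390901270602433363864299867364370996426558136995807231),
  (679243876368026821776459434550351720457158340905351318440243579566565302781402835209100398258290687,
    17480901210503938029541866759647643677822756538412128392306743897253456797264454851191185836771115007),
  (16359772975515785560892817264731918437200747606397505497358425260660983152704916829376613115592966143,
    1138232822748309834087200552209052517107740357783482242471147342187732252379997648987261203828965376),
  (17425257070311167291942884635246635244424127989930714057323716889768721219368482940152248035262332927,
    5157465886059866832314289411997632845879314969382601761565009149326944912527107206543513037343555584),
  (17478633773463855062556495985386515258434250388775732600932735867322244473744200135962643248852238336,
    11229048680785966529611586629176236063741204277598710362714036302729234240716319951069437373911662591),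
  (16882741407016808181270115227717973730827708160811484678405898745517142330878787880025051214750154751,
    17488377146541707930778063798419670165621689090511858526134857905559734973886081007804584162767142911),
  (127091210013036269592403829440178539968567267430757969747127567556815454973788249605679822005075967,
    17408177529436115941262028813194381217694719005998329201715594608240206996019221733494276997414649855),
  (12950737688375083908285813234732003047610353181186518950592664596790519839640781942228844255398330367,
    6268973804876846997478449898871814282381069689516859846995949918651788988883839241126640950850879488),
  (5127562043876430866272358355240578054336088879697301317084037422455605877714120933282909656908300288,
    12439980145355877348475652716104149036994083889140472711557400753688424167380599330659453049554075647),
  (16331631712975946674334934312481595835693283576431737696780450268644073153639745255839083466619617279,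
    1166374085288148720645083504459375087157783949103993163424809110239234392511427543729453919083954176),
  (16904326566971932195898846478650857964373381139271155598166151635746849744705239467350704549200396288,
    16331648400410969402702867448466018242054085621646703208665109157166072798196448665789275162607091711),
  (1760053316580311919726254842749488045561549045968879824008140328875548812409719206473463716854628351,
    17497989110829072666612084680956548516438841323540702610722411435153940796482138562057481750677815295),
  (16404372083988781865142898577877494805129725385778145150956432885273497083519638820936652146427822079,
    1093633714275313529837119239063476117708485958040484724321615402481695161374697195198930891441176576),
  (16818770273743571544596512083017941682455416108349996906234643044029738254666071584372169257867280384,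
    16404372083988781865142898577877494805348337615597598620250994183778711531314084547603785797406294015),
  (1772869238795837380220624972986505358245546461120263836481953527598222860486791101571062225627512831,
    17498005798264095394980017816940970922233933198739301816518320607614420871536259558166148548413882367),
  (16404372083988781865142898577877494836599893628055852979847894098065260173844751765934222603634868223,
    1093633714275313529837119239063476117490140995443358266043951799698015727501874576634706060682199040),
  (16818770273743571544596512083017941681323251459752994385692860696489164644895370072997300840725217280,
    16404372083988781865142898577877494806158246061390168953733688335489616259740017296787467936712359935),
  (1772869238795837380220624972986505326287749318826496330385976873267141476589999050215305007578742783,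
    17498005798264095394980017816940970922002323837457871763034689567371615999948122898154036834974302207),
  (16404380435836284836535852278504817322661051811268064541100820256382097051681328689427736426480402431,
    12340548264051731534058682105570660555605615567517895950644887189368003207298536568606139658029498367),
  (16838133946696308905627080213945074863468180062136666018875662846346119462703450226739307105939881983,
    6286061705238286230806582245058062104086750078280560227791549502576556949209239969315587621686083584),
  (1753497213995597047797103141432049671040010922135110717920630877732485007684386914844226343388839936,
    16369401627238173025094771283253219162921281445996058214206324454811780760923936114784365465772752895),
  (17443663316203987228424747169195128074422504046824523133996234882530986304691589876478923292375252992,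
    12430368181032208016383717408689927755748503568143405158159997651443716676257254343714031559480705023),
  (4566640134689251819117726413763423565935084144118339787796428513041033657492725282706003962665893887,
    17497989110865377262869999105833891446870483287597444060083344931989124790214470400737571238511116287),
  (12985708145634951742417562050923390113144867493360997700341392083775599745972491136910811229805608959,
    5067654304630605510706319119358122643031724038550549764568987119126406520718290027124608034377039872),
  (4407609230034844670969941753481303039248771713830810315239830601322585734075205505878744501606940671,
    13090396568246657037284418595962713247648884717868144164893349521877258934599744008525449679616344064),
  (50368865856771265391899744831312443315233968027454401471775936699144873905104728078004810449682431,
    17484088468997163654502540982796140113299668750345934192879275875355435984288773457304756342291955711),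
  (17447636932421746501546762976534683187683772198246176112270945366903769746749868028678513395020857344,
    13516500931550488514987701989069210630636750752343256965771279988183126549616514663554134438804717567),
  (17463830005689360831764458561499986786188637863236581064981637461885598722371414154666971128473321471,
    17498005798246689081705675284437924716254721114134950919334928109995944767354302052779126616657756159),
  (17460619765320940253243895877401323595531815031800421906827626154383351075403508379757478510887698431,
    17480659246775402314858111220153040439715746198236762377712970204589875734228308932262807620420632576),
  (67548617692192524111601823278757039065767711864116790424764169332337249752883684987967689377972223,
    17483954895447648289631092558921967166336886956607855333874576401596325476855261479027248571682390016),
  (34175792594130169435540935230467192199491772473226766544622943140723732908119579570667119527854080,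
    17498005798262106102034378669875389114432180284332758327605949383931581694099875535719862124568117247),
  (17480826120758107726830610251002726625168032098600203573192214864869433435245159579686266459947794431,
    17346551507094039869068703955642621022983420289292853930981459442740066120609847311036748216139775),
  (17485022891001650074533963819350641830609344325130600280570887606866598435396497865519541549742948352,
    14050902817441751821744830419864028648902816786601652446636867573763859111300206121597706996547583),
  (17463830005671954518490116027009211514293987357262321720903751840028785026161978157591594283370020863,
    17498005798264095394980017809857876809781536184217128785457858914375377667144875261045657689068142591),
  (17496937802707109670658687843245699155808918818399349593825280597997267861477390804876710049461829631,
    17480659246758990648056588256075363517222513255705500006118846814875509415151931599159062247210221568),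
  (31230580323429419971152391925427192648319286094888701000087013245429082493425867061814066497454079,
    17483954895446653643158272997579478000726634320853569669913515768612786901307211688070394112576061440),
  (34175792594130169435542003863126101006449502422837212072510116701628790561385028118476557457031168,
    17498005798262106102034377624225695505141135991974742738731978513728491620389847697797684490722607103),
  (17480826120758107726830610223021105819119051658274487282434888267224135787667989563838753796727504895,
    17346551507094039869069810135465590578971357433802295083289087168316474888106831900796077058555903),
  (17485022891001650074533962778697426712157994621343286764332050195774094825908282281591395658506436608,
    14050902817441751821744769889788588277293473279697134198474149312624798342676140598978219220140031),
  (17463830005672949166860173605825433308270090340416357613736419607207177966428136315323949359579529215,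
    17498005723902833117279494561069128068509195087346362678841371731986709604715366428314212817602347007),
  (17462762010131380460970312037382128538359952659296093963616310243836514440119355045611088456978530303,
    17480659246758990648056587040351131213691698835413217770310160753732084499834512577712532887154196480),
  (65406372898163981289470618989760782521487365114748657881211967552180964571504029258175857228251135,
    17483954969807915920858797462065067739715964787985236325010277067380464540320838320607567076084678656),
  (13090396568255608855539794755521510233427819161547139073525729464461619605078916280020786534686916608,
    4407609230016443711222779647693946910680177087597354414211220633967484131041477058268630669817020415),
  (4425673266314732032985598715029078297372410059222810443336680557576822151292021557788719752117485567,
    13107743194089649869797116274676864048099002458634175222341021556160520721871823645213200743625916415),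
  (17483954969783547082274721535116047853378125377903452173531324433544721926986566920199558305392099328,
    14050828480548312705296281824924754443896766157234484563283356461819168929966874374327179767971839),
  (17498005798244699788760036137372351332844879435896945588976927336282487979466802246639783669919645695,
    19395606219981679568626329967142798908702569183009269904804423414310774291442022167347200),
  (54565710449142809885529505036168063779600803090038960787658483261172786071757211101603828380729344,
    17498005798245694435232855709773258784911981275765343751168378038526632186841095992002366463732088831),
  (17443440087834348191314469992135990098318124778898150995826338326450893682979812423130425659553218559,
    17498005798263100748507198242773209665993202490034055161718023878300327480058989047160796145176805375),
  (17498005798262106102034378669875368894472179921352912327344634119208576466241558630290501296860430335,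
    1989292945639154148675921436994425741511869748521404252288625945263974810691018732601344),
  (18247673062973392470737543167304554043863663697722151833475840054872214224181195260130588180348928,
    17498005798262106102034378666783331768718339694845058783670131207885673821259617168039838202890027007),
  (17479758125203111295454919429673503721026588957157252007348812322433218791102369736633609953791180799,
    17498005798264095394980017805882545896381839455371638326422003027111349952482657796239256805575753727),
  (17498005798262106102034377617144758187830688780229745393990634147278136265493518818853725052426256383,
    1989292945640199798369530728038718099527458622492274455378699655291812732868652578111488),
  (18247673062973392470737539344828955761910926370551418243028034439240147990899936885576864410632192,
    17498005798262106102034377567670897058275889076033739345489497643470032999994596015936503679218089983),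
  (17479758125203111295454920519796684256739335097690242188408711900701485098720451010755457746554847231,
    17498005798264095394980017753334463110830186006827092131153554771674866887500513623124041617844994047),
  (17498005798261111453664320137268575068164047273126241498860438792973963270064782203798698193712054271,
    74363251570646163222430693980367185628308213470145409430926107962005574005898719758588575744),
  (52423465638702602159113599641170807858342506696903243234193614687431279832545889927729552813981696,
    17498005798262106102034378331082496458113652328120218727231739809822969412308942082831694337245446143),
  (17445582332628376734136602688519680990344500767785534573545192385610639237569979916329361264936484863,
    17498005723902833117279493401899478532270290377876726500154470384056354212637818764149015440168845311),
  (4441785022599632767560066367933457249633791618935603560693870116302274096768651970912168711064387583,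
    13090396642608913961457761425063652895687014209048203842861521132985445379655808192552067151159099392),
  (13107576320082078296004126690673817118556367722557092045571959930322264033607258578815015077348900864,
    4407609155679550272106332318853946583860009600244005990161147392666642765483678548650477201588748287),
  (17446650253846479726395847098403153310124435286040305278417900174293485858398637013160902353062199295,
    17498005798239726556395934652958765033841473111812626106795420347533118239515275564274665985050411007),
  (10871948688604694682630599746249009268418050682358440078325115445751248838662511357033926523977990144,
    6626057109659400712349475966736580312505016550279763757034976040520707975214515757546182848771260415),
  (98514105738338452549020295084062981179012323720456326637336649502620987369845547564821575450492927,
    17467843289897939238722276657344439625756831891215498325591070911607386744493634212477447137067532288),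
  (15374993324636605338730370314778270570713312032014321236380803326762255672625363726492507541101084671,
    15280692680849833215176625132295525668783050262814257951451376023899209020779092110962113333795225600),
  (6626057112969584173893023093928381888432470035174962939736363277178477807950637835760605490889883647,
    10871948690132471664881406414905724876627372517654537029620640998736021355396277603064425097050718208),
  (17485056340147915535544262959852311937152274649377918973748474681321572795105829263935323208270479360,
    31230514106332469305855188060290203582093874500189854195684964293315573644204996525990283636113407),
  (10884964894270505204803980174742360031884623154100498434629830556403470064979736724590104052439711743,
    8472651346415154046481020894249679117948220163999884986581863510359915259051803087296126769124343807),
  (17497939041794226173215821531396732759121469655796204701699257310232642757987641983060733773400244223,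
    17496904429948698599832758216904617491845376622900112956017304042545070711558148224090215290071154687),
  (9038303911493147125948894645775983665859529065432978769612527907025597823522183407541603095585751039,
    17485056339646613682887954454729534052144874809574098066286461892089914321761600470520238891235016704),
  (8459701892381003245097225201915427818286974266737798137093851597205681826313704990790530262261301248,
    15634231872807111025464882221066630947745576217066256998916432047000583836804065270040041657607389183),
  (1168124785267115937712662501833249275346023415281413834022325610408668214990435115750518274654208,
    17498005798264094417370566804127796200700243215795431067818338316209469921262517123779134492132769791),
  (17498005798264095394979554648584021658043661163205664739774751771340961431338849555452073763665870847,
    14050826932879362868755488902592116778953245615266735147657656822021244476559041678720287220170751),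
  (17496904424338642524770042184077688221961181502217059556389272529838944889140602482361724360219164671,
    1863773925456986191330434779545649936615566148210675453544449621073517033852997934585320601028657152),
  (17496837673478829252373933222468902871946715184919720433428762747251944399838786229092983160543641599,
    17498005798264088101274296563663660904187941032977233447705703317550825253166732814894664903137689599),
  (15635333246732526136145511053933905919402694933788475686967976667170928593992655939573363853800505343,
    17483954971331214580737088695675142714035521955313485096122299160103093222576779622715749325558775808),
  (1863773925457021155946754348099961220645742086814110957462065652991239368957691390916478877587996672,
    15634231872807105327189809651940686482802010214483330023973953390211057782150481854448929880491950079),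
  (2054660956464417664058825176545122320064329357529902109204551336479729387188500985953262695312523264,
    15444512966584953595566327523159292400652084618582104234105306658724757529284314852938571586388099071),
  (17221654245292251288068744116067047952213094414159244541661449515883512678957407813466242000883810303,
    2067543658612082359411314722442949220311340155013921002115925906699368280544469889166271313652744191),
  (15719763145631336085193798165868379006820198657591462814757391798028592562273359099029714031442132991,
    1863773925457046405199198751710123459179305929271496136384457891642584008152195887628206147184361472),
  (15443411593940917532476176228843532767420478630873967692336049603229122220983767210733973805639663615,
    17399525070378995894429728184258541872546203917187866599329347964263619500366129149112094705091346432),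
  (2140058726287588626253598564072462505195846996986170057908800367210255362617156028996296499213107200,
    15719763146148303589442169415695652128190587446136854348194480365880243005692684031619269676691881983),
  (17412474525439373073675340161416480009850362661980556234197950509307596431787447508127255021513342975,
    17496904425874626715461245877068927022893931085620925739929405032882482034326088281376930274392145919),
  (10872015441764380458028812793471903487534473419811511895105852260173962813569696962968096905327804416,
    6627158476447020494890627432241446898302557320754187889716098371226485135599664923995119770748846079),
  (8472651344887128158822121598083798821514311612463062346909613404263748153197926120525735203010772991,
    17479724742775244577055738851431812432172933344251988847413610266072676522512361263677080308501446655),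
  (15651344809876682279348806285920798102509998891428014947803488048785417088880882845678706821190123519,
    10889128377305925718013669350208682515175220229285222245682621065260086329077988583904010753118568448),
  (17496904429948697622227475719303986152755512947010157297112195226922879699531078435105529238686531583,
    1101368315397772756710612849528153105091055595854958976687343804707354369349423706861050164936704),
  (8459701886770948511873534898163157152750756129513244333091340344606055009416373971994139369102376960,
    17496904429948697744203325690249815676726882839102034181378210153647312420951855259377251653913673727),
  (9039405279808545505776665365171267067409026053057519008661786216341353825910491625247167001858670591,
    17498005798264093573164718633269660961289568529014466530351448034485147116532951566950848573732814847),
  (17498005798264095393016183983476088248441591541398352574214705911350360027485806761013898737491116031,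
    6328579583796960719692736642934634823589957965505492022596061627525609568269217300480),
  (1862672551531571201570558400493779316230238508181169433399923827354288178557646583843616382783586304,
    17498005798264092960883014511044676918784468271594825396881727759020273086738401492596054883827711999),
  (15635333246732530994714416039963822499095554727028050223621636646342924162489995512883693930323902463,
    17498005798264091500497437325876545234129599688061749995972636438046952304389985753370587679323848703),
  (15444512966584951644469631111386976845743201195377419949500305872055295066959276785701337648037101567,
    2053492831679149093119411547058988540810685242732061301001319726283665204738967103742974342843072512),
  (2139024104503428907630488216919108358241991233414965772825484025960248447833049476879350320733356032,
    15444512966584893849811632215763849911303848783963992884574104635756786484068765259694190193157341183),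
  (17412474525439864632588898625989842386598909524028399247878033264450299523145161198315508609436352511,
    17498005798264039057571027230231131903669394750536572822453918420705606196887337029499074804692549631),
  (17497939046122917760963865240645768294994181654172677255842050788672163313390140408259955703611916287,
    2151973559564116964886317902159144498795864861951132000237031027927337088794783102783581796498931711),
  (15634298624948475210715354978047394461898326979716280532382723871109013814360238595855635076662427647,
    17208704791767556170951227447133414349835668300000031334220635326692568963463285517306744353243267072),
  (1863773925457232976112673978500665048225330728637529093719502722030831265419417282020506018798108672,
    15635333245196517654122490284589382997019177732340235648354663347939341934931946151485884682626662399),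
  (17498005798264095394980017816940970922825355447145699491406164851279623993595007385788105416184430591,
    0),
  (26855454766128478676390641399928325365424632143056776741785054752230612838676802278785024,
    17498005798261111455561559097088038629336474522105096754501380764974981209733648428806030215931232255),
  (17498005798239726556395938271475357192666161225980777140017094813125041258727242570434491280783310847,
    17498005798261111455561559097088038629336474522105096754501380764974981209733648428806030215931232255),
  (17497872299074350338099868128084335325818192778113052200608043161179135104862146095753728912334520320,
    133499189745056880149688856635597007162669032647290798121690100488888732861290034376503849910271),
  (36451536601775282588257790208640644914970026018416706884954019300527483710750022289559502748385279,
    17498005798240223879632348058117512574914308046820877596167892160842481722704135729931503814158843903),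
  (17461687760871958098728301181275181164843420923763948321351226430777203957692845033413423752307277823,
    17497872299050478822752198369260876977907145377788230305369770470741992833971274439897127310308933632),
  (13433090944040871997750549537543397178991368312338691831016536941812767101026182970889964587948441599,
    17497202847534783176334562441215953563664626902212824528310427716608705410678586507130211132000698367),
  (8440219254663777849651585808867205450159926226835640692369731790450296955136799713130721212121481216,
    9127041278359984705492066583424105610169280947952490886150769735667135711694538853383031560771469311),
  (13122701397919027003948579322765172608143605956416354040379151732044753014590518710981931440401285119,
    8371767470633422908133406609241882671816803044126083568351132250283406864816889411062968139596693504),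
  (17498005798264095394980017816940970922825355447145699491406164851279623993595007385788105416184430591,
    0),
  (5601848934919836737238225643125789942891538082581324689249386235724548574349175942004342784,
    17498005796736318412729153252239636656518321826357098196156712663302518656579221410965602886546882559),
  (17498005793935393945269234883620523834955426854911329154866050318677825538716947123791014915544711167,
    17498005796736318412729153252239636656518321826357098196156712663302518656579221410965602886546882559),
  (17496937804746134939938820306087886146768054094884521165021191330475388365178463361152793648765599743,
    1067993517960455041197510853084776057301352261178326384973520804235628416544024635311767418830848),
  (86632643177155024489079301217326440692462556623457302926891179717694712286137139892696743409614848,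
    17498005786041879536973101299330296792369086480836889129410547347462781297468719587208085179084046335),
  (17412441158790080707204566457918957700237085048040762483193928445546867156497320769347403971110633471,
    17496937792523919081931903788477212016311785128575710803025573826658545669052175562572773411665215487),
  (13309203695957459212971638278585563156344411451574501511203196641718894760939679284334723547583741951,
    17484386906767609028045921198656712248356152875278873277653695450120327958269600481425450091291869183),
  (12950754376283061034479453467406193919338593104118324268067357338179220931880878804223627396210753535,
    6268957120497378233612245892290060461254523620967808755964883799069791704099472275960825620711079936),
  (8736053442806231489129500437152357233592579896539837456904325697215514320194204692484391641238470656,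
    11242667569263203528301868542935169136040034398044716949193750453369128324820942014189935120365912063),
  (17361035629585667035946437050032848393476457019649579132533310808178024153679323810517882972359622655,
    13569124923540848052072744282230914868572780140457244325235372241568936981701531420337353273069010979),
  (4065048744560180506588860956673124419556474647048919834055716105079465932607955229612741217858093055,
    13432957184110521970056180806325713465583801028718090150978575170286300689980655984310828399196635100),
  (13308535138458360761261828127658625798971403928464798408051559578457434133871623617471361437879238655,
    4189470659805734633718189689282345123853951518680901083354605272822189859723383768388803015452131328),
  (17497337780834160168950831287935696704988732872806554258935876237925224510257228869364365095436550143,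
    3929147090844617947967001360462839994950968879662553281039309362260578366963578793044235796671889408),
  (17497872299001741145584039278329649517588756935458385602569329649234621259647867517644033834021289984,
    69388234013069591304236954402864662273807464207937765236819617968883055599394177923493338112065535),
  (17488393837978193419299140257186298127459349634340616621887940380456347611594637329984248659402817535,
    43921252140894422905936001787878022319455451723095969179130002124900618368310980190636174114553855),
  (12371520092114243043887487849674128896773750010260753156573277485240464544466091423090764754479742975,
    6241470938900567414102731297887348229874217199087614621588831198482174549995183795155417631763202048),
  (16876185337533927924776362428262777832437894007360773545114839809052388057255370958473459893736046592,
    16359772978571339525394546394134586989563631466722732896716603008082999368353640937495097198971453439),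
  (17485056340147915535544277433863466601676702595751045059736956340069656000176334196133324197411684352,
    31197131160752292159308586504439702889214543133657641772026165428128344083067317223453496895864831),
  (17480892796009124292741745678496823208647252386756150850564677623508948915277128122694923120730439679,
    3995555769530053985341241085890764048677073185340286683166473312779795960718238628994827821881753599),
  (137103667868173415913730455764758126356061096528767649670975733202088733600404192142260241101225984,
    17360902130395921979066287361176212796469294350616931841735189118077535264946462520483506537229189119),
  (17498005798264095394980017816940970922825355447145699491406164851279623988643148058950444054038446079,
    17360902130395921979066287361176212796469294350616931841735189118077535264946462520483506537229189119),
  (286889777386385115751781314986807779242869393613505857216974809538698280153269457203712591411544063,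
    17211116020877710279228236501954163143582486053532193634189190041740925713441737928584392824772886528),
  (17498005798264095394980017816940970922825355447145699491406164851279623993595007385788105416184430591,
    17222997467389278221871658772271641088070257239892280447275483244272513203900749914972649047491346431),
  (8466919111164437913475801929522126081163240134729295449420156746773819829939623741628639511675142144,
    9031086687099657481504215887418844841662115312416404041986008104505804163655383644159465904509288447),
  (17494801799122260745804239747182149687917875670767515420049576001812784545093953360262323242755162111,
    16946921142996500593722102216749226477257857680377683076759828116461491304343602123882181197754793983),
  (12986801178362828704703817548633533952669323818635101529784852355474080952245722909640051243211554815,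
    4528292516188633970935360441956793387072853264689451183780888828668120799155529600548237869668368384),
  (17388002484538426406046774161150148799774011561132328277448721115616900777130259096662228844368887808,
    16387292539548917555876692104855460919116829418226892739540542595127054755688502665276606885614583807),
  (13090396568229250725907314971601938238569033027851620877009459820592017145075046257288126520098816000,
    4407609230034844670969941753481303881747105062288303898584052070686044285235968710271634536094760959),
  (8749002899132047695592770000328214263921895080578624461515735385641374560081496111122397068083068927,
    10833726246190855937907550093691968325264917337392942849171395034874298449159408869716463704942313471),
  (17498005798264095394980017816940970922825355447145699491406164851279623993595007385788105416184430591,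
    0),
  (17483988364716606542254200524917323426222981556263256025549924607140214283410214758849826231379034112,
    14017433547488852725817292023647496602373890882443465856240244139409710184792626938279184805396479),
  (9583239354473166021855514535663240970022490151040247875218986647182954081682062291041149334281256959,
    7915834455896843112217886329330381635595742367961279034773820011955687140688218479722715293245505536),
  (5740465140449492562384435298131104401259192684238855227031006033967109394123088413485962878343184383,
    11893175816007627338775480859952066174107858780481842623065127672354119433146606582527852900062855167),
  (15446390231674107976787413930965549210013882033827485413670363099911275828070319072790302601382985727,
    15175119915288058964427617248681149904930489998677488696290425389828066160720943852338881876939767808),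
  (17362370640071070888800119475798771270283659429570701132716195996238019159920319775562395053962821632,
    11893175816007627338775480859952066174107858780481842623065127672354119433146606582527852900062855167),
  (17498005798264095394980017816940970922825355447145699491406164851279623993595007385788105416184430591,
    7927715865232504486756937525248725766612362115132067663456776640377062393322464336709476055366238207)]

/-- The index of an edge outside the pieces. -/
def outerIndex : OuterDart → ℕ
  | .inl (p, s, t) =>
    match portMate p s t with
    | .inl _ => 17 + 2 * junction (if s then p else p - 1) + t
    | .inr (.inl (s', t', i)) => 9 * s'.toNat + 3 * t' + i
    | .inr (.inr (x, i)) => 28 + 2 * x + i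
  | .inr (.inl (s, t, i)) => 9 * s.toNat + 3 * t + i
  | .inr (.inr (x, i)) => (![![28, 29, 38], ![30, 31, 39], ![32, 33, 40], ![34, 35, 41],
      ![36, 37, 42], ![38, 41, 43], ![39, 40, 44], ![42, 43, 44]] : Fin 8 → Fin 3 → ℕ) x i

theorem outerIndex_mate : ∀ d, outerIndex (mate d) = outerIndex d := by decide +kernel

theorem outerIndex_lt : ∀ d, outerIndex d < 45 := by decide +kernel

set_option synthInstance.maxSize 1000 in
theorem eq_or_of_outerIndex_eq :
    ∀ d d', outerIndex d' = outerIndex d → d' = d ∨ d' = mate d := by decide +kernel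

def redBits (e : ℕ) : ℕ := (certificate.getD e (0, 0)).1

def blueBits (e : ℕ) : ℕ := (certificate.getD e (0, 0)).2

/-- At a vertex with the edges `e₀`, `e₁`, `e₂`, the colours add up to zero in every colouring in
which the vertex is not removed. -/
def vertexCheck (e₀ e₁ e₂ : ℕ) : Bool :=
  let mask := 2 ^ e₀ ||| 2 ^ e₁ ||| 2 ^ e₂
  (redBits e₀ ^^^ redBits e₁ ^^^ redBits e₂) ||| mask == mask &&
    (blueBits e₀ ^^^ blueBits e₁ ^^^ blueBits e₂) ||| mask == mask

theorem redBits_or_blueBits : ∀ e < 333, redBits e ||| blueBits e = 2 ^ 333 - 1 := by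
  decide +kernel

theorem vertexCheck_leaf : ∀ (p : Fin 8) (j : Fin 5) (t : Fin 3), vertexCheck
    (36 * p + 3 + 3 * j + t) (36 * p + 3 + 3 * (j + 1) + t) (36 * p + 21 + 3 * j + t) = true := by
  decide +kernel

theorem vertexCheck_ctr : ∀ (p : Fin 8) (j : Fin 5), vertexCheck
    (36 * p + 21 + 3 * j) (36 * p + 21 + 3 * j + 1) (36 * p + 21 + 3 * j + 2) = true := by
  decide +kernel

theorem vertexCheck_port_true : ∀ (p : Fin 8) (t : Fin 3), vertexCheck
    (36 * p + t) (36 * p + 3 + t) (288 + outerIndex (.inl (p, true, t))) = true := by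
  decide +kernel

theorem vertexCheck_port_false : ∀ (p : Fin 8) (t : Fin 3), vertexCheck
    (36 * p + t) (36 * p + 18 + twist t) (288 + outerIndex (.inl (p, false, t))) = true := by
  decide +kernel

theorem vertexCheck_hub : ∀ (s : Bool) (t : Fin 3), vertexCheck
    (288 + outerIndex (.inr (.inl (s, t, 0)))) (288 + outerIndex (.inr (.inl (s, t, 1))))
    (288 + outerIndex (.inr (.inl (s, t, 2)))) = true := by
  decide +kernel

theorem vertexCheck_out : ∀ x : Fin 8, vertexCheck
    (288 + outerIndex (.inr (.inr (x, 0)))) (288 + outerIndex (.inr (.inr (x, 1))))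
    (288 + outerIndex (.inr (.inr (x, 2)))) = true := by
  decide +kernel

/-- The colour encoded by two bits, not both zero. -/
def bitColor : Bool → Bool → Kol
  | true, true => ⟨(1, 1), by decide⟩
  | true, false => ⟨(1, 0), by decide⟩
  | false, _ => ⟨(0, 1), by decide⟩

/-- The colour of the edge `e` in the colouring with the ends of the edge `k` removed. -/
def edgeColor (k e : ℕ) : Kol := bitColor ((redBits e).testBit k) ((blueBits e).testBit k)

theorem Fin.injective_three {α : Type*} {f : Fin 3 → α} (h₀ : f 0 ≠ f 1) (h₁ : f 0 ≠ f 2)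
    (h₂ : f 1 ≠ f 2) : Function.Injective f := by
  intro i j hij
  fin_cases i <;> fin_cases j <;> simp_all

theorem bitColor_ne : ∀ r₀ b₀ r₁ b₁ r₂ b₂ : Bool, (r₀ || b₀) = true → (r₁ || b₁) = true →
    (r₂ || b₂) = true → (r₀ ^^ r₁ ^^ r₂) = false → (b₀ ^^ b₁ ^^ b₂) = false →
    bitColor r₀ b₀ ≠ bitColor r₁ b₁ ∧ bitColor r₀ b₀ ≠ bitColor r₂ b₂ ∧
      bitColor r₁ b₁ ≠ bitColor r₂ b₂ := by
  decide

theorem edgeColor_ne {k e₀ e₁ e₂ : ℕ} (hk : k < 333) (h₀ : e₀ < 333) (h₁ : e₁ < 333)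
    (h₂ : e₂ < 333) (hk₀ : e₀ ≠ k) (hk₁ : e₁ ≠ k) (hk₂ : e₂ ≠ k)
    (h : vertexCheck e₀ e₁ e₂ = true) : edgeColor k e₀ ≠ edgeColor k e₁ ∧
      edgeColor k e₀ ≠ edgeColor k e₂ ∧ edgeColor k e₁ ≠ edgeColor k e₂ := by
  have hor : ∀ e < 333, ((redBits e).testBit k || (blueBits e).testBit k) = true := by
    intro e he
    rw [← Nat.testBit_or, redBits_or_blueBits e he, Nat.testBit_two_pow_sub_one]
    exact decide_eq_true hk
  rw [vertexCheck, Bool.and_eq_true, beq_iff_eq, beq_iff_eq] at h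
  have hr := congrArg (Nat.testBit · k) h.1
  have hb := congrArg (Nat.testBit · k) h.2
  simp only [Nat.testBit_or, Nat.testBit_xor, Nat.testBit_two_pow, hk₀, hk₁, hk₂, decide_false,
    Bool.or_false] at hr hb
  exact bitColor_ne _ _ _ _ _ _ (hor _ h₀) (hor _ h₁) (hor _ h₂) hr hb

/-- Folding the levels of a long chain of claws to those of a chain of five claws: the first `2 * a`
steps and the last ones go back and forth. -/
def foldLevel (a j : ℕ) : ℕ :=
  if j ≤ 2 * a then j % 2 else if j ≤ 2 * a + 4 then j - 2 * a else 4 + j % 2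

/-- The claw of the chain of five claws to which a claw of a long chain is folded. -/
def foldClaw (a j : ℕ) : ℕ := min (j - 2 * a) 4

theorem foldLevel_foldClaw (a j : ℕ) :
    (foldLevel a j = foldClaw a j ∧ foldLevel a (j + 1) = foldClaw a j + 1) ∨
      (foldLevel a j = foldClaw a j + 1 ∧ foldLevel a (j + 1) = foldClaw a j) := by
  unfold foldLevel foldClaw
  split_ifs <;> omega

theorem foldClaw_le (a j : ℕ) : foldClaw a j ≤ 4 := min_le_right _ _

theorem foldLevel_le (a j : ℕ) : foldLevel a j ≤ 5 := by
  unfold foldLevel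
  split_ifs <;> omega

theorem foldLevel_eq_iff {m g j : ℕ} (hg : g ≤ 2 * m + 5) (hj : j ≤ 2 * m + 5) :
    foldLevel (min m ((g - 2) / 2)) j = foldLevel (min m ((g - 2) / 2)) g ↔ j = g := by
  refine ⟨?_, fun h => h ▸ rfl⟩
  unfold foldLevel
  split_ifs <;> omega

theorem foldClaw_eq_iff {m g j : ℕ} (hg : g ≤ 2 * m + 4) (hj : j ≤ 2 * m + 4) :
    foldClaw (min m ((g - 1) / 2)) j = foldClaw (min m ((g - 1) / 2)) g ↔ j = g := by
  unfold foldClaw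
  omega

theorem foldLevel_zero (a : ℕ) : foldLevel a 0 = 0 := by simp [foldLevel]

theorem foldLevel_last {a m : ℕ} (h : a ≤ m) : foldLevel a (2 * m + 5) = 5 := by
  unfold foldLevel
  split_ifs <;> omega

namespace Vert

variable {m a : Fin 8 → ℕ}

/-- The edge of the short superposition to which the edge of a dart is folded. -/
def edgeIndex (a : Fin 8 → ℕ) : Vert (fun p => 2 * m p + 4) × Fin 3 → ℕ
  | (port p _ t, 0) => 36 * p + t
  | (port p true t, 1) => 36 * p + 3 + t
  | (port p false t, 1) => 36 * p + 18 + twist t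
  | (port p s t, 2) => 288 + outerIndex (.inl (p, s, t))
  | (hub s t, i) => 288 + outerIndex (.inr (.inl (s, t, i)))
  | (out x, i) => 288 + outerIndex (.inr (.inr (x, i)))
  | (leaf p j t, 0) => 36 * p + 3 + 3 * foldLevel (a p) j + t
  | (leaf p j t, 1) => 36 * p + 3 + 3 * foldLevel (a p) (j + 1) + t
  | (leaf p j t, 2) => 36 * p + 21 + 3 * foldClaw (a p) j + t
  | (ctr p j, t) => 36 * p + 21 + 3 * foldClaw (a p) j + t

theorem edgeIndex_ofOuter (e : OuterDart) :
    edgeIndex a (ofOuter e : Vert (fun p => 2 * m p + 4) × Fin 3) = 288 + outerIndex e := by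
  rcases e with ⟨p, s, t⟩ | ⟨s, t, i⟩ | ⟨x, i⟩
  · cases s <;> rfl
  · rfl
  · rfl

theorem edgeIndex_rotFun (ha : ∀ p, a p ≤ m p) (d : Vert (fun p => 2 * m p + 4) × Fin 3) :
    edgeIndex a (rotFun d) = edgeIndex a d := by
  have houter : ∀ e : OuterDart, 
      edgeIndex a (rotFun (ofOuter e : Vert (fun p => 2 * m p + 4) × Fin 3)) =
        edgeIndex a (ofOuter e : Vert (fun p => 2 * m p + 4) × Fin 3) := by
    intro e
    rw [rotFun_ofOuter, edgeIndex_ofOuter, edgeIndex_ofOuter, outerIndex_mate]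
  obtain ⟨v, i⟩ := d
  cases v with
  | port p s t =>
    fin_cases i
    · cases s <;> rfl
    · cases s
      · simp [rotFun, edgeIndex, foldLevel_last (ha p)]
      · simp [rotFun, edgeIndex, foldLevel_zero]
    · exact houter (.inl (p, s, t))
  | hub s t => exact houter (.inr (.inl (s, t, i)))
  | out x => exact houter (.inr (.inr (x, i)))
  | leaf p j t =>
    obtain ⟨j, hj⟩ := j
    fin_cases i
    · by_cases h : j = 0
      · subst h
        simp [rotFun, edgeIndex, foldLevel_zero]
      · simp [rotFun, edgeIndex, h, show j - 1 + 1 = j by omega]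
    · by_cases h : j < 2 * m p + 4
      · simp [rotFun, edgeIndex, h]
      · obtain rfl : j = 2 * m p + 4 := by omega
        simp [rotFun, edgeIndex, twist_twist, foldLevel_last (ha p)]
    · rfl
  | ctr p j => rfl

/-- Representatives of the edges. -/
inductive EdgeRep (m : Fin 8 → ℕ) : Type
  | outer (e : OuterDart)
  | cross (p : Fin 8) (t : Fin 3)
  | level (p : Fin 8) (g : Fin (2 * m p + 6)) (t : Fin 3)
  | spoke (p : Fin 8) (j : Fin (2 * m p + 5)) (t : Fin 3)

namespace EdgeRep

/-- A dart of an edge. -/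
def dart : EdgeRep m → Vert (fun p => 2 * m p + 4) × Fin 3
  | outer e => ofOuter e
  | cross p t => (port p true t, 0)
  | level p g t =>
    if h : g.1 < 2 * m p + 4 + 1 then (leaf p ⟨g, h⟩ t, 0) else (port p false (twist t), 1)
  | spoke p j t => (ctr p j, t)

/-- The edge to which an edge is folded. -/
def index (a : Fin 8 → ℕ) : EdgeRep m → ℕ
  | outer e => 288 + outerIndex e
  | cross p t => 36 * p + t
  | level p g t => 36 * p + 3 + 3 * foldLevel (a p) g + t
  | spoke p j t => 36 * p + 21 + 3 * foldClaw (a p) j + t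

theorem edgeIndex_dart (ha : ∀ p, a p ≤ m p) (x : EdgeRep m) :
    edgeIndex a x.dart = x.index a := by
  cases x with
  | outer e => exact edgeIndex_ofOuter e
  | cross p t => rfl
  | level p g t =>
    by_cases h : g.1 < 2 * m p + 4 + 1
    · simp [dart, h, edgeIndex, index]
    · have : g.1 = 2 * m p + 5 := by omega
      simp [dart, this, edgeIndex, index, foldLevel_last (ha p), twist_twist]
  | spoke p j t => rfl

theorem exists_dart_eq (d : Vert (fun p => 2 * m p + 4) × Fin 3) :
    ∃ x : EdgeRep m, d = x.dart ∨ d = rotFun x.dart := by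
  obtain ⟨v, i⟩ := d
  cases v with
  | port p s t =>
    fin_cases i
    · cases s
      · exact ⟨cross p t, .inr rfl⟩
      · exact ⟨cross p t, .inl rfl⟩
    · cases s
      · exact ⟨level p (Fin.last _) (twist t), .inl (by simp [dart, twist_twist])⟩
      · exact ⟨level p 0 t, .inr (by simp [dart, rotFun])⟩
    · exact ⟨outer (.inl (p, s, t)), .inl rfl⟩
  | hub s t => exact ⟨outer (.inr (.inl (s, t, i))), .inl rfl⟩
  | out x => exact ⟨outer (.inr (.inr (x, i))), .inl rfl⟩
  | leaf p j t =>
    fin_cases i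
    · exact ⟨level p j.castSucc t, .inl (by simp [dart]; omega)⟩
    · refine ⟨level p j.succ t, .inr ?_⟩
      obtain ⟨j, hj⟩ := j
      by_cases h : j < 2 * m p + 4
      · have h' : j ≤ 2 * m p + 3 := by omega
        simp [dart, h', rotFun]
      · obtain rfl : j = 2 * m p + 4 := by omega
        simp [dart, rotFun, twist_twist, Fin.last]
    · exact ⟨spoke p j t, .inr rfl⟩
  | ctr p j => exact ⟨spoke p j i, .inl rfl⟩

theorem index_lt (x : EdgeRep m) : x.index a < 333 := by
  cases x with
  | outer e =>
    have := outerIndex_lt e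
    simp only [index]
    omega
  | cross p t => simp only [index]; omega
  | level p g t =>
    have := foldLevel_le (a p) g
    simp only [index]
    omega
  | spoke p j t =>
    have := foldClaw_le (a p) j
    simp only [index]
    omega

/-- For every edge there is a folding under which no other edge is folded to the same edge. -/
theorem exists_index_injective (x : EdgeRep m) : ∃ a : Fin 8 → ℕ, (∀ p, a p ≤ m p) ∧
    ∀ y : EdgeRep m, y.index a = x.index a → y.dart = x.dart ∨ y.dart = rotFun x.dart := by
  have hl := fun a p (g : Fin (2 * m p + 6)) => foldLevel_le a g
  have hc := fun a p (j : Fin (2 * m p + 5)) => foldClaw_le a j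
  cases x with
  | outer e =>
    refine ⟨0, fun p => Nat.zero_le _, fun y hy => ?_⟩
    cases y with
    | outer e' =>
      rcases eq_or_of_outerIndex_eq e e' (Nat.add_left_cancel hy) with rfl | rfl
      · exact .inl rfl
      · exact .inr (rotFun_ofOuter e).symm
    | cross p t => simp only [index] at hy; omega
    | level p g t => have := hl 0 p g; simp only [index, Pi.zero_apply] at hy; omega
    | spoke p j t => have := hc 0 p j; simp only [index, Pi.zero_apply] at hy; omega
  | cross p t =>
    refine ⟨0, fun p => Nat.zero_le _, fun y hy => .inl ?_⟩
    cases y with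
    | outer e' => simp only [index] at hy; omega
    | cross q u =>
      simp only [index] at hy
      obtain rfl : q = p := by omega
      obtain rfl : u = t := by omega
      rfl
    | level q g u => have := hl 0 q g; simp only [index, Pi.zero_apply] at hy; omega
    | spoke q j u => have := hc 0 q j; simp only [index, Pi.zero_apply] at hy; omega
  | level p g t =>
    refine ⟨fun p => min (m p) ((g.1 - 2) / 2), fun p => min_le_left _ _, fun y hy => .inl ?_⟩
    have hg := hl (min (m p) ((g.1 - 2) / 2)) p g
    cases y with
    | outer e' => simp only [index] at hy; omega
    | cross q u => simp only [index] at hy; omega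
    | level q g' u =>
      have := hl (min (m q) ((g.1 - 2) / 2)) q g'
      simp only [index] at hy
      obtain rfl : q = p := by omega
      obtain rfl : u = t := by omega
      have hgg := (foldLevel_eq_iff (m := m q) (g := g.1) (j := g'.1) (by omega) (by omega)).1
        (by omega)
      rw [Fin.ext hgg]
    | spoke q j u =>
      have := hc (min (m q) ((g.1 - 2) / 2)) q j
      simp only [index] at hy
      omega
  | spoke p j t =>
    refine ⟨fun p => min (m p) ((j.1 - 1) / 2), fun p => min_le_left _ _, fun y hy => .inl ?_⟩
    have hj := hc (min (m p) ((j.1 - 1) / 2)) p j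
    cases y with
    | outer e' => simp only [index] at hy; omega
    | cross q u => simp only [index] at hy; omega
    | level q g u =>
      have := hl (min (m q) ((j.1 - 1) / 2)) q g
      simp only [index] at hy
      omega
    | spoke q j' u =>
      have := hc (min (m q) ((j.1 - 1) / 2)) q j'
      simp only [index] at hy
      obtain rfl : q = p := by omega
      obtain rfl : u = t := by omega
      have hjj := (foldClaw_eq_iff (m := m q) (g := j.1) (j := j'.1) (by omega) (by omega)).1
        (by omega)
      rw [Fin.ext hjj]

end EdgeRep

theorem edgeIndex_lt (ha : ∀ p, a p ≤ m p) (d : Vert (fun p => 2 * m p + 4) × Fin 3) :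
    edgeIndex a d < 333 := by
  obtain ⟨x, rfl | rfl⟩ := EdgeRep.exists_dart_eq d
  · rw [EdgeRep.edgeIndex_dart ha]
    exact x.index_lt
  · rw [edgeIndex_rotFun ha, EdgeRep.edgeIndex_dart ha]
    exact x.index_lt

theorem exists_edgeIndex_injective (d : Vert (fun p => 2 * m p + 4) × Fin 3) :
    ∃ a : Fin 8 → ℕ, (∀ p, a p ≤ m p) ∧
      ∀ d', edgeIndex a d' = edgeIndex a d → d' = d ∨ d' = rotFun d := by
  obtain ⟨x, hx⟩ := EdgeRep.exists_dart_eq d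
  obtain ⟨a, ha, h⟩ := x.exists_index_injective
  refine ⟨a, ha, fun d' hd => ?_⟩
  obtain ⟨y, hy⟩ := EdgeRep.exists_dart_eq d'
  have hyx : y.index a = x.index a := by
    rw [← EdgeRep.edgeIndex_dart ha, ← EdgeRep.edgeIndex_dart ha]
    rcases hx with rfl | rfl <;> rcases hy with rfl | rfl <;>
      simpa only [edgeIndex_rotFun ha] using hd
  rcases hx with rfl | rfl <;> rcases hy with rfl | rfl <;> rcases h y hyx with h | h <;>
    simp [h, rotFun_rotFun]

theorem injective_edgeColor {k : ℕ} (hk : k < 333) (ha : ∀ p, a p ≤ m p)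
    (v : Vert fun p => 2 * m p + 4) (hv : ∀ i, edgeIndex a (v, i) ≠ k) :
    Function.Injective fun i => edgeColor k (edgeIndex a (v, i)) := by
  have hlt := fun i => edgeIndex_lt ha (v, i)
  have hswap : vertexCheck (edgeIndex a (v, 0)) (edgeIndex a (v, 1)) (edgeIndex a (v, 2)) = true ∨
      vertexCheck (edgeIndex a (v, 1)) (edgeIndex a (v, 0)) (edgeIndex a (v, 2)) = true := by
    cases v with
    | port p s t =>
      cases s
      exacts [.inl (vertexCheck_port_false p t), .inl (vertexCheck_port_true p t)]
    | hub s t => exact .inl (vertexCheck_hub s t)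
    | out x => exact .inl (vertexCheck_out x)
    | leaf p j t =>
      have hj := foldClaw_le (a p) j
      have h := vertexCheck_leaf p ⟨foldClaw (a p) j, by omega⟩ t
      simp only [edgeIndex]
      rcases foldLevel_foldClaw (a p) j with ⟨h₀, h₁⟩ | ⟨h₀, h₁⟩
      · rw [h₀, h₁]
        exact .inl h
      · rw [h₀, h₁]
        exact .inr h
    | ctr p j =>
      have hj := foldClaw_le (a p) j
      exact .inl (vertexCheck_ctr p ⟨foldClaw (a p) j, by omega⟩)
  rcases hswap with h | h
  · obtain ⟨h₀, h₁, h₂⟩ := edgeColor_ne hk (hlt 0) (hlt 1) (hlt 2) (hv 0) (hv 1) (hv 2) h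
    exact Fin.injective_three h₀ h₁ h₂
  · obtain ⟨h₀, h₁, h₂⟩ := edgeColor_ne hk (hlt 1) (hlt 0) (hlt 2) (hv 1) (hv 0) (hv 2) h
    exact Fin.injective_three h₀.symm h₂ h₁

theorem critical (m : Fin 8 → ℕ) : Critical (rotation fun p => 2 * m p + 4).graph := by
  rintro u v ⟨i, rfl⟩
  obtain ⟨a, ha, h⟩ := exists_edgeIndex_injective (m := m) (u, i)
  refine (rotation _).threeEdgeColorable_induce _
    (fun d => edgeColor (edgeIndex a (u, i)) (edgeIndex a d))
    (fun d => congrArg _ (edgeIndex_rotFun ha d)) fun w hw => ?_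
  refine injective_edgeColor (edgeIndex_lt ha _) ha w fun j hj => hw ?_
  rcases h _ hj with h | h
  · exact .inl (congrArg Prod.fst h)
  · exact .inr (congrArg Prod.fst h)

end Vert

namespace Vert

variable {ℓ : Fin 8 → ℕ}

theorem isSnark (hℓ : ∀ p, 3 ≤ ℓ p) (he : ∀ p, Even (ℓ p)) : IsSnark (rotation ℓ).graph :=
  ⟨connected hℓ, (rotation ℓ).isCubic, fun h => not_threeEdgeColorable_induce he
    (h.of_embedding (SimpleGraph.Embedding.induce _))⟩

theorem strictlyCritical (m : Fin 8 → ℕ) :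
    StrictlyCritical (rotation fun p => 2 * m p + 4).graph :=
  ⟨critical m, fun h => not_threeEdgeColorable_induce (fun p => ⟨m p + 2, by ring⟩)
    (h (hub false 0) (hub false 1) (by simp))⟩

end Vert

/-- For every integer `n ≡ 6 (mod 8)` with `n ≥ 342` there exists a
cyclically 6-connected strictly critical snark of order `n`. -/
theorem exists_cyclically6Connected_strictlyCritical_snark_mod8_eq_6
    (n : ℕ) (hn : n % 8 = 6) (hn342 : 342 ≤ n) :
    ∃ G : SimpleGraph (Fin n),
      IsSnark G ∧ CyclicallyConnected G 6 ∧ StrictlyCritical G := by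
  let m : Fin 8 → ℕ := Pi.single 0 ((n - 222) / 8)
  have hm : ∑ p, m p = (n - 222) / 8 := Finset.sum_pi_single' .. |>.trans (by simp)
  have hcard : Fintype.card (Vert fun p => 2 * m p + 4) = n := by
    have : ∀ p, (2 * m p + 4 + 1) * 4 = 8 * m p + 20 := fun p => by ring
    rw [Vert.card_eq]
    simp only [this, Finset.sum_add_distrib, ← Finset.mul_sum, hm, Finset.sum_const,
      Finset.card_univ, Fintype.card_fin, smul_eq_mul]
    omega
  have hℓ : ∀ p, 3 ≤ 2 * m p + 4 := fun p => by omega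
  have φ := (Vert.rotation fun p => 2 * m p + 4).graph.overFinIso hcard
  exact ⟨_, (Vert.isSnark hℓ fun p => ⟨m p + 2, by ring⟩).iso φ,
    (Vert.cyclicallyConnected hℓ).iso φ, (Vert.strictlyCritical m).iso φ⟩
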